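/- Let X be a Banach function space over ℝⁿ. Assume the Hardy–Littlewood maximal operator M is bounded on X and that each Riesz transform R_j (j = 1,…,n) is bounded on X. Then M is bounded on the associate space X', i.e. there exists C with ‖Mf‖_{X'} ≤ C‖f‖_{X'} for all f. -/

import Mathlib

open MeasureTheory Filter Topology Bornology ENNReal NNReal

noncomputable section

/-- Euclidean space `ℝⁿ`. -/
abbrev Rn (n : ℕ) : Type := EuclideanSpace ℝ (Fin n)

/-- Axis-parallel closed cube with center `c` and half side-length `r`. -/
def Cube {n : ℕ} (c : Rn n) (r : ℝ) : Set (Rn n) := {y | ∀ i, |y i - c i| ≤ r}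

/-- The Hardy–Littlewood maximal operator (over cubes), acting on
`ℝ≥0∞`-valued functions: `Mf(x) = sup_{Q ∋ x} (1/|Q|) ∫_Q f`. -/
def maximal {n : ℕ} (f : Rn n → ℝ≥0∞) (x : Rn n) : ℝ≥0∞ :=
  ⨆ (c : Rn n) (r : ℝ) (_ : 0 < r) (_ : x ∈ Cube c r),
    (volume (Cube c r))⁻¹ * ∫⁻ y in Cube c r, f y

/-- The Hardy–Littlewood maximal operator of a real-valued function. -/
def maximalR {n : ℕ} (f : Rn n → ℝ) : Rn n → ℝ≥0∞ :=
  maximal fun y => (‖f y‖₊ : ℝ≥0∞)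

/-- The Fefferman–Stein sharp maximal function
`f^#(x) = sup_{Q ∋ x} (1/|Q|) ∫_Q |f - f_Q|`. -/
def sharpMaximal {n : ℕ} (f : Rn n → ℝ) (x : Rn n) : ℝ≥0∞ :=
  ⨆ (c : Rn n) (r : ℝ) (_ : 0 < r) (_ : x ∈ Cube c r),
    (volume (Cube c r))⁻¹ *
      ∫⁻ y in Cube c r, (‖f y - ⨍ z in Cube c r, f z‖₊ : ℝ≥0∞)

/-- A Banach function space norm over `ℝⁿ` (with Lebesgue measure), given by a
functional `ρ` on nonnegative (`ℝ≥0∞`-valued) functions satisfying the axioms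
(i)-(v) of a BFS norm. -/
structure BFSNorm (n : ℕ) where
  ρ : (Rn n → ℝ≥0∞) → ℝ≥0∞
  eq_zero_iff : ∀ f : Rn n → ℝ≥0∞, Measurable f → (ρ f = 0 ↔ f =ᵐ[volume] 0)
  smul : ∀ (f : Rn n → ℝ≥0∞) (a : ℝ≥0), ρ (fun x => (a : ℝ≥0∞) * f x) = a * ρ f
  add_le : ∀ f g : Rn n → ℝ≥0∞, ρ (fun x => f x + g x) ≤ ρ f + ρ g
  mono : ∀ f g : Rn n → ℝ≥0∞, (∀ᵐ x ∂volume, f x ≤ g x) → ρ f ≤ ρ g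
  sup_eq : ∀ (F : ℕ → Rn n → ℝ≥0∞) (f : Rn n → ℝ≥0∞),
    (∀ᵐ x ∂volume, Monotone fun k => F k x) →
    (∀ᵐ x ∂volume, (⨆ k, F k x) = f x) → ρ f = ⨆ k, ρ (F k)
  indicator_lt_top : ∀ E : Set (Rn n), MeasurableSet E → IsBounded E →
    ρ (E.indicator 1) < ⊤
  int_le : ∀ E : Set (Rn n), MeasurableSet E → IsBounded E →
    ∃ cE : ℝ≥0, ∀ f : Rn n → ℝ≥0∞, Measurable f →
      (∫⁻ x in E, f x) ≤ (cE : ℝ≥0∞) * ρ f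

/-- The `X`-norm of a real-valued function `f`, i.e. `ρ(|f|)`. -/
def BFSNorm.normR {n : ℕ} (X : BFSNorm n) (f : Rn n → ℝ) : ℝ≥0∞ :=
  X.ρ fun x => (‖f x‖₊ : ℝ≥0∞)

/-- The associate space norm `‖f‖_{X'} = sup { ∫ f g : ‖g‖_X ≤ 1 }`. -/
def assocNorm {n : ℕ} (ρ : (Rn n → ℝ≥0∞) → ℝ≥0∞) (f : Rn n → ℝ≥0∞) : ℝ≥0∞ :=
  ⨆ (g : Rn n → ℝ≥0∞) (_ : Measurable g) (_ : ρ g ≤ 1), ∫⁻ x, f x * g x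

/-- The norm of the space `MX`: `‖f‖_{MX} = ‖Mf‖_X`. -/
def MXnorm {n : ℕ} (X : BFSNorm n) : (Rn n → ℝ≥0∞) → ℝ≥0∞ :=
  fun f => X.ρ (maximal f)

/-- The constant `c_n = Γ((n+1)/2) / π^((n+1)/2)` in the Riesz transforms. -/
def rieszConst (n : ℕ) : ℝ :=
  Real.Gamma (((n : ℝ) + 1) / 2) / Real.pi ^ (((n : ℝ) + 1) / 2)

/-- The truncated Riesz transform
`R_{j,ε} f(x) = c_n ∫_{|y| > ε} f(x-y) y_j / |y|^{n+1} dy`. -/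
def rieszTrunc {n : ℕ} (j : Fin n) (ε : ℝ) (f : Rn n → ℝ) (x : Rn n) : ℝ :=
  rieszConst n * ∫ y in {y : Rn n | ε < ‖y‖}, f (x - y) * (y j / ‖y‖ ^ (n + 1))

/-- The maximal Riesz transform `R_j^⋆ f(x) = sup_{ε > 0} |R_{j,ε} f(x)|`. -/
def rieszMax {n : ℕ} (j : Fin n) (f : Rn n → ℝ) (x : Rn n) : ℝ≥0∞ :=
  ⨆ (ε : ℝ) (_ : 0 < ε), (‖rieszTrunc j ε f x‖₊ : ℝ≥0∞)

/-- The principal value Riesz transform `R_j f(x) = lim_{ε → 0⁺} R_{j,ε} f(x)`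
(a junk value if the limit does not exist). -/
def rieszPV {n : ℕ} (j : Fin n) (f : Rn n → ℝ) (x : Rn n) : ℝ :=
  limUnder (𝓝[>] (0 : ℝ)) fun ε => rieszTrunc j ε f x

set_option linter.all false

namespace RW

/-- the ambient space of dimension n+1 -/
abbrev Z (n : ℕ) : Type := Option (Fin n) → ℝ

def pt {n : ℕ} (x : Rn n) (t : ℝ) : Z n := fun o => o.elim t (fun i => x i)

def ee {n : ℕ} (i : Option (Fin n)) : Z n := Pi.single i 1

def S {n : ℕ} (z : Z n) : ℝ := ∑ i, z i ^ 2

def mm (n : ℕ) : ℝ := ((n : ℝ) + 1) / 2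

def dl {n : ℕ} (i k : Option (Fin n)) : ℝ := if i = k then 1 else 0

def K {n : ℕ} (k : Option (Fin n)) (z : Z n) : ℝ := z k * S z ^ (-mm n)

def K1 {n : ℕ} (i k : Option (Fin n)) (z : Z n) : ℝ :=
  dl i k * S z ^ (-mm n) - 2 * mm n * (z i * z k) * S z ^ (-mm n - 1)

def K2 {n : ℕ} (i k : Option (Fin n)) (z : Z n) : ℝ :=
  -(2 * mm n) * (2 * dl i k * z i + z k) * S z ^ (-mm n - 1)
    + 4 * mm n * (mm n + 1) * (z i ^ 2 * z k) * S z ^ (-mm n - 2)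

theorem mm_pos (n : ℕ) : 0 < mm n := by unfold mm; positivity

theorem S_nonneg {n : ℕ} (z : Z n) : 0 ≤ S z := Finset.sum_nonneg fun i _ => sq_nonneg _

theorem sq_le_S {n : ℕ} (z : Z n) (i) : z i ^ 2 ≤ S z :=
  Finset.single_le_sum (f := fun i => z i ^ 2) (fun i _ => sq_nonneg _) (Finset.mem_univ i)

theorem abs_le_sqrt_S {n : ℕ} (z : Z n) (i) : |z i| ≤ Real.sqrt (S z) :=
  Real.abs_le_sqrt (sq_le_S z i)

theorem continuous_S {n : ℕ} : Continuous (S : Z n → ℝ) := by unfold S; fun_prop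

theorem ee_apply {n : ℕ} (i k : Option (Fin n)) : (ee i : Z n) k = dl i k := by
  unfold ee dl; rw [Pi.single_apply]; simp [eq_comm]

theorem lineS {n : ℕ} (i) (z : Z n) : HasLineDerivAt ℝ S (2 * z i) z (ee i) := by
  unfold HasLineDerivAt S
  have h : ∀ k ∈ (Finset.univ : Finset (Option (Fin n))),
      HasDerivAt (fun s : ℝ => (z + s • ee i) k ^ 2) (2 * z k * dl i k) 0 := by
    intro k _
    have h1 : HasDerivAt (fun s : ℝ => z k + s * dl i k) (1 * dl i k) 0 :=
      ((hasDerivAt_id (0:ℝ)).mul_const (dl i k)).const_add (z k)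
    have h2 := h1.fun_pow 2
    simp only [Pi.add_apply, Pi.smul_apply, ee_apply, smul_eq_mul]
    exact h2.congr_deriv (by simp)
  have := HasDerivAt.fun_sum h
  convert this using 1
  simp [dl]

theorem lineCoord {n : ℕ} (i k) (z : Z n) :
    HasLineDerivAt ℝ (fun z : Z n => z k) (dl i k) z (ee i) := by
  unfold HasLineDerivAt
  have h1 : HasDerivAt (fun s : ℝ => z k + s * dl i k) (1 * dl i k) 0 :=
      ((hasDerivAt_id (0:ℝ)).mul_const (dl i k)).const_add (z k)
  simp only [Pi.add_apply, Pi.smul_apply, ee_apply, smul_eq_mul]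
  exact h1.congr_deriv (by simp)

theorem linePow {n : ℕ} (i) (p : ℝ) (z : Z n) (hz : 0 < S z) :
    HasLineDerivAt ℝ (fun z : Z n => S z ^ p) (2 * z i * p * S z ^ (p - 1)) z (ee i) := by
  have h := lineS i z
  unfold HasLineDerivAt at h ⊢
  have h2 := h.rpow_const (p := p) (Or.inl (by simpa using hz.ne'))
  exact h2.congr_deriv (by simp)

theorem lineK {n : ℕ} (i k) (z : Z n) (hz : 0 < S z) :
    HasLineDerivAt ℝ (K k) (K1 i k z) z (ee i) := by
  have h1 := lineCoord i k z
  have h2 := linePow i (-mm n) z hz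
  unfold HasLineDerivAt at *
  have h3 := h1.mul h2
  exact h3.congr_deriv (by simp [K1]; ring)

theorem lineK1 {n : ℕ} (i k) (z : Z n) (hz : 0 < S z) :
    HasLineDerivAt ℝ (K1 i k) (K2 i k z) z (ee i) := by
  have h1 := lineCoord i k z
  have h1' := lineCoord i i z
  have h2 := linePow i (-mm n) z hz
  have h3 := linePow i (-mm n - 1) z hz
  unfold HasLineDerivAt at *
  have h4 := (h2.const_mul (dl i k)).sub (((h1'.mul h1).const_mul (2 * mm n)).mul h3)
  have : -mm n - 1 - 1 = -mm n - 2 := by ring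
  have h5 : dl i i = 1 := by simp [dl]
  exact h4.congr_deriv (by simp [K2, this, h5]; ring)

theorem S_rpow_mul {n : ℕ} (z : Z n) (hz : 0 < S z) (p : ℝ) : S z * S z ^ (p - 1) = S z ^ p := by
  rw [Real.rpow_sub_one hz.ne']; field_simp

theorem K1_symm {n : ℕ} (i k) (z : Z n) : K1 i k z = K1 k i z := by
  unfold K1 dl; simp [eq_comm, mul_comm]

theorem K1_trace {n : ℕ} (z : Z n) (hz : 0 < S z) : ∑ i, K1 i i z = 0 := by
  unfold K1
  rw [Finset.sum_sub_distrib, ← Finset.sum_mul, ← Finset.sum_mul, ← Finset.mul_sum]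
  have : ∑ i : Option (Fin n), z i * z i = S z := by simp [S, sq]
  rw [this, mul_assoc, S_rpow_mul z hz]
  have : ∑ i : Option (Fin n), dl i i = n + 1 := by simp [dl]
  rw [this]; unfold mm; ring

theorem K2_trace {n : ℕ} (k) (z : Z n) (hz : 0 < S z) : ∑ i, K2 i k z = 0 := by
  unfold K2
  rw [Finset.sum_add_distrib, ← Finset.sum_mul, ← Finset.sum_mul, ← Finset.mul_sum,
    ← Finset.mul_sum, ← Finset.sum_mul, Finset.sum_add_distrib]
  have : ∑ i : Option (Fin n), z i ^ 2 = S z := by simp [S]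
  rw [this]
  have : S z ^ (-mm n - 1) = S z * S z ^ (-mm n - 2) := by
    rw [← S_rpow_mul z hz (-mm n - 1)]; congr 2; ring
  rw [this]
  have h1 : ∑ i : Option (Fin n), 2 * dl i k * z i = 2 * z k := by simp [dl]
  have h2 : ∑ i : Option (Fin n), z k = (n + 1) * z k := by simp
  rw [h1, h2]; unfold mm; ring

theorem abs_K_le {n : ℕ} (k) (z : Z n) (hz : 0 < S z) : |K k z| ≤ S z ^ (-(n:ℝ)/2) := by
  unfold K
  rw [abs_mul, abs_of_nonneg (Real.rpow_nonneg hz.le _)]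
  calc _ ≤ Real.sqrt (S z) * S z ^ (-mm n) := by gcongr; exact abs_le_sqrt_S z k
    _ = _ := by
      rw [Real.sqrt_eq_rpow, ← Real.rpow_add hz]; congr 1; unfold mm; ring

theorem abs_dl_le {n : ℕ} (i k : Option (Fin n)) : |dl i k| ≤ 1 := by
  unfold dl; split_ifs <;> simp

theorem abs_K1_le {n : ℕ} (i k) (z : Z n) (hz : 0 < S z) :
    |K1 i k z| ≤ (1 + 2 * mm n) * S z ^ (-mm n) := by
  unfold K1
  have h0 := mm_pos n
  have h1 : |z i * z k| ≤ S z := by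
    rw [abs_mul, ← Real.mul_self_sqrt hz.le]
    exact mul_le_mul (abs_le_sqrt_S _ _) (abs_le_sqrt_S _ _) (abs_nonneg _) (Real.sqrt_nonneg _)
  calc _ ≤ |dl i k * S z ^ (-mm n)| + |2 * mm n * (z i * z k) * S z ^ (-mm n - 1)| := abs_sub _ _
    _ = |dl i k| * S z ^ (-mm n) + 2 * mm n * |z i * z k| * S z ^ (-mm n - 1) := by
      rw [abs_mul, abs_mul, abs_mul (2 * mm n), abs_of_nonneg (Real.rpow_nonneg hz.le _),
        abs_of_nonneg (Real.rpow_nonneg hz.le _), abs_of_pos (a := 2 * mm n) (by positivity)]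
    _ ≤ 1 * S z ^ (-mm n) + 2 * mm n * S z * S z ^ (-mm n - 1) := by
      have := abs_dl_le i k
      have : 0 ≤ S z ^ (-mm n) := Real.rpow_nonneg hz.le _
      have : 0 ≤ S z ^ (-mm n - 1) := Real.rpow_nonneg hz.le _
      gcongr
    _ = _ := by rw [mul_assoc (2 * mm n), S_rpow_mul z hz]; ring

theorem abs_K2_le {n : ℕ} (i k) (z : Z n) (hz : 0 < S z) :
    |K2 i k z| ≤ (6 * mm n + 4 * mm n * (mm n + 1)) * S z ^ (-mm n - 1/2) := by
  unfold K2
  have h0 := mm_pos n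
  set r := Real.sqrt (S z) with hr
  have hi := abs_le_sqrt_S z i
  have hk := abs_le_sqrt_S z k
  have hr0 : 0 ≤ r := Real.sqrt_nonneg _
  have hrr : r * r = S z := Real.mul_self_sqrt hz.le
  have h1 : |2 * dl i k * z i + z k| ≤ 3 * r := by
    calc _ ≤ |2 * dl i k * z i| + |z k| := abs_add_le _ _
      _ = 2 * |dl i k| * |z i| + |z k| := by rw [abs_mul, abs_mul]; simp
      _ ≤ 2 * 1 * r + r := by
        have := abs_dl_le i k
        gcongr
      _ = _ := by ring
  have h2 : |z i ^ 2 * z k| ≤ S z * r := by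
    rw [abs_mul, abs_of_nonneg (sq_nonneg _)]
    have := sq_le_S z i
    gcongr
  have e1 : r * S z ^ (-mm n - 1) = S z ^ (-mm n - 1/2) := by
    rw [hr, Real.sqrt_eq_rpow, ← Real.rpow_add hz]; congr 1; ring
  have e2 : S z * S z ^ (-mm n - 2) = S z ^ (-mm n - 1) := by
    rw [← S_rpow_mul z hz (-mm n - 1)]; congr 2; ring
  have p1 : 0 ≤ S z ^ (-mm n - 1) := Real.rpow_nonneg hz.le _
  have p2 : 0 ≤ S z ^ (-mm n - 2) := Real.rpow_nonneg hz.le _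
  calc _ ≤ |-(2 * mm n) * (2 * dl i k * z i + z k) * S z ^ (-mm n - 1)| +
        |4 * mm n * (mm n + 1) * (z i ^ 2 * z k) * S z ^ (-mm n - 2)| := abs_add_le _ _
    _ = 2 * mm n * |2 * dl i k * z i + z k| * S z ^ (-mm n - 1) +
        4 * mm n * (mm n + 1) * |z i ^ 2 * z k| * S z ^ (-mm n - 2) := by
      rw [abs_mul, abs_mul, abs_mul (4 * mm n * (mm n + 1) * (z i ^ 2 * z k)),
        abs_mul (4 * mm n * (mm n + 1)), abs_of_nonneg p1, abs_of_nonneg p2, abs_neg,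
        abs_of_pos (a := 2 * mm n) (by positivity),
        abs_of_pos (a := 4 * mm n * (mm n + 1)) (by positivity)]
    _ ≤ 2 * mm n * (3 * r) * S z ^ (-mm n - 1) +
        4 * mm n * (mm n + 1) * (S z * r) * S z ^ (-mm n - 2) := by gcongr
    _ = 6 * mm n * (r * S z ^ (-mm n - 1)) +
        4 * mm n * (mm n + 1) * (r * (S z * S z ^ (-mm n - 2))) := by ring
    _ = _ := by rw [e2, e1]; ring

theorem contK {n : ℕ} (k) (z : Z n) (hz : 0 < S z) : ContinuousAt (K k) z := by
  unfold K
  exact (continuous_apply k).continuousAt.mul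
    (continuous_S.continuousAt.rpow_const (Or.inl hz.ne'))

theorem contK1 {n : ℕ} (i k) (z : Z n) (hz : 0 < S z) : ContinuousAt (K1 i k) z := by
  unfold K1
  have h1 := (continuous_S.continuousAt (x := z)).rpow_const (p := -mm n) (Or.inl hz.ne')
  have h2 := (continuous_S.continuousAt (x := z)).rpow_const (p := -mm n - 1) (Or.inl hz.ne')
  have h3 : ContinuousAt (fun z : Z n => 2 * mm n * (z i * z k)) z := by fun_prop
  exact (continuousAt_const.mul h1).sub (h3.mul h2)

theorem contK2 {n : ℕ} (i k) (z : Z n) (hz : 0 < S z) : ContinuousAt (K2 i k) z := by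
  unfold K2
  have h1 := (continuous_S.continuousAt (x := z)).rpow_const (p := -mm n - 1) (Or.inl hz.ne')
  have h2 := (continuous_S.continuousAt (x := z)).rpow_const (p := -mm n - 2) (Or.inl hz.ne')
  have h3 : ContinuousAt (fun z : Z n => -(2 * mm n) * (2 * dl i k * z i + z k)) z := by fun_prop
  have h4 : ContinuousAt (fun z : Z n => 4 * mm n * (mm n + 1) * (z i ^ 2 * z k)) z := by fun_prop
  exact (h3.mul h1).add (h4.mul h2)

/-- symmetric traceless matrices -/
theorem traceless {ι : Type*} [Fintype ι] [DecidableEq ι] (A : ι → ι → ℝ) (hs : ∀ i k, A i k = A k i)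
    (ht : ∑ i, A i i = 0) (g : ι → ℝ) (d : ℝ) (hd : d = Fintype.card ι) (hd2 : 2 ≤ d) :
    d * ∑ i, (∑ k, A i k * g k) ^ 2 ≤ (d - 1) * ((∑ i, ∑ k, A i k ^ 2) * ∑ k, g k ^ 2) := by
  set h : ι → ℝ := fun i => ∑ k, A i k * g k with hh
  set H := ∑ i, h i ^ 2
  set Gg := ∑ k, g k ^ 2
  set T := ∑ i, ∑ k, A i k ^ 2
  set p := ∑ i, g i * h i with hp
  have hp2 : p ^ 2 ≤ Gg * H := Finset.sum_mul_sq_le_sq_mul_sq _ _ _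
  have hH0 : 0 ≤ H := Finset.sum_nonneg fun i _ => sq_nonneg _
  have hG0 : 0 ≤ Gg := Finset.sum_nonneg fun i _ => sq_nonneg _
  have hT0 : 0 ≤ T := Finset.sum_nonneg fun i _ => Finset.sum_nonneg fun k _ => sq_nonneg _
  -- test matrix
  set M : ι → ι → ℝ := fun i k => (g i * h k + h i * g k) / 2 - p / d * (if i = k then 1 else 0)
  have c1 : ∑ i, ∑ k, A i k * M i k = H := by
    have e1 : ∑ i, ∑ k, A i k * (h i * g k) = H := by
      simp only [H, sq]
      refine Finset.sum_congr rfl fun i _ => ?_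
      conv_rhs => enter [2]; rw [hh]
      rw [Finset.mul_sum]
      refine Finset.sum_congr rfl fun k _ => ?_
      ring
    have e2 : ∑ i, ∑ k, A i k * (g i * h k) = H := by
      rw [Finset.sum_comm, ← e1]
      refine Finset.sum_congr rfl fun i _ => Finset.sum_congr rfl fun k _ => ?_
      rw [hs k i]; ring
    have e3 : ∑ i, ∑ k, A i k * (p / d * (if i = k then 1 else 0)) = 0 := by
      simp [← Finset.sum_mul, ht]
    calc _ = (∑ i, ∑ k, A i k * (g i * h k) + ∑ i, ∑ k, A i k * (h i * g k)) / 2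
          - ∑ i, ∑ k, A i k * (p / d * (if i = k then 1 else 0)) := by
            simp only [← Finset.sum_add_distrib, ← Finset.sum_sub_distrib, Finset.sum_div]
            refine Finset.sum_congr rfl fun i _ => Finset.sum_congr rfl fun k _ => ?_
            simp only [M]; ring
      _ = H := by rw [e1, e2, e3]; ring
  have c2 : ∑ i, ∑ k, M i k ^ 2 = (Gg * H + p ^ 2) / 2 - p ^ 2 / d := by
    have e1 : ∑ i, ∑ k, (g i ^ 2 * h k ^ 2) = Gg * H := by
      rw [Finset.sum_mul_sum]
    have e2 : ∑ i, ∑ k, (h i ^ 2 * g k ^ 2) = H * Gg := by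
      rw [Finset.sum_mul_sum]
    have e3 : ∑ i, ∑ k, ((g i * h i) * (g k * h k)) = p * p := by
      rw [Finset.sum_mul_sum]
    have e4 : ∑ i, ∑ k, ((g i * h k + h i * g k) * (if i = k then 1 else 0)) = 2 * p := by
      simp [hp, Finset.mul_sum]
      refine Finset.sum_congr rfl fun i _ => ?_
      ring
    have e5 : ∑ i : ι, ∑ k, (if i = k then (1:ℝ) else 0) = d := by
      simp [hd]
    calc _ = (∑ i, ∑ k, (g i ^ 2 * h k ^ 2) + ∑ i, ∑ k, (h i ^ 2 * g k ^ 2)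
              + 2 * ∑ i, ∑ k, ((g i * h i) * (g k * h k))) / 4
            - p / d * ∑ i, ∑ k, ((g i * h k + h i * g k) * (if i = k then 1 else 0))
            + (p / d) ^ 2 * ∑ i : ι, ∑ k, (if i = k then (1:ℝ) else 0) := by
            simp only [← Finset.sum_add_distrib, ← Finset.sum_sub_distrib, Finset.sum_div,
              Finset.mul_sum]
            refine Finset.sum_congr rfl fun i _ => Finset.sum_congr rfl fun k _ => ?_
            simp only [M]; split_ifs <;> ring
      _ = _ := by
        rw [e1, e2, e3, e4, e5]; field_simp; ring
  have c3 : H ^ 2 ≤ T * ((Gg * H + p ^ 2) / 2 - p ^ 2 / d) := by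
    have := Finset.sum_mul_sq_le_sq_mul_sq (Finset.univ : Finset (ι × ι)) (fun q => A q.1 q.2)
      (fun q => M q.1 q.2)
    simp only [Fintype.sum_prod_type] at this
    rwa [c1, c2] at this
  have c4 : (Gg * H + p ^ 2) / 2 - p ^ 2 / d ≤ Gg * H * (1 - 1 / d) := by
    have : 0 ≤ 1/2 - 1/d := by
      have : 1/d ≤ 1/2 := one_div_le_one_div_of_le (by norm_num) hd2
      linarith
    have := mul_le_mul_of_nonneg_right hp2 this
    have e : p^2 / d = p^2 * (1/d) := by ring
    rw [e]; nlinarith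
  rcases hH0.eq_or_lt with h0 | h0
  · rw [← h0]; simp; have : 0 ≤ d - 1 := by linarith
    positivity
  · have c5 : H ^ 2 ≤ T * (Gg * H * (1 - 1 / d)) := c3.trans (by gcongr)
    have c6 : H ≤ T * Gg * (1 - 1 / d) := by
      have : H * H ≤ H * (T * Gg * (1 - 1 / d)) := by nlinarith
      exact le_of_mul_le_mul_left this h0
    have hdp : 0 < d := by linarith
    calc d * H ≤ d * (T * Gg * (1 - 1 / d)) := by gcongr
      _ = _ := by field_simp

end RW

namespace RW

structure BC {n : ℕ} (f : Rn n → ℝ) (B N : ℝ) : Prop where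
  meas : Measurable f
  bd : ∀ y, |f y| ≤ B
  supp : ∀ y, N < ‖y‖ → f y = 0
  hN : 0 ≤ N

theorem BC.integrable {n : ℕ} {f : Rn n → ℝ} {B N : ℝ} (h : BC f B N) : Integrable f := by
  have h1 : IntegrableOn f (Metric.closedBall 0 N) := by
    refine Measure.integrableOn_of_bounded (M := B) ?_ h.meas.aestronglyMeasurable ?_
    · exact (measure_closedBall_lt_top).ne
    · exact Eventually.of_forall fun y => h.bd y
  refine (integrableOn_iff_integrable_of_support_subset ?_).1 h1
  intro y hy
  simp only [Metric.mem_closedBall, dist_zero_right]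
  by_contra hc
  exact hy (h.supp y (not_le.1 hc))

def pot {n : ℕ} (k : Z n → ℝ) (f : Rn n → ℝ) (z : Z n) : ℝ := ∫ y, k (z - pt y 0) * f y

@[simp] theorem pt_none {n : ℕ} (x : Rn n) (t : ℝ) : pt x t none = t := rfl
@[simp] theorem pt_some {n : ℕ} (x : Rn n) (t : ℝ) (i) : pt x t (some i) = x i := rfl

theorem continuous_pt {n : ℕ} : Continuous (fun p : Rn n × ℝ => pt p.1 p.2) := by
  refine continuous_pi fun o => ?_
  cases o with
  | none => exact continuous_snd
  | some i => simp only [pt_some]; fun_prop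

theorem continuous_pt0 {n : ℕ} : Continuous (fun y : Rn n => pt y 0) :=
  continuous_pt.comp (by fun_prop : Continuous fun y : Rn n => (y, (0:ℝ)))

theorem S_ge {n : ℕ} (z : Z n) (y : Rn n) : z none ^ 2 ≤ S (z - pt y 0) := by
  have := sq_le_S (z - pt y 0) none
  simpa using this

theorem S_pos {n : ℕ} (z : Z n) (hz : 0 < z none) (y : Rn n) : 0 < S (z - pt y 0) :=
  lt_of_lt_of_le (by positivity) (S_ge z y)

theorem S_pt {n : ℕ} (x : Rn n) (t : ℝ) : S (pt x t) = ‖x‖ ^ 2 + t ^ 2 := by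
  unfold S
  rw [Fintype.sum_option, EuclideanSpace.real_norm_sq_eq]
  simp [add_comm]

theorem pt_sub {n : ℕ} (x y : Rn n) (t s : ℝ) : pt x t - pt y s = pt (x - y) (t - s) := by
  funext o; cases o <;> simp

structure Ker {n : ℕ} (k : Z n → ℝ) (C a : ℝ) : Prop where
  cont : ∀ z, 0 < S z → ContinuousAt k z
  bd : ∀ z, 0 < S z → |k z| ≤ C * S z ^ (-a)
  hC : 0 ≤ C
  ha : 0 ≤ a

theorem Ker.bd' {n : ℕ} {k : Z n → ℝ} {C a : ℝ} (hk : Ker k C a) (z : Z n) (τ : ℝ) (hτ : 0 < τ)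
    (hz : τ ≤ S z) : |k z| ≤ C * τ ^ (-a) := by
  refine (hk.bd z (hτ.trans_le hz)).trans ?_
  have h0 : -a ≤ 0 := by have := hk.ha; linarith
  exact mul_le_mul_of_nonneg_left (Real.rpow_le_rpow_of_nonpos hτ hz h0) hk.hC

theorem kerK {n : ℕ} (k : Option (Fin n)) : Ker (K k) 1 ((n:ℝ)/2) :=
  ⟨contK k, fun z hz => by
    have := abs_K_le k z hz
    rw [one_mul]; convert this using 2; ring, by norm_num, by positivity⟩

theorem kerK1 {n : ℕ} (i k : Option (Fin n)) : Ker (K1 i k) (1 + 2 * mm n) (mm n) :=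
  ⟨contK1 i k, fun z hz => abs_K1_le i k z hz, by have := mm_pos n; positivity, (mm_pos n).le⟩

theorem kerK2 {n : ℕ} (i k : Option (Fin n)) :
    Ker (K2 i k) (6 * mm n + 4 * mm n * (mm n + 1)) (mm n + 1/2) :=
  ⟨contK2 i k, fun z hz => by
    have := abs_K2_le i k z hz
    convert this using 3; ring, by have := mm_pos n; positivity, by have := mm_pos n; positivity⟩

theorem Ker.cont_shift {n : ℕ} {k : Z n → ℝ} {C a : ℝ} (hk : Ker k C a) (z : Z n) (hz : 0 < z none) :
    Continuous (fun y : Rn n => k (z - pt y 0)) := by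
  rw [continuous_iff_continuousAt]
  intro y
  exact ContinuousAt.comp (f := fun y : Rn n => z - pt y 0) (hk.cont _ (S_pos z hz y))
    (continuous_const.sub continuous_pt0).continuousAt

theorem Ker.integrable {n : ℕ} {k : Z n → ℝ} {C a : ℝ} (hk : Ker k C a) {f : Rn n → ℝ} {B N : ℝ}
    (hf : BC f B N) (z : Z n) (hz : 0 < z none) : Integrable (fun y => k (z - pt y 0) * f y) := by
  refine hf.integrable.bdd_mul (c := C * (z none ^ 2) ^ (-a))
    (hk.cont_shift z hz).aestronglyMeasurable (Eventually.of_forall fun y => ?_)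
  exact hk.bd' _ _ (by positivity) (S_ge z y)

theorem pot_line {n : ℕ} {k k' : Z n → ℝ} {C a C' a' : ℝ} (hk : Ker k C a) (hk' : Ker k' C' a')
    (v : Z n) (hv : ∀ z, 0 < S z → HasLineDerivAt ℝ k (k' z) z v)
    {f : Rn n → ℝ} {B N : ℝ} (hf : BC f B N) (z : Z n) (hz : 0 < z none) :
    HasLineDerivAt ℝ (pot k f) (pot k' f z) z v := by
  unfold HasLineDerivAt
  have hc : Continuous (fun s : ℝ => (z + s • v) none) := by
    simp only [Pi.add_apply, Pi.smul_apply]; fun_prop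
  set s0 : Set ℝ := {s : ℝ | z none / 2 < (z + s • v) none} with hs0
  have hs : s0 ∈ 𝓝 (0:ℝ) := by
    refine (isOpen_lt continuous_const hc).mem_nhds ?_
    simp [hs0]; linarith
  have key := hasDerivAt_integral_of_dominated_loc_of_deriv_le (μ := (volume : Measure (Rn n)))
    (F := fun (s : ℝ) y => k (z + s • v - pt y 0) * f y)
    (F' := fun (s : ℝ) y => k' (z + s • v - pt y 0) * f y) (x₀ := (0:ℝ)) (s := s0)
    (bound := fun y => C' * ((z none / 2) ^ 2) ^ (-a') * |f y|) hs ?_ ?_ ?_ ?_ ?_ ?_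
  · have := key.2
    simpa [pot] using this
  · filter_upwards [hs] with s h
    have h0 : 0 < (z + s • v) none := lt_trans (by positivity) h
    exact (hk.integrable hf _ h0).aestronglyMeasurable
  · simpa using hk.integrable hf z hz
  · simpa using (hk'.integrable hf z hz).aestronglyMeasurable
  · refine Eventually.of_forall fun y s h => ?_
    rw [norm_mul]
    simp only [Real.norm_eq_abs]
    gcongr
    refine hk'.bd' _ _ (by positivity) (le_trans ?_ (S_ge _ y))
    have : z none / 2 < (z + s • v) none := h
    gcongr
  · exact hf.integrable.abs.const_mul _
  · refine Eventually.of_forall fun y s h => ?_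
    have h0 : 0 < (z + s • v) none := lt_trans (by positivity) (show z none / 2 < _ from h)
    have h1 := hv (z + s • v - pt y 0) (S_pos _ h0 y)
    unfold HasLineDerivAt at h1
    have h2 : HasDerivAt (fun s' : ℝ => k (z + s' • v - pt y 0)) (k' (z + s • v - pt y 0)) s := by
      have h1' : HasDerivAt (fun t : ℝ => k (z + s • v - pt y 0 + t • v)) (k' (z + s • v - pt y 0))
        (s - s) := by simpa using h1
      have h4 := HasDerivAt.comp_sub_const s s h1'
      refine h4.congr_of_eventuallyEq (Eventually.of_forall fun s' => ?_)
      simp only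
      congr 1
      rw [sub_smul]; abel
    exact h2.mul_const _

theorem pot_cont {n : ℕ} {k : Z n → ℝ} {C a : ℝ} (hk : Ker k C a)
    {f : Rn n → ℝ} {B N : ℝ} (hf : BC f B N) (z : Z n) (hz : 0 < z none) :
    ContinuousAt (pot k f) z := by
  unfold pot
  have ho : {w : Z n | z none / 2 < w none} ∈ 𝓝 z := by
    refine (isOpen_lt continuous_const (continuous_apply none)).mem_nhds ?_
    simp; linarith
  refine continuousAt_of_dominated (bound := fun y => C * ((z none / 2) ^ 2) ^ (-a) * |f y|) ?_ ?_ ?_ ?_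
  · filter_upwards [ho] with w hw
    exact (hk.integrable hf _ (lt_trans (by positivity) hw)).aestronglyMeasurable
  · filter_upwards [ho] with w hw
    refine Eventually.of_forall fun y => ?_
    rw [norm_mul]
    simp only [Real.norm_eq_abs]
    gcongr
    refine hk.bd' _ _ (by positivity) (le_trans ?_ (S_ge _ y))
    have : z none / 2 < w none := hw
    gcongr
  · exact hf.integrable.abs.const_mul _
  · refine Eventually.of_forall fun y => ?_
    refine ContinuousAt.mul ?_ continuousAt_const
    exact ContinuousAt.comp (f := fun w : Z n => w - pt y 0) (hk.cont _ (S_pos z hz y))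
      (by fun_prop)

theorem pot_bound {n : ℕ} {k : Z n → ℝ} {C a : ℝ} (hk : Ker k C a)
    {f : Rn n → ℝ} {B N : ℝ} (hf : BC f B N) (z : Z n) (hz : 0 < z none) (L M : ℝ) (hL : 0 < L)
    (hM : 0 < M) (h : ∀ y : Rn n, ‖y‖ ≤ N → M ≤ L * √(S (z - pt y 0))) :
    |pot k f z| ≤ C * (M / L) ^ (-(2 * a)) * ∫ y, |f y| := by
  unfold pot
  rw [← integral_const_mul]
  refine abs_integral_le_integral_abs.trans ?_
  refine integral_mono (hk.integrable hf z hz).abs (hf.integrable.abs.const_mul _) fun y => ?_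
  simp only [abs_mul]
  by_cases hy : ‖y‖ ≤ N
  · gcongr
    have h1 : (M / L) ^ 2 ≤ S (z - pt y 0) := by
      have : M / L ≤ √(S (z - pt y 0)) := by
        rw [div_le_iff₀ hL, mul_comm]; exact h y hy
      calc _ ≤ √(S (z - pt y 0)) ^ 2 := by gcongr
        _ = _ := Real.sq_sqrt (S_nonneg _)
    refine (hk.bd' _ _ (by positivity) h1).trans (le_of_eq ?_)
    rw [← Real.rpow_natCast, ← Real.rpow_mul (by positivity)]
    congr 2; push_cast; ring
  · rw [hf.supp y (not_le.1 hy)]; simp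

theorem sqrtS_ge {n : ℕ} (z : Z n) (hz : 0 < z none) (y : Rn n) : z none ≤ √(S (z - pt y 0)) :=
  Real.le_sqrt_of_sq_le (S_ge z y)

theorem norm_bd {n : ℕ} (z : Z n) (τ N : ℝ) (hτ : 0 < τ) (hN : 0 ≤ N) (hz : τ ≤ z none) (y : Rn n)
    (hy : ‖y‖ ≤ N) : 1 + ‖z‖ ≤ (1 + (N + 1) / τ) * √(S (z - pt y 0)) := by
  set r := √(S (z - pt y 0)) with hr
  have hr1 : τ ≤ r := hz.trans (sqrtS_ge z (hτ.trans_le hz) y)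
  have hr0 : 0 < r := hτ.trans_le hr1
  have h1 : ‖z‖ ≤ r + N := by
    refine (pi_norm_le_iff_of_nonneg (by positivity)).2 fun o => ?_
    have h2 := abs_le_sqrt_S (z - pt y 0) o
    rw [← hr] at h2
    have h3 : |pt y 0 o| ≤ N := by
      cases o with
      | none => simpa using hN
      | some i => exact (PiLp.norm_apply_le y i).trans hy
    have h4 : z o = (z - pt y 0) o + pt y 0 o := by simp
    rw [Real.norm_eq_abs, h4]
    exact (abs_add_le _ _).trans (add_le_add h2 h3)
  have h2 : N + 1 ≤ (N + 1) / τ * r := by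
    rw [div_mul_eq_mul_div, le_div_iff₀ hτ]; gcongr
  linarith

theorem norm_bd' {n : ℕ} (x : Rn n) (t τ N : ℝ) (hτ : 0 < τ) (hN : 0 ≤ N) (hz : τ ≤ t) (y : Rn n)
    (hy : ‖y‖ ≤ N) : 1 + ‖x‖ ≤ (1 + (N + 1) / τ) * √(S (pt x t - pt y 0)) := by
  set r := √(S (pt x t - pt y 0)) with hr
  have hr1 : τ ≤ r := hz.trans (sqrtS_ge (pt x t) (hτ.trans_le hz) y)
  have hr0 : 0 < r := hτ.trans_le hr1
  have h1 : ‖x‖ ≤ r + N := by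
    have h2 : ‖x - y‖ ≤ r := by
      refine Real.le_sqrt_of_sq_le ?_
      rw [pt_sub, S_pt]; nlinarith [sq_nonneg (t - 0)]
    calc ‖x‖ = ‖(x - y) + y‖ := by simp
      _ ≤ ‖x - y‖ + ‖y‖ := norm_add_le _ _
      _ ≤ _ := by gcongr
  have h2 : N + 1 ≤ (N + 1) / τ * r := by
    rw [div_mul_eq_mul_div, le_div_iff₀ hτ]; gcongr
  linarith

theorem pot_bdz {n : ℕ} {k : Z n → ℝ} {C a : ℝ} (hk : Ker k C a)
    {f : Rn n → ℝ} {B N : ℝ} (hf : BC f B N) (τ : ℝ) (hτ : 0 < τ) :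
    ∃ D : ℝ, 0 ≤ D ∧ ∀ z : Z n, τ ≤ z none → |pot k f z| ≤ D * (1 + ‖z‖) ^ (-(2 * a)) := by
  have hN := hf.hN
  have hC := hk.hC
  refine ⟨C * ((1 + (N + 1) / τ)⁻¹) ^ (-(2 * a)) * ∫ y, |f y|, by positivity, fun z hz => ?_⟩
  have := pot_bound hk hf z (hτ.trans_le hz) (1 + (N + 1) / τ) (1 + ‖z‖) (by positivity)
    (by positivity) (fun y hy => norm_bd z τ N hτ hN hz y hy)
  refine this.trans (le_of_eq ?_)
  rw [div_eq_mul_inv, Real.mul_rpow (by positivity) (by positivity)]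
  ring

theorem pot_bdx {n : ℕ} {k : Z n → ℝ} {C a : ℝ} (hk : Ker k C a)
    {f : Rn n → ℝ} {B N : ℝ} (hf : BC f B N) (τ : ℝ) (hτ : 0 < τ) :
    ∃ D : ℝ, 0 ≤ D ∧ ∀ (x : Rn n) (t : ℝ), τ ≤ t → |pot k f (pt x t)| ≤ D * (1 + ‖x‖) ^ (-(2 * a)) := by
  have hN := hf.hN
  have hC := hk.hC
  refine ⟨C * ((1 + (N + 1) / τ)⁻¹) ^ (-(2 * a)) * ∫ y, |f y|, by positivity, fun x t hz => ?_⟩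
  have := pot_bound hk hf (pt x t) (hτ.trans_le hz) (1 + (N + 1) / τ) (1 + ‖x‖) (by positivity)
    (by positivity) (fun y hy => norm_bd' x t τ N hτ hN hz y hy)
  refine this.trans (le_of_eq ?_)
  rw [div_eq_mul_inv, Real.mul_rpow (by positivity) (by positivity)]
  ring

def G {n : ℕ} (f : Rn n → ℝ) (k : Option (Fin n)) : Z n → ℝ := pot (K k) f
def G1 {n : ℕ} (f : Rn n → ℝ) (i k : Option (Fin n)) : Z n → ℝ := pot (K1 i k) f
def G2 {n : ℕ} (f : Rn n → ℝ) (i k : Option (Fin n)) : Z n → ℝ := pot (K2 i k) f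


theorem lineG {n : ℕ} {f : Rn n → ℝ} {B N : ℝ} (hf : BC f B N) (z : Z n) (hz : 0 < z none) (i k) : HasLineDerivAt ℝ (G f k) (G1 f i k z) z (ee i) :=
  pot_line (kerK k) (kerK1 i k) _ (fun z hz => lineK i k z hz) hf z hz

theorem lineG1 {n : ℕ} {f : Rn n → ℝ} {B N : ℝ} (hf : BC f B N) (z : Z n) (hz : 0 < z none) (i k) : HasLineDerivAt ℝ (G1 f i k) (G2 f i k z) z (ee i) :=
  pot_line (kerK1 i k) (kerK2 i k) _ (fun z hz => lineK1 i k z hz) hf z hz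

theorem G1_symm {n : ℕ} {f : Rn n → ℝ} {B N : ℝ} (hf : BC f B N) (z : Z n) (hz : 0 < z none) (i k) : G1 f i k z = G1 f k i z := by
  unfold G1 pot; simp only [K1_symm i k]

theorem G1_trace {n : ℕ} {f : Rn n → ℝ} {B N : ℝ} (hf : BC f B N) (z : Z n) (hz : 0 < z none) : ∑ i, G1 f i i z = 0 := by
  unfold G1 pot
  rw [← integral_finset_sum _ fun i _ => (kerK1 i i).integrable hf z hz]
  simp only [← Finset.sum_mul]
  simp [K1_trace _ (S_pos z hz _)]

theorem G2_trace {n : ℕ} {f : Rn n → ℝ} {B N : ℝ} (hf : BC f B N) (z : Z n) (hz : 0 < z none) (k) : ∑ i, G2 f i k z = 0 := by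
  unfold G2 pot
  rw [← integral_finset_sum _ fun i _ => (kerK2 i k).integrable hf z hz]
  simp only [← Finset.sum_mul]
  simp [K2_trace _ _ (S_pos z hz _)]

theorem contG {n : ℕ} {f : Rn n → ℝ} {B N : ℝ} (hf : BC f B N) (z : Z n) (hz : 0 < z none) (k) : ContinuousAt (G f k) z := pot_cont (kerK k) hf z hz

end RW

namespace RW

theorem max_test (φ φ1 : ℝ → ℝ) (φ2 : ℝ) (hmax : IsLocalMax φ 0)
    (h1 : ∀ᶠ s in 𝓝 0, HasDerivAt φ (φ1 s) s) (h2 : HasDerivAt φ1 φ2 0) : φ2 ≤ 0 := by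
  by_contra hc
  push Not at hc
  have e1 : deriv φ =ᶠ[𝓝 0] φ1 := h1.mono fun s hs => hs.deriv
  have h2' : HasDerivAt (deriv φ) φ2 0 := h2.congr_of_eventuallyEq e1
  have z1 : deriv φ 0 = 0 := hmax.deriv_eq_zero
  have hmin : IsLocalMin φ 0 := isLocalMin_of_deriv_deriv_pos (by rw [h2'.deriv]; exact hc) z1
    h1.self_of_nhds.continuousAt
  have e2 : φ =ᶠ[𝓝 0] fun _ => φ 0 := by
    filter_upwards [hmax, hmin] with s a b
    exact le_antisymm a b
  have e3 : deriv φ =ᶠ[𝓝 0] fun _ => 0 := by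
    refine e2.deriv.trans ?_
    simp
  have := h2'.congr_of_eventuallyEq e3.symm
  have := this.unique (hasDerivAt_const (0:ℝ) (0:ℝ))
  linarith

theorem line_at {n : ℕ} {F : Z n → ℝ} {F' : ℝ} {z v : Z n} {s : ℝ}
    (h : HasLineDerivAt ℝ F F' (z + s • v) v) : HasDerivAt (fun s' : ℝ => F (z + s' • v)) F' s := by
  unfold HasLineDerivAt at h
  have h1' : HasDerivAt (fun t : ℝ => F (z + s • v + t • v)) F' (s - s) := by simpa using h
  have h4 := HasDerivAt.comp_sub_const s s h1'
  refine h4.congr_of_eventuallyEq (Eventually.of_forall fun s' => ?_)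
  simp only
  congr 1
  rw [sub_smul]; abel

theorem line_shift {n : ℕ} {F : Z n → ℝ} {F' : ℝ} {z v a : Z n}
    (h : HasLineDerivAt ℝ F F' (z + a) v) : HasLineDerivAt ℝ (fun z => F (z + a)) F' z v := by
  unfold HasLineDerivAt at h ⊢
  refine h.congr_of_eventuallyEq (Eventually.of_forall fun s' => ?_)
  simp only
  congr 1
  abel

theorem line_max_test {n : ℕ} (F F1 : Z n → ℝ) (F2 : ℝ) (z v : Z n) (hmax : IsLocalMax F z)
    (h1 : ∀ᶠ w in 𝓝 z, HasLineDerivAt ℝ F (F1 w) w v) (h2 : HasLineDerivAt ℝ F1 F2 z v) :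
    F2 ≤ 0 := by
  have hc : Tendsto (fun s : ℝ => z + s • v) (𝓝 0) (𝓝 z) := by
    have : Continuous (fun s : ℝ => z + s • v) := by fun_prop
    simpa using this.tendsto 0
  refine max_test (fun s => F (z + s • v)) (fun s => F1 (z + s • v)) F2 ?_ ?_ h2
  · have := hc.eventually hmax
    simpa [IsLocalMax, IsMaxFilter] using this
  · filter_upwards [hc.eventually h1] with s hs
    exact line_at hs

def Q {n : ℕ} (f : Rn n → ℝ) (z : Z n) : ℝ := ∑ k, G f k z ^ 2
def Q1 {n : ℕ} (f : Rn n → ℝ) (i : Option (Fin n)) (z : Z n) : ℝ := ∑ k, 2 * (G f k z * G1 f i k z)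
def Q2 {n : ℕ} (f : Rn n → ℝ) (i : Option (Fin n)) (z : Z n) : ℝ :=
  ∑ k, 2 * (G1 f i k z * G1 f i k z + G f k z * G2 f i k z)

theorem Q_nonneg {n : ℕ} (f : Rn n → ℝ) (z : Z n) : 0 ≤ Q f z :=
  Finset.sum_nonneg fun _ _ => sq_nonneg _

theorem contQ {n : ℕ} {f : Rn n → ℝ} {B N : ℝ} (hf : BC f B N) (z : Z n) (hz : 0 < z none) :
    ContinuousAt (Q f) z := by
  unfold Q
  exact tendsto_finset_sum _ fun k _ => (contG hf z hz k).pow 2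

theorem lineQ {n : ℕ} {f : Rn n → ℝ} {B N : ℝ} (hf : BC f B N) (z : Z n) (hz : 0 < z none) (i) :
    HasLineDerivAt ℝ (Q f) (Q1 f i z) z (ee i) := by
  unfold HasLineDerivAt Q Q1
  refine HasDerivAt.fun_sum fun k _ => ?_
  have := lineG hf z hz i k
  unfold HasLineDerivAt at this
  exact (this.fun_pow 2).congr_deriv (by simp; ring)

theorem lineQ1 {n : ℕ} {f : Rn n → ℝ} {B N : ℝ} (hf : BC f B N) (z : Z n) (hz : 0 < z none) (i) :
    HasLineDerivAt ℝ (Q1 f i) (Q2 f i z) z (ee i) := by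
  unfold HasLineDerivAt Q1 Q2
  refine HasDerivAt.fun_sum fun k _ => ?_
  have h1 := lineG hf z hz i k
  have h2 := lineG1 hf z hz i k
  unfold HasLineDerivAt at h1 h2
  exact ((h1.mul h2).const_mul 2).congr_deriv (by simp)

def F1 {n : ℕ} (f : Rn n → ℝ) (b : ℝ) (i : Option (Fin n)) (z : Z n) : ℝ := Q1 f i z * b * Q f z ^ (b - 1)
def F2 {n : ℕ} (f : Rn n → ℝ) (b : ℝ) (i : Option (Fin n)) (z : Z n) : ℝ :=
  Q2 f i z * b * Q f z ^ (b - 1) + Q1 f i z * b * (Q1 f i z * (b - 1) * Q f z ^ (b - 2))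

theorem lineF {n : ℕ} {f : Rn n → ℝ} {B N : ℝ} (hf : BC f B N) (b : ℝ) (z : Z n) (hz : 0 < z none)
    (hQ : 0 < Q f z) (i) :
    HasLineDerivAt ℝ (fun z => Q f z ^ b) (F1 f b i z) z (ee i) := by
  have h := lineQ hf z hz i
  unfold HasLineDerivAt at h ⊢
  have h2 := h.rpow_const (p := b) (Or.inl (by simpa using hQ.ne'))
  exact h2.congr_deriv (by simp [F1])

theorem lineF1 {n : ℕ} {f : Rn n → ℝ} {B N : ℝ} (hf : BC f B N) (b : ℝ) (z : Z n) (hz : 0 < z none)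
    (hQ : 0 < Q f z) (i) :
    HasLineDerivAt ℝ (F1 f b i) (F2 f b i z) z (ee i) := by
  have h := lineQ hf z hz i
  have h1 := lineQ1 hf z hz i
  unfold HasLineDerivAt at h h1 ⊢
  have h2 := h.rpow_const (p := b - 1) (Or.inl (by simpa using hQ.ne'))
  have e : b - 1 - 1 = b - 2 := by ring
  exact ((h1.mul_const b).mul h2).congr_deriv (by simp [F2, e])

/-- Stein–Weiss subharmonicity -/
theorem F2_trace {n : ℕ} (hn : 1 ≤ n) {f : Rn n → ℝ} {B N : ℝ} (hf : BC f B N) (b : ℝ) (hb : 0 < b)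
    (hb1 : (1 - b) * (2 * n) ≤ n + 1) (z : Z n) (hz : 0 < z none) (hQ : 0 < Q f z) :
    0 ≤ ∑ i, F2 f b i z := by
  set T := ∑ i, ∑ k, G1 f i k z ^ 2 with hT
  set H := ∑ i, (∑ k, G1 f i k z * G f k z) ^ 2 with hH
  have hT0 : 0 ≤ T := Finset.sum_nonneg fun i _ => Finset.sum_nonneg fun k _ => sq_nonneg _
  have hH0 : 0 ≤ H := Finset.sum_nonneg fun i _ => sq_nonneg _
  have e1 : ∑ i, Q2 f i z = 2 * T := by
    have : ∑ i, Q2 f i z = 2 * T + 2 * ∑ k, G f k z * ∑ i, G2 f i k z := by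
      unfold Q2
      simp only [Finset.mul_sum, hT]
      rw [Finset.sum_comm (f := fun k i => 2 * (G f k z * G2 f i k z)), ← Finset.sum_add_distrib]
      refine Finset.sum_congr rfl fun i _ => ?_
      rw [← Finset.sum_add_distrib]
      refine Finset.sum_congr rfl fun k _ => ?_
      ring
    rw [this]
    simp [G2_trace hf z hz]
  have e2 : ∑ i, Q1 f i z ^ 2 = 4 * H := by
    rw [hH, Finset.mul_sum]
    refine Finset.sum_congr rfl fun i _ => ?_
    unfold Q1
    rw [← Finset.mul_sum, mul_pow]
    rw [show (2:ℝ)^2 = 4 by norm_num]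
    congr 2
    exact Finset.sum_congr rfl fun k _ => by ring
  have key := traceless (fun i k => G1 f i k z) (fun i k => G1_symm hf z hz i k)
    (G1_trace hf z hz) (fun k => G f k z) ((n:ℝ)+1) (by simp) (by
      have : (1:ℝ) ≤ n := by exact_mod_cast hn
      linarith)
  have key2 : ((n:ℝ) + 1) * H ≤ n * (T * Q f z) := by
    have : ((n:ℝ) + 1) * H ≤ (n + 1 - 1) * (T * Q f z) := key
    simpa using this
  have hp : Q f z ^ (b - 1) = Q f z * Q f z ^ (b - 2) := by
    rw [show b - 2 = (b - 1) - 1 by ring, Real.rpow_sub_one hQ.ne' (b - 1)]; field_simp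
  have e3 : ∑ i, F2 f b i z = 2 * b * Q f z ^ (b - 2) * (T * Q f z - 2 * (1 - b) * H) := by
    have : ∑ i, F2 f b i z = (∑ i, Q2 f i z) * (b * Q f z ^ (b - 1))
        + (∑ i, Q1 f i z ^ 2) * (b * (b - 1) * Q f z ^ (b - 2)) := by
      unfold F2
      rw [Finset.sum_mul, Finset.sum_mul, ← Finset.sum_add_distrib]
      refine Finset.sum_congr rfl fun i _ => ?_
      ring
    rw [this, e1, e2, hp]; ring
  rw [e3]
  have hn' : (1:ℝ) ≤ n := by exact_mod_cast hn
  have : 0 ≤ T * Q f z - 2 * (1 - b) * H := by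
    by_cases hb2 : 1 ≤ b
    · have : 2 * (1 - b) * H ≤ 0 := mul_nonpos_of_nonpos_of_nonneg (by linarith) hH0
      have : 0 ≤ T * Q f z := by positivity
      linarith
    · push Not at hb2
      have h1 : 2 * (1 - b) * (((n:ℝ) + 1) * H) ≤ 2 * (1 - b) * (n * (T * Q f z)) := by
        have : 0 ≤ 1 - b := by linarith
        gcongr
      have h2 : (1 - b) * (2 * n) * (T * Q f z) ≤ (n + 1) * (T * Q f z) := by gcongr
      have h3 : ((n:ℝ) + 1) * (2 * (1 - b) * H) ≤ (n + 1) * (T * Q f z) := by linarith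
      have := le_of_mul_le_mul_left h3 (by positivity)
      linarith
  positivity

theorem Q_bdz {n : ℕ} {f : Rn n → ℝ} {B N : ℝ} (hf : BC f B N) (τ : ℝ) (hτ : 0 < τ) :
    ∃ D : ℝ, 0 ≤ D ∧ ∀ z : Z n, τ ≤ z none → Q f z ≤ D * (1 + ‖z‖) ^ (-(2 * n : ℝ)) := by
  have h : ∀ k : Option (Fin n), ∃ D : ℝ, 0 ≤ D ∧ ∀ z : Z n, τ ≤ z none →
      |G f k z| ≤ D * (1 + ‖z‖) ^ (-(2 * ((n:ℝ)/2))) := fun k => pot_bdz (kerK k) hf τ hτ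
  choose D hD0 hD using h
  refine ⟨∑ k, D k ^ 2, Finset.sum_nonneg fun _ _ => sq_nonneg _, fun z hz => ?_⟩
  unfold Q
  rw [Finset.sum_mul]
  refine Finset.sum_le_sum fun k _ => ?_
  rw [← sq_abs]
  calc _ ≤ (D k * (1 + ‖z‖) ^ (-(2 * ((n:ℝ)/2)))) ^ 2 := by
        have := hD k z hz
        gcongr
    _ = _ := by
      rw [mul_pow, ← Real.rpow_natCast ((1 + ‖z‖) ^ (-(2 * ((n:ℝ)/2)))), ← Real.rpow_mul (by positivity)]
      congr 2; push_cast; ring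

theorem Q_small {n : ℕ} (hn : 1 ≤ n) {f : Rn n → ℝ} {B N : ℝ} (hf : BC f B N) (τ : ℝ) (hτ : 0 < τ)
    (b : ℝ) (hb : 0 < b) (η : ℝ) (hη : 0 < η) :
    ∃ R : ℝ, ∀ z : Z n, τ ≤ z none → R ≤ ‖z‖ → Q f z ^ b ≤ η := by
  obtain ⟨D, hD0, hD⟩ := Q_bdz hf τ hτ
  have ht : Tendsto (fun r : ℝ => (D * (1 + r) ^ (-(2 * n : ℝ))) ^ b) atTop (𝓝 ((D * 0) ^ b)) := by
    refine Tendsto.rpow_const ?_ (Or.inr hb.le)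
    refine Tendsto.const_mul _ ?_
    have h1 : Tendsto (fun r : ℝ => 1 + r) atTop atTop := tendsto_atTop_add_const_left _ _ tendsto_id
    have : (0:ℝ) < 2 * n := by
      have : (1:ℝ) ≤ n := by exact_mod_cast hn
      linarith
    exact (tendsto_rpow_neg_atTop this).comp h1
  rw [mul_zero, Real.zero_rpow hb.ne'] at ht
  obtain ⟨R, hR⟩ := eventually_atTop.1 (ht.eventually (ge_mem_nhds hη))
  refine ⟨R, fun z hz hzR => le_trans ?_ (hR _ hzR)⟩
  have := hD z hz
  have := Q_nonneg f z
  gcongr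

theorem comparison {n : ℕ} (hn : 1 ≤ n) {f g : Rn n → ℝ} {B N B' N' : ℝ} (hf : BC f B N)
    (hg : BC g B' N') (b : ℝ) (hb : 0 < b) (hb1 : (1 - b) * (2 * n) ≤ n + 1)
    (c : ℝ) (hc : 0 < c) (V : Z n → ℝ) (hV : ContinuousOn V {z | 0 ≤ z none})
    (hV1 : ∀ z, 0 < z none → V z = G g none z) (hV0 : ∀ x, V (pt x 0) = c * g x)
    (hVn : ∀ z, 0 ≤ z none → 0 ≤ V z) (ε η : ℝ) (hε : 0 < ε) (hη : 0 < η)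
    (hb0 : ∀ x, Q f (pt x ε) ^ b ≤ g x + η) (z1 : Z n) (hz1 : 0 < z1 none) :
    c * Q f (z1 + pt 0 ε) ^ b ≤ V z1 + c * η := by
  by_contra hcon
  push Not at hcon
  set a : Z n := pt 0 ε with ha
  have han : a none = ε := rfl
  set γ := c * Q f (z1 + a) ^ b - V z1 - c * η with hγ
  have hγ0 : 0 < γ := by linarith
  set δ := γ / 2
  set ψ : Z n → ℝ := fun z => c * Q f (z + a) ^ b - V z + δ * Real.exp (-z none) with hψ
  have hδ : 0 < δ := by positivity
  have hψ1 : c * η + γ < ψ z1 := by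
    have := Real.exp_pos (-z1 none)
    have : 0 < δ * Real.exp (-z1 none) := by positivity
    simp only [hψ]; linarith
  have hexp : ∀ z : Z n, 0 ≤ z none → δ * Real.exp (-z none) ≤ δ := fun z hz => by
    have : Real.exp (-z none) ≤ 1 := Real.exp_le_one_iff.2 (by linarith)
    nlinarith
  have hpos : ∀ z : Z n, 0 ≤ z none → 0 < (z + a) none := fun z hz => by
    simp only [Pi.add_apply, han]; linarith
  have hQc : ∀ z : Z n, 0 ≤ z none → ContinuousAt (fun z => Q f (z + a)) z := fun z hz =>
    ContinuousAt.comp (f := fun z => z + a) (contQ hf _ (hpos z hz)) (by fun_prop)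
  have hψc : ContinuousOn ψ {z | 0 ≤ z none} := by
    refine ContinuousOn.add (ContinuousOn.sub ?_ hV) (by fun_prop)
    intro z hz
    exact (((hQc z hz).rpow_const (Or.inr hb.le)).const_mul c).continuousWithinAt
  obtain ⟨R, hR⟩ := Q_small hn hf ε hε b hb η hη
  set R' := max ‖z1‖ (R + ‖a‖) with hR'
  set Kc : Set (Z n) := {z | 0 ≤ z none} ∩ Metric.closedBall 0 R' with hKc
  have hcl : IsClosed {z : Z n | 0 ≤ z none} := isClosed_le continuous_const (continuous_apply none)
  have hcomp : IsCompact Kc := (isCompact_closedBall 0 R').inter_left hcl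
  have hz1K : z1 ∈ Kc := ⟨hz1.le, by simp [hR']⟩
  obtain ⟨z0, hz0K, hz0⟩ := hcomp.exists_isMaxOn ⟨z1, hz1K⟩ (hψc.mono Set.inter_subset_left)
  have hψ0 : c * η + γ < ψ z0 := hψ1.trans_le (hz0 hz1K)
  have hmax : ∀ z : Z n, 0 ≤ z none → ψ z ≤ ψ z0 := by
    intro z hz
    by_cases hzK : ‖z‖ ≤ R'
    · exact hz0 ⟨hz, by simpa using hzK⟩
    · push Not at hzK
      have h1 : R ≤ ‖z + a‖ := by
        have h2 : ‖z‖ ≤ ‖z + a‖ + ‖a‖ := by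
          calc ‖z‖ = ‖(z + a) - a‖ := by simp
            _ ≤ _ := norm_sub_le _ _
        have := le_max_right ‖z1‖ (R + ‖a‖)
        linarith
      have h3 : Q f (z + a) ^ b ≤ η := hR _ (by simp only [Pi.add_apply, han]; linarith) h1
      have h4 : c * Q f (z + a) ^ b ≤ c * η := by gcongr
      have := hVn z hz
      have := hexp z hz
      have : ψ z ≤ c * η + δ := by simp only [hψ]; linarith
      have : δ ≤ γ := by simp only [δ]; linarith
      linarith
  have hz0n : 0 ≤ z0 none := hz0K.1
  have hz0p : 0 < z0 none := by
    refine lt_of_le_of_ne hz0n fun h => ?_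
    set x : Rn n := WithLp.toLp 2 (fun i => z0 (some i)) with hx
    have e : z0 = pt x 0 := by
      funext o; cases o with
      | none => simpa using h.symm
      | some i => simp [hx]
    have e2 : z0 + a = pt x ε := by
      rw [e, ha]; funext o; cases o <;> simp
    have h5 : ψ z0 ≤ c * η + δ := by
      have h6 := hb0 x
      have h7 := hexp z0 hz0n
      have h8 : c * Q f (pt x ε) ^ b ≤ c * (g x + η) := by gcongr
      simp only [hψ] at h7 ⊢
      rw [e2]
      rw [show V z0 = c * g x by rw [e]; exact hV0 x]
      linarith
    have : δ ≤ γ := by simp only [δ]; linarith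
    linarith
  have hQ0 : 0 < Q f (z0 + a) := by
    rcases (Q_nonneg f (z0 + a)).eq_or_lt with h | h
    · exfalso
      have h7 := hexp z0 hz0n
      have h8 := hVn z0 hz0n
      have : ψ z0 ≤ δ := by
        simp only [hψ]; rw [← h, Real.zero_rpow hb.ne']; linarith
      have : δ ≤ γ := by simp only [δ]; linarith
      have : 0 < c * η := by positivity
      linarith
    · exact h
  have hopen : ∀ᶠ w : Z n in 𝓝 z0, 0 < w none :=
    (isOpen_lt continuous_const (continuous_apply none)).mem_nhds hz0p
  have hopen2 : ∀ᶠ w : Z n in 𝓝 z0, 0 < Q f (w + a) :=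
    (hQc z0 hz0n).eventually (lt_mem_nhds hQ0)
  set ψ' : Z n → ℝ := fun z => c * Q f (z + a) ^ b - G g none z + δ * Real.exp (-z none) with hψ'
  have hloc : IsLocalMax ψ' z0 := by
    filter_upwards [hopen] with w hw
    have := hmax w hw.le
    simp only [hψ, hV1 w hw, hV1 z0 hz0p] at this
    exact this
  have lexp : ∀ i (w : Z n), HasLineDerivAt ℝ (fun z : Z n => Real.exp (-z none))
      (-dl i none * Real.exp (-w none)) w (ee i) := fun i w => by
    have h := lineCoord i none w
    unfold HasLineDerivAt at h ⊢
    exact h.fun_neg.exp.congr_deriv (by simp; ring)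
  have hi : ∀ i, c * F2 f b i (z0 + a) - G2 g i none z0 + δ * (dl i none * Real.exp (-z0 none)) ≤ 0 := by
    intro i
    refine line_max_test ψ' (fun w => c * F1 f b i (w + a) - G1 g i none w
      + δ * (-dl i none * Real.exp (-w none))) _ z0 (ee i) hloc ?_ ?_
    · filter_upwards [hopen, hopen2] with w hw hw2
      have h1 := line_shift (lineF hf b (w + a) (hpos w hw.le) hw2 i)
      have h2 := lineG hg w hw i none
      have h3 := lexp i w
      unfold HasLineDerivAt at *
      exact ((h1.const_mul c).sub h2).add (h3.const_mul δ)
    · have h1 := line_shift (lineF1 hf b (z0 + a) (hpos z0 hz0n) hQ0 i)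
      have h2 := lineG1 hg z0 hz0p i none
      have h3 := lexp i z0
      unfold HasLineDerivAt at *
      refine (((h1.const_mul c).sub h2).add ((h3.const_mul (-dl i none)).const_mul δ)).congr_deriv ?_
      have : dl i none * dl i none = dl i none := by unfold dl; split_ifs <;> simp
      rw [← mul_assoc (-dl i none), neg_mul_neg, this]
  have hsum := Finset.sum_nonpos fun i (_ : i ∈ Finset.univ) => hi i
  rw [Finset.sum_add_distrib, Finset.sum_sub_distrib, ← Finset.mul_sum, G2_trace hg z0 hz0p,
    ← Finset.mul_sum, ← Finset.sum_mul] at hsum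
  have e1 : ∑ i : Option (Fin n), dl i none = 1 := by simp [dl]
  rw [e1] at hsum
  have h9 := F2_trace hn hf b hb hb1 (z0 + a) (hpos z0 hz0n) hQ0
  have h10 : 0 ≤ c * ∑ i, F2 f b i (z0 + a) := by positivity
  have h11 := Real.exp_pos (-z0 none)
  have : 0 < δ * (1 * Real.exp (-z0 none)) := by positivity
  linarith

end RW

namespace RW

def Pk {n : ℕ} (y : Rn n) : ℝ := (1 + ‖y‖ ^ 2) ^ (-mm n)
def cc (n : ℕ) : ℝ := ∫ y : Rn n, Pk y

theorem Pk_pos {n : ℕ} (y : Rn n) : 0 < Pk y := by unfold Pk; positivity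
theorem Pk_cont {n : ℕ} : Continuous (Pk : Rn n → ℝ) := by
  unfold Pk
  refine Continuous.rpow_const (by fun_prop) fun x => Or.inl (by positivity)
theorem Pk_int {n : ℕ} : Integrable (Pk : Rn n → ℝ) := by
  have h := integrable_rpow_neg_one_add_norm_sq (E := Rn n) (μ := volume) (r := (n:ℝ)+1) (by simp)
  have e : (Pk : Rn n → ℝ) = fun x ↦ ((1 : ℝ) + ‖x‖ ^ 2) ^ (-((n:ℝ)+1) / 2) := by
    funext x; unfold Pk mm; congr 1; ring
  rw [e]; exact h

theorem cc_pos (n : ℕ) : 0 < cc n := by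
  unfold cc
  rw [integral_pos_iff_support_of_nonneg (fun y => (Pk_pos y).le) Pk_int]
  have : Function.support (Pk : Rn n → ℝ) = Set.univ := by
    ext y; simp [(Pk_pos y).ne']
  rw [this]
  exact Measure.measure_univ_pos.2 (NeZero.ne _)

theorem K_scale {n : ℕ} (t : ℝ) (ht : 0 < t) (u : Rn n) :
    K none (pt (t • u) t) = (t ^ n)⁻¹ * Pk u := by
  unfold K Pk
  rw [S_pt, norm_smul, Real.norm_of_nonneg ht.le, pt_none]
  have e : (t * ‖u‖) ^ 2 + t ^ 2 = t ^ 2 * (1 + ‖u‖ ^ 2) := by ring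
  rw [e, Real.mul_rpow (by positivity) (by positivity), ← mul_assoc]
  congr 1
  rw [← Real.rpow_natCast t 2, ← Real.rpow_mul ht.le, ← Real.rpow_natCast t n, ← Real.rpow_neg ht.le]
  nth_rewrite 1 [← Real.rpow_one t]
  rw [← Real.rpow_add ht]
  congr 1
  unfold mm; push_cast; ring

theorem G_none_eq {n : ℕ} (g : Rn n → ℝ) (x : Rn n) (t : ℝ) (ht : 0 < t) :
    G g none (pt x t) = ∫ u, Pk u * g (x - t • u) := by
  have h1 : G g none (pt x t) = ∫ y, K none (pt (x - y) t) * g (x - (x - y)) := by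
    unfold G pot
    simp only [pt_sub, sub_zero, _root_.sub_sub_cancel]
  rw [h1, integral_sub_left_eq_self (fun y => K none (pt y t) * g (x - y)) volume x]
  have h2 := Measure.integral_comp_smul (volume : Measure (Rn n))
    (fun y => K none (pt y t) * g (x - y)) t
  simp only [K_scale t ht, mul_assoc, integral_const_mul, finrank_euclideanSpace, Fintype.card_fin,
    smul_eq_mul] at h2
  rw [abs_of_pos (by positivity)] at h2
  exact (mul_left_cancel₀ (by positivity) h2).symm

def px {n : ℕ} (z : Z n) : Rn n := WithLp.toLp 2 (fun i => z (some i))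
theorem px_pt {n : ℕ} (x : Rn n) (t : ℝ) : px (pt x t) = x := by
  ext i; simp [px]
theorem pt_px {n : ℕ} (z : Z n) : pt (px z) (z none) = z := by
  funext o; cases o <;> simp [px]
theorem cont_px {n : ℕ} : Continuous (px : Z n → Rn n) := by
  unfold px
  exact (PiLp.continuous_toLp 2 _).comp (continuous_pi fun i => continuous_apply (some i))

def Vv {n : ℕ} (g : Rn n → ℝ) (z : Z n) : ℝ := ∫ u, Pk u * g (px z - z none • u)

theorem Pk_mul_int {n : ℕ} {g : Rn n → ℝ} (hg : Measurable g) {B : ℝ} (hB : ∀ y, |g y| ≤ B)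
    (x : Rn n) (t : ℝ) : Integrable (fun u => Pk u * g (x - t • u)) :=
  Pk_int.mul_bdd (c := B)
    (hg.comp (by fun_prop : Measurable fun u : Rn n => x - t • u)).aestronglyMeasurable
    (Eventually.of_forall fun y => hB _)

theorem Vv_cont {n : ℕ} {g : Rn n → ℝ} (hg : Continuous g) {B : ℝ} (hB : ∀ y, |g y| ≤ B) :
    Continuous (Vv g) := by
  unfold Vv
  refine continuous_of_dominated (bound := fun u => Pk u * B) (fun z => ?_) (fun z => ?_)
    (Pk_int.mul_const B) (Eventually.of_forall fun u => ?_)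
  · exact (Pk_mul_int hg.measurable hB _ _).aestronglyMeasurable
  · refine Eventually.of_forall fun u => ?_
    rw [norm_mul, Real.norm_of_nonneg (Pk_pos u).le]
    exact mul_le_mul_of_nonneg_left (hB _) (Pk_pos u).le
  · have := cont_px (n := n)
    refine continuous_const.mul (hg.comp ?_)
    exact this.sub ((continuous_apply none).smul continuous_const)

theorem pt_add_pt {n : ℕ} (x y : Rn n) (t s : ℝ) : pt x t + pt y s = pt (x + y) (t + s) := by
  funext o; cases o <;> simp

theorem contQx {n : ℕ} {f : Rn n → ℝ} {B N : ℝ} (hf : BC f B N) (ε : ℝ) (hε : 0 < ε) :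
    Continuous fun x => Q f (pt x ε) := by
  rw [continuous_iff_continuousAt]
  intro x
  refine ContinuousAt.comp (f := fun x => pt x ε) (contQ hf _ hε) ?_
  exact (continuous_pt.comp (by fun_prop : Continuous fun x : Rn n => (x, ε))).continuousAt

theorem contQb {n : ℕ} {f : Rn n → ℝ} {B N : ℝ} (hf : BC f B N) (ε : ℝ) (hε : 0 < ε) (b : ℝ)
    (hb : 0 ≤ b) : Continuous fun x => Q f (pt x ε) ^ b :=
  (contQx hf ε hε).rpow_const fun _ => Or.inr hb

theorem bddQb {n : ℕ} {f : Rn n → ℝ} {B N : ℝ} (hf : BC f B N) (ε : ℝ) (hε : 0 < ε) (b : ℝ)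
    (hb : 0 ≤ b) : ∃ D : ℝ, ∀ x, |Q f (pt x ε) ^ b| ≤ D := by
  obtain ⟨D, hD0, hD⟩ := Q_bdz hf ε hε
  refine ⟨D ^ b, fun x => ?_⟩
  have h0 := Q_nonneg f (pt x ε)
  rw [abs_of_nonneg (by positivity)]
  refine Real.rpow_le_rpow h0 ((hD _ le_rfl).trans ?_) hb
  refine mul_le_of_le_one_right hD0 (Real.rpow_le_one_of_one_le_of_nonpos (by simp) ?_)
  have : (0:ℝ) ≤ 2 * n := by positivity
  linarith

theorem norm_le_pt {n : ℕ} (x : Rn n) (t : ℝ) : ‖x‖ ≤ √n * ‖pt x t‖ := by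
  have h : ‖x‖ ^ 2 ≤ (√n * ‖pt x t‖) ^ 2 := by
    rw [EuclideanSpace.real_norm_sq_eq, mul_pow, Real.sq_sqrt (by positivity)]
    have : ∀ i ∈ Finset.univ, x i ^ 2 ≤ ‖pt x t‖ ^ 2 := fun i _ => by
      have := norm_le_pi_norm (pt x t) (some i)
      rw [← sq_abs]
      have h3 : |x i| ≤ ‖pt x t‖ := this
      gcongr
    have := Finset.sum_le_card_nsmul _ _ _ this
    simpa using this
  exact (sq_le_sq₀ (by positivity) (by positivity)).1 h

theorem SW {n : ℕ} (hn : 1 ≤ n) {f : Rn n → ℝ} {B N : ℝ} (hf : BC f B N)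
    (b : ℝ) (hb : 0 < b) (hb1 : (1 - b) * (2 * n) ≤ n + 1) (ε t : ℝ) (hε : 0 < ε) (ht : 0 < t)
    (x : Rn n) :
    cc n * Q f (pt x (t + ε)) ^ b ≤ ∫ u, Pk u * Q f (pt (x - t • u) ε) ^ b := by
  refine le_of_forall_pos_le_add fun η' hη' => ?_
  set η := η' / cc n with hη
  have hcc := cc_pos n
  have hη0 : 0 < η := by positivity
  set g : Rn n → ℝ := fun x => max (Q f (pt x ε) ^ b - η) 0 with hg
  have hgc : Continuous g := ((contQb hf ε hε b hb.le).sub continuous_const).max continuous_const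
  obtain ⟨D, hD⟩ := bddQb hf ε hε b hb.le
  have hgle : ∀ x, g x ≤ Q f (pt x ε) ^ b := fun x => by
    have := Q_nonneg f (pt x ε)
    have : 0 ≤ Q f (pt x ε) ^ b := by positivity
    simp only [hg]
    exact max_le (by linarith) this
  have hg0 : ∀ x, 0 ≤ g x := fun x => le_max_right _ _
  have hgD : ∀ x, |g x| ≤ D := fun x => by
    rw [abs_of_nonneg (hg0 x)]
    exact (hgle x).trans ((le_abs_self _).trans (hD x))
  obtain ⟨R, hR⟩ := Q_small hn hf ε hε b hb η hη0
  have hgBC : BC g D (√n * max R 0) := by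
    refine ⟨hgc.measurable, hgD, fun y hy => ?_, by positivity⟩
    have h1 := norm_le_pt y ε
    have h2 : √n * max R 0 < √n * ‖pt y ε‖ := hy.trans_le h1
    have h3 := lt_of_mul_lt_mul_left h2 (Real.sqrt_nonneg _)
    have h4 := hR (pt y ε) le_rfl ((le_max_left _ _).trans h3.le)
    simp only [hg]
    exact max_eq_right (by linarith)
  have key := comparison hn hf hgBC b hb hb1 (cc n) hcc (Vv g) (Vv_cont hgc hgD).continuousOn
    (fun z hz => by
      have := G_none_eq g (px z) (z none) hz
      rw [pt_px] at this
      rw [this]; rfl)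
    (fun x => by simp [Vv, px_pt, integral_mul_const, cc])
    (fun z hz => integral_nonneg fun u => mul_nonneg (Pk_pos u).le (hg0 _)) ε η hε hη0
    (fun x => by
      have := le_max_left (Q f (pt x ε) ^ b - η) 0
      simp only [hg]; linarith) (pt x t) ht
  rw [pt_add_pt, add_zero] at key
  have e : cc n * η = η' := by rw [hη]; field_simp
  rw [e] at key
  refine key.trans (add_le_add_left ?_ _)
  unfold Vv
  rw [px_pt, pt_none]
  refine integral_mono (Pk_mul_int hgc.measurable hgD _ _)
    (Pk_mul_int (contQb hf ε hε b hb.le).measurable hD _ _) fun u => ?_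
  exact mul_le_mul_of_nonneg_left (hgle _) (Pk_pos u).le

theorem SW' {n : ℕ} (hn : 1 ≤ n) {f : Rn n → ℝ} {B N : ℝ} (hf : BC f B N)
    (b : ℝ) (hb : 0 < b) (hb1 : (1 - b) * (2 * n) ≤ n + 1) (ε t : ℝ) (hε : 0 < ε) (ht : 0 < t)
    (x : Rn n) :
    ENNReal.ofReal (cc n) * ENNReal.ofReal (Q f (pt x (t + ε)) ^ b) ≤
      ∫⁻ u, ENNReal.ofReal (Pk u) * ENNReal.ofReal (Q f (pt (x - t • u) ε) ^ b) := by
  rw [← ENNReal.ofReal_mul (cc_pos n).le]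
  refine (ENNReal.ofReal_le_ofReal (SW hn hf b hb hb1 ε t hε ht x)).trans ?_
  obtain ⟨D, hD⟩ := bddQb hf ε hε b hb.le
  rw [ofReal_integral_eq_lintegral_ofReal
    (Pk_mul_int (contQb hf ε hε b hb.le).measurable hD _ _)
    (Eventually.of_forall fun u => by
      have := Q_nonneg f (pt (x - t • u) ε)
      have := Pk_pos u
      simp only [Pi.zero_apply]
      positivity)]
  simp only [ENNReal.ofReal_mul (Pk_pos _).le]
  exact le_rfl

end RW

namespace RW

theorem cube_eq {n : ℕ} (c : Rn n) (r : ℝ) : Cube c r =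
    (fun y : Rn n => WithLp.ofLp y) ⁻¹' (Set.univ.pi fun i => Set.Icc (c i - r) (c i + r)) := by
  ext y
  simp only [Cube, Set.mem_setOf_eq, Set.mem_preimage, Set.mem_pi, Set.mem_univ, true_imp_iff,
    Set.mem_Icc, abs_le]
  refine forall_congr' fun i => ⟨fun h => ⟨by linarith [h.1], by linarith [h.2]⟩,
    fun h => ⟨by linarith [h.1], by linarith [h.2]⟩⟩

theorem cube_meas {n : ℕ} (c : Rn n) (r : ℝ) : MeasurableSet (Cube c r) := by
  rw [cube_eq]
  exact (PiLp.volume_preserving_ofLp (Fin n)).measurable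
    (MeasurableSet.univ_pi fun i => measurableSet_Icc)

theorem cube_vol {n : ℕ} (c : Rn n) (r : ℝ) : volume (Cube c r) = ENNReal.ofReal (2 * r) ^ n := by
  rw [cube_eq, (PiLp.volume_preserving_ofLp (Fin n)).measure_preimage
    (MeasurableSet.univ_pi fun i => measurableSet_Icc).nullMeasurableSet, volume_pi_pi]
  have : ∀ i : Fin n, volume (Set.Icc (c i - r) (c i + r)) = ENNReal.ofReal (2 * r) := fun i => by
    rw [Real.volume_Icc]; congr 1; ring
  simp [this]

theorem cube_vol_ne_zero {n : ℕ} (c : Rn n) (r : ℝ) (hr : 0 < r) : volume (Cube c r) ≠ 0 := by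
  rw [cube_vol]; positivity
theorem cube_vol_ne_top {n : ℕ} (c : Rn n) (r : ℝ) : volume (Cube c r) ≠ ⊤ := by
  rw [cube_vol]; exact ENNReal.pow_ne_top ENNReal.ofReal_ne_top

theorem max_ge {n : ℕ} (φ : Rn n → ℝ≥0∞) (x c : Rn n) (r : ℝ) (hr : 0 < r) (hx : x ∈ Cube c r) :
    (volume (Cube c r))⁻¹ * ∫⁻ y in Cube c r, φ y ≤ maximal φ x :=
  le_iSup_of_le c (le_iSup_of_le r (le_iSup_of_le hr (le_iSup_of_le hx le_rfl)))

theorem max_ge' {n : ℕ} (φ : Rn n → ℝ≥0∞) (x c : Rn n) (r : ℝ) (hr : 0 < r) (hx : x ∈ Cube c r) :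
    ∫⁻ y in Cube c r, φ y ≤ volume (Cube c r) * maximal φ x := by
  have h := max_ge φ x c r hr hx
  calc _ = volume (Cube c r) * ((volume (Cube c r))⁻¹ * ∫⁻ y in Cube c r, φ y) := by
        rw [← mul_assoc, ENNReal.mul_inv_cancel (cube_vol_ne_zero c r hr) (cube_vol_ne_top c r), one_mul]
    _ ≤ _ := by gcongr

theorem mem_cube_self {n : ℕ} (c : Rn n) (r : ℝ) (hr : 0 ≤ r) : c ∈ Cube c r := fun i => by simpa

theorem abs_coord_le {n : ℕ} (y : Rn n) (i : Fin n) : |y i| ≤ ‖y‖ := by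
  have := PiLp.norm_apply_le y i
  simpa using this

theorem ball_sub_cube {n : ℕ} (c y : Rn n) (r : ℝ) (h : ‖y - c‖ ≤ r) : y ∈ Cube c r := fun i =>
  (abs_coord_le (y - c) i).trans h

theorem lint_scale {n : ℕ} (φ : Rn n → ℝ≥0∞) (hφ : Measurable φ) (x : Rn n) (t : ℝ) (ht : 0 < t) :
    ∫⁻ u, φ (x - t • u) = ENNReal.ofReal ((t ^ n)⁻¹) * ∫⁻ y, φ y := by
  have h1 : ∫⁻ u, φ (x - t • u) = ∫⁻ v, φ (x - v) ∂(Measure.map (fun u : Rn n => t • u) volume) := by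
    rw [lintegral_map (by fun_prop) (by fun_prop)]
  rw [h1, Measure.map_addHaar_smul _ ht.ne', lintegral_smul_measure,
    lintegral_sub_left_eq_self (fun v => φ v) x]
  simp only [finrank_euclideanSpace, Fintype.card_fin, smul_eq_mul]
  rw [abs_of_pos (by positivity)]

theorem Pk_le {n : ℕ} (y : Rn n) : ENNReal.ofReal (Pk y) ≤
    ∑' k : ℕ, ENNReal.ofReal (2 ^ (n + 1) * (2 ^ (n + 1))⁻¹ ^ k) * (Cube (0:Rn n) (2 ^ k)).indicator 1 y := by
  have hex : ∃ k : ℕ, ‖y‖ ≤ 2 ^ k := by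
    obtain ⟨k, hk⟩ := pow_unbounded_of_one_lt ‖y‖ (by norm_num : (1:ℝ) < 2)
    exact ⟨k, hk.le⟩
  classical
  set k := Nat.find hex with hk
  have hyk : ‖y‖ ≤ 2 ^ k := Nat.find_spec hex
  refine le_trans ?_ (ENNReal.le_tsum k)
  have hmem : y ∈ Cube (0:Rn n) (2 ^ k) := ball_sub_cube _ _ _ (by simpa using hyk)
  rw [Set.indicator_of_mem hmem, Pi.one_apply, mul_one]
  refine ENNReal.ofReal_le_ofReal ?_
  unfold Pk
  rcases Nat.eq_zero_or_pos k with h0 | h0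
  · rw [h0, pow_zero, mul_one]
    refine (Real.rpow_le_one_of_one_le_of_nonpos (by nlinarith [norm_nonneg y]) (by linarith [mm_pos n])).trans ?_
    exact one_le_pow₀ (by norm_num)
  · have h1 : ¬ ‖y‖ ≤ 2 ^ (k - 1) := Nat.find_min hex (by omega)
    push Not at h1
    obtain ⟨j, hj⟩ : ∃ j, k = j + 1 := ⟨k - 1, by omega⟩
    rw [hj] at h1 ⊢
    simp only [Nat.add_sub_cancel] at h1
    have h2 : ((2:ℝ) ^ j) ^ 2 ≤ 1 + ‖y‖ ^ 2 := by
      have : ((2:ℝ) ^ j) ^ 2 ≤ ‖y‖ ^ 2 := by gcongr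
      linarith
    refine (Real.rpow_le_rpow_of_nonpos (by positivity) h2 (by linarith [mm_pos n])).trans ?_
    rw [pow_succ ((2 ^ (n + 1) : ℝ)⁻¹), ← Real.rpow_natCast (2 ^ j : ℝ) 2, ← Real.rpow_mul (by positivity)]
    have e : ((2:ℕ):ℝ) * -mm n = -((n+1 : ℕ):ℝ) := by unfold mm; push_cast; ring
    rw [e, Real.rpow_neg (by positivity), Real.rpow_natCast, ← pow_mul, mul_comm j, pow_mul, inv_pow]
    have : (2:ℝ) ^ (n+1) ≠ 0 := by positivity
    field_simp
    exact le_rfl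

theorem poisson_le_max {n : ℕ} (φ : Rn n → ℝ≥0∞) (hφ : Measurable φ) (x : Rn n) (t : ℝ) (ht : 0 < t) :
    ∫⁻ u, ENNReal.ofReal (Pk u) * φ (x - t • u) ≤ ENNReal.ofReal (2 ^ (2 * n + 2)) * maximal φ x := by
  have hm : Measurable fun u : Rn n => φ (x - t • u) := by fun_prop
  calc ∫⁻ u, ENNReal.ofReal (Pk u) * φ (x - t • u)
      ≤ ∫⁻ u, ∑' k : ℕ, ENNReal.ofReal (2 ^ (n + 1) * (2 ^ (n + 1))⁻¹ ^ k) *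
          (Cube (0:Rn n) (2 ^ k)).indicator (fun u => φ (x - t • u)) u := by
        refine lintegral_mono fun u => ?_
        refine (mul_le_mul_left (Pk_le u) _).trans ?_
        rw [← ENNReal.tsum_mul_right]
        refine ENNReal.tsum_le_tsum fun k => ?_
        rw [mul_assoc]
        gcongr
        by_cases h : u ∈ Cube (0:Rn n) (2 ^ k) <;> simp [h]
    _ = ∑' k : ℕ, ENNReal.ofReal (2 ^ (n + 1) * (2 ^ (n + 1))⁻¹ ^ k) *
          ∫⁻ u in Cube (0:Rn n) (2 ^ k), φ (x - t • u) := by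
        rw [lintegral_tsum fun k => ?_]
        · refine tsum_congr fun k => ?_
          rw [lintegral_const_mul _ (hm.indicator (cube_meas _ _)), lintegral_indicator (cube_meas _ _)]
        · exact ((hm.indicator (cube_meas _ _)).const_mul _).aemeasurable
    _ ≤ ∑' k : ℕ, ENNReal.ofReal (2 ^ (n + 1) * (2 ^ (n + 1))⁻¹ ^ k) *
          (ENNReal.ofReal ((2 * 2 ^ k) ^ n) * maximal φ x) := by
        refine ENNReal.tsum_le_tsum fun k => ?_
        gcongr
        have e : ∀ u : Rn n, (Cube (0:Rn n) (2 ^ k)).indicator (fun u => φ (x - t • u)) u =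
            (Cube x (t * 2 ^ k)).indicator φ (x - t • u) := fun u => by
          have : u ∈ Cube (0:Rn n) (2 ^ k) ↔ x - t • u ∈ Cube x (t * 2 ^ k) := by
            simp only [Cube, Set.mem_setOf_eq]
            refine forall_congr' fun i => ?_
            simp [abs_mul, abs_of_pos ht, ht]
          by_cases h : u ∈ Cube (0:Rn n) (2 ^ k)
          · rw [Set.indicator_of_mem h, Set.indicator_of_mem (this.1 h)]
          · rw [Set.indicator_of_notMem h, Set.indicator_of_notMem (fun h' => h (this.2 h'))]
        rw [← lintegral_indicator (cube_meas _ _), lintegral_congr e,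
          lint_scale _ (hφ.indicator (cube_meas _ _)) x t ht, lintegral_indicator (cube_meas _ _)]
        refine (mul_le_mul_right (max_ge' φ x x (t * 2 ^ k) (by positivity)
          (mem_cube_self _ _ (by positivity))) _).trans ?_
        rw [cube_vol, ← mul_assoc, ← ENNReal.ofReal_pow (by positivity), ← ENNReal.ofReal_mul (by positivity)]
        gcongr
        refine le_of_eq ?_
        rw [show 2 * (t * 2 ^ k) = t * (2 * 2 ^ k) by ring, mul_pow t]
        field_simp
    _ = (∑' k : ℕ, ENNReal.ofReal (2 ^ (2 * n + 1) * (1/2) ^ k)) * maximal φ x := by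
        rw [← ENNReal.tsum_mul_right]
        refine tsum_congr fun k => ?_
        rw [← mul_assoc, ← ENNReal.ofReal_mul (by positivity)]
        congr 2
        rw [mul_pow, ← pow_mul, inv_pow, ← pow_mul, show (n+1) * k = k * n + k by ring, pow_add 2 (k * n),
          pow_add, pow_add, pow_mul, pow_mul, one_div, inv_pow]
        field_simp
        rw [← pow_mul, ← pow_mul, mul_comm n 2]
    _ = _ := by
        congr 1
        rw [← ENNReal.ofReal_tsum_of_nonneg (fun k => by positivity)
          ((summable_geometric_two).mul_left _), _root_.tsum_mul_left, tsum_geometric_two]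
        congr 1

theorem avg_le {n : ℕ} {f : Rn n → ℝ} {B N : ℝ} (hf : BC f B N) (hf0 : ∀ y, 0 ≤ f y) (x c : Rn n) (r : ℝ)
    (hr : 0 < r) (hx : x ∈ Cube c r) :
    (volume (Cube c r))⁻¹ * ∫⁻ y in Cube c r, ENNReal.ofReal (f y) ≤
      ENNReal.ofReal ((4 * n + 1) ^ mm n) * ENNReal.ofReal (Q f (pt x r) ^ (1/2 : ℝ)) := by
  have h1 : ∀ y ∈ Cube c r, f y ≤ (4 * n + 1) ^ mm n * r ^ n * (K none (pt x r - pt y 0) * f y) := by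
    intro y hy
    have hd : ‖x - y‖ ^ 2 ≤ 4 * n * r ^ 2 := by
      rw [EuclideanSpace.real_norm_sq_eq]
      have : ∀ i ∈ Finset.univ, (x - y) i ^ 2 ≤ 4 * r ^ 2 := fun i _ => by
        have h1 := abs_le.1 (hx i)
        have h2 := abs_le.1 (hy i)
        rw [show (x - y) i = x i - y i from rfl, show 4 * r ^ 2 = (2 * r) ^ 2 by ring]
        exact sq_le_sq.2 (by rw [abs_of_pos (by positivity : 0 < 2 * r)]; exact abs_le.2 ⟨by linarith, by linarith⟩)
      have := Finset.sum_le_card_nsmul _ _ _ this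
      simp only [Finset.card_univ, Fintype.card_fin, nsmul_eq_mul] at this
      linarith
    have hK : ((4 * n + 1) ^ mm n * r ^ n)⁻¹ ≤ K none (pt x r - pt y 0) := by
      rw [pt_sub, sub_zero]
      unfold K
      rw [S_pt, pt_none]
      have h3 : ‖x - y‖ ^ 2 + r ^ 2 ≤ (4 * n + 1) * r ^ 2 := by linarith
      have h4 := Real.rpow_le_rpow_of_nonpos (by positivity) h3 (show -mm n ≤ 0 by linarith [mm_pos n])
      refine le_trans (le_of_eq ?_) (mul_le_mul_of_nonneg_left h4 hr.le)
      rw [Real.mul_rpow (by positivity) (by positivity), mul_inv, Real.rpow_neg (by positivity), ← mul_assoc,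
        mul_comm r, mul_assoc]
      congr 1
      rw [← Real.rpow_natCast r 2, ← Real.rpow_mul hr.le, ← Real.rpow_natCast r n, ← Real.rpow_neg hr.le]
      nth_rewrite 2 [← Real.rpow_one r]
      rw [← Real.rpow_add hr]
      congr 1
      unfold mm; push_cast; ring
    have hp : 0 < (4 * n + 1 : ℝ) ^ mm n * r ^ n := by positivity
    rw [← mul_assoc]
    refine le_mul_of_one_le_left (hf0 y) ?_
    rw [inv_le_iff_one_le_mul₀ hp] at hK
    linarith
  have hint := (kerK (n := n) none).integrable hf (pt x r) hr
  have hKn : ∀ y, 0 ≤ K none (pt x r - pt y 0) * f y := fun y => by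
    refine mul_nonneg ?_ (hf0 y)
    unfold K
    have := S_nonneg (pt x r - pt y 0)
    have e : (pt x r - pt y 0) none = r := by simp
    rw [e]
    positivity
  have h2 : ∫⁻ y in Cube c r, ENNReal.ofReal (f y) ≤
      ENNReal.ofReal ((4 * n + 1) ^ mm n * r ^ n) * ENNReal.ofReal (G f none (pt x r)) := by
    calc _ ≤ ∫⁻ y in Cube c r, ENNReal.ofReal ((4 * n + 1) ^ mm n * r ^ n) *
          ENNReal.ofReal (K none (pt x r - pt y 0) * f y) := by
          refine setLIntegral_mono_ae' (cube_meas _ _) (Eventually.of_forall fun y hy => ?_)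
          rw [← ENNReal.ofReal_mul (by positivity)]
          exact ENNReal.ofReal_le_ofReal (h1 y hy)
      _ ≤ ∫⁻ y, ENNReal.ofReal ((4 * n + 1) ^ mm n * r ^ n) *
          ENNReal.ofReal (K none (pt x r - pt y 0) * f y) := setLIntegral_le_lintegral _ _
      _ = _ := by
        rw [lintegral_const_mul' _ _ (by simp)]
        congr 1
        unfold G pot
        rw [ofReal_integral_eq_lintegral_ofReal hint (Eventually.of_forall hKn)]
  have h3 : G f none (pt x r) ≤ Q f (pt x r) ^ (1/2:ℝ) := by
    rw [← Real.sqrt_eq_rpow]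
    refine Real.le_sqrt_of_sq_le ?_
    exact Finset.single_le_sum (f := fun k => G f k (pt x r) ^ 2) (fun _ _ => sq_nonneg _) (Finset.mem_univ none)
  calc _ ≤ (volume (Cube c r))⁻¹ * (ENNReal.ofReal ((4 * n + 1) ^ mm n * r ^ n) *
          ENNReal.ofReal (Q f (pt x r) ^ (1/2:ℝ))) := by
        gcongr
        exact h2.trans (by gcongr)
    _ ≤ _ := by
      rw [← mul_assoc]
      gcongr
      rw [cube_vol, ← ENNReal.ofReal_pow (by positivity), ← ENNReal.ofReal_inv_of_pos (by positivity),
        ← ENNReal.ofReal_mul (by positivity)]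
      gcongr
      have hp : 0 < (4 * n + 1 : ℝ) ^ mm n := by positivity
      have : (1:ℝ) ≤ 2 ^ n := one_le_pow₀ (by norm_num)
      rw [inv_mul_le_iff₀ (by positivity), mul_pow]
      have h5 : 0 < (4 * n + 1 : ℝ) ^ mm n * r ^ n := by positivity
      nlinarith

end RW

namespace RW

theorem nontriv {n : ℕ} (hn : 1 ≤ n) : Nontrivial (Rn n) := by
  haveI : Nonempty (Fin n) := ⟨⟨0, hn⟩⟩
  infer_instance

def loc {n : ℕ} (y : Rn n) : ℝ := (Metric.ball (0:Rn n) 1).indicator (fun y => ‖y‖ * (‖y‖ ^ n)⁻¹) y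

theorem loc_int {n : ℕ} (hn : 1 ≤ n) : Integrable (loc : Rn n → ℝ) := by
  haveI := nontriv hn
  unfold loc
  rw [integrable_indicator_iff Metric.isOpen_ball.measurableSet]
  rw [integrableOn_fun_norm_addHaar volume (f := fun r : ℝ => r * (r ^ n)⁻¹)]
  have : Set.EqOn (fun y : ℝ ↦ y ^ (Module.finrank ℝ (Rn n) - 1) • (y * (y ^ n)⁻¹)) (fun _ => 1) (Set.Ioo 0 1) := by
    intro y hy
    have hy0 : 0 < y := hy.1
    obtain ⟨m, rfl⟩ : ∃ m, n = m + 1 := ⟨n - 1, by omega⟩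
    simp only [finrank_euclideanSpace, Fintype.card_fin, smul_eq_mul, Nat.add_sub_cancel]
    rw [pow_succ]; field_simp
  rw [integrableOn_congr_fun this measurableSet_Ioo]
  simp

theorem loc_nonneg {n : ℕ} (y : Rn n) : 0 ≤ loc y := Set.indicator_nonneg (fun y _ => by positivity) y

def Dom {n : ℕ} (h : Rn n → ℝ) (L : ℝ) (x y : Rn n) : ℝ := 2 * L * loc y + |h (x - y)| + |h (x + y)|

theorem shift_int1 {n : ℕ} {h : Rn n → ℝ} {B N : ℝ} (hh : BC h B N) (x : Rn n) :
    Integrable fun y => h (x - y) := hh.integrable.comp_sub_left x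
theorem shift_int2 {n : ℕ} {h : Rn n → ℝ} {B N : ℝ} (hh : BC h B N) (x : Rn n) :
    Integrable fun y => h (x + y) := hh.integrable.comp_add_left x

theorem Dom_int {n : ℕ} (hn : 1 ≤ n) {h : Rn n → ℝ} {B N L : ℝ} (hh : BC h B N) (x : Rn n) :
    Integrable (Dom h L x) :=
  (((loc_int hn).const_mul _).add (shift_int1 hh x).abs).add (shift_int2 hh x).abs

theorem Dom_integral {n : ℕ} (hn : 1 ≤ n) {h : Rn n → ℝ} {B N L : ℝ} (hh : BC h B N) (x : Rn n) :
    ∫ y, Dom h L x y = 2 * L * (∫ y : Rn n, loc y) + 2 * ∫ y, |h y| := by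
  unfold Dom
  have a1 : Integrable fun y : Rn n => 2 * L * loc y := (loc_int hn).const_mul _
  have a2 : Integrable fun y : Rn n => 2 * L * loc y + |h (x - y)| := a1.add (shift_int1 hh x).abs
  rw [integral_add a2 (shift_int2 hh x).abs,
    integral_add a1 (shift_int1 hh x).abs, integral_const_mul,
    integral_sub_left_eq_self (fun y => |h y|) volume x, integral_add_left_eq_self (fun y => |h y|) x]
  ring

theorem Dom_ge {n : ℕ} {h : Rn n → ℝ} {L : ℝ} (hL : ∀ x y, |h x - h y| ≤ L * ‖x - y‖) (hL0 : 0 ≤ L)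
    (x y : Rn n) (k : ℝ) (hk : |k| ≤ (‖y‖ ^ n)⁻¹) : |k * (h (x - y) - h (x + y))| ≤ Dom h L x y := by
  rw [abs_mul]
  refine (mul_le_mul_of_nonneg_right hk (abs_nonneg _)).trans ?_
  unfold Dom
  by_cases hy : ‖y‖ < 1
  · have h1 : |h (x - y) - h (x + y)| ≤ L * (2 * ‖y‖) := by
      refine (hL _ _).trans (le_of_eq ?_)
      rw [show x - y - (x + y) = (-2:ℝ) • y by module, norm_smul]
      simp
    have h2 : loc y = ‖y‖ * (‖y‖ ^ n)⁻¹ := Set.indicator_of_mem (by simpa using hy) _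
    rw [h2]
    have : (‖y‖ ^ n)⁻¹ * |h (x - y) - h (x + y)| ≤ (‖y‖ ^ n)⁻¹ * (L * (2 * ‖y‖)) := by gcongr
    have := abs_nonneg (h (x - y))
    have := abs_nonneg (h (x + y))
    linarith
  · push Not at hy
    have h1 : (‖y‖ ^ n)⁻¹ ≤ 1 := inv_le_one_of_one_le₀ (one_le_pow₀ hy)
    have h2 : |h (x - y) - h (x + y)| ≤ |h (x - y)| + |h (x + y)| := abs_sub _ _
    have h3 := loc_nonneg y
    have h4 : 0 ≤ 2 * L * loc y := by positivity
    have := mul_le_of_le_one_left (abs_nonneg (h (x - y) - h (x + y))) h1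
    linarith

theorem K_le' {n : ℕ} (k : Option (Fin n)) (y : Rn n) (hy : y ≠ 0) (δ : ℝ) :
    |K k (pt y δ)| ≤ (‖y‖ ^ n)⁻¹ := by
  have hy0 : 0 < ‖y‖ := norm_pos_iff.2 hy
  have h := (kerK k).bd' (pt y δ) (‖y‖ ^ 2) (by positivity) (by rw [S_pt]; nlinarith [sq_nonneg δ])
  rw [one_mul] at h
  refine h.trans (le_of_eq ?_)
  rw [← Real.rpow_natCast ‖y‖ 2, ← Real.rpow_mul hy0.le, ← Real.rpow_natCast ‖y‖ n, ← Real.rpow_neg hy0.le]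
  congr 1; push_cast; ring

theorem kr_le {n : ℕ} (j : Fin n) (y : Rn n) : |y j / ‖y‖ ^ (n + 1)| ≤ (‖y‖ ^ n)⁻¹ := by
  by_cases hy : y = 0
  · subst hy; simp
  have hy0 : 0 < ‖y‖ := norm_pos_iff.2 hy
  rw [abs_div, abs_of_pos (by positivity : 0 < ‖y‖ ^ (n+1)), pow_succ, div_le_iff₀ (by positivity)]
  have := abs_coord_le y j
  field_simp
  exact this

theorem K_some {n : ℕ} (j : Fin n) (y : Rn n) (δ : ℝ) :
    K (some j) (pt y δ) = y j * (‖y‖ ^ 2 + δ ^ 2) ^ (-mm n) := by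
  unfold K; rw [S_pt, pt_some]

theorem K_zero {n : ℕ} (j : Fin n) (y : Rn n) (hy : y ≠ 0) :
    y j / ‖y‖ ^ (n + 1) = y j * (‖y‖ ^ 2 + 0 ^ 2) ^ (-mm n) := by
  have hy0 : 0 < ‖y‖ := norm_pos_iff.2 hy
  rw [zero_pow two_ne_zero, add_zero, ← Real.rpow_natCast ‖y‖ 2, ← Real.rpow_mul hy0.le, div_eq_mul_inv,
    ← Real.rpow_natCast ‖y‖ (n+1), ← Real.rpow_neg hy0.le]
  congr 2; unfold mm; push_cast; ring

def Rl {n : ℕ} (j : Fin n) (h : Rn n → ℝ) (x : Rn n) : ℝ :=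
  (1/2) * ∫ y, y j / ‖y‖ ^ (n + 1) * (h (x - y) - h (x + y))

theorem Ker_int' {n : ℕ} {h : Rn n → ℝ} {B N : ℝ} (hh : BC h B N) (k : Option (Fin n)) (x : Rn n) (δ : ℝ)
    (hδ : 0 < δ) : Integrable fun y => K k (pt y δ) * h (x - y) := by
  have := ((kerK k).integrable hh (pt x δ) hδ).comp_sub_left x
  simpa only [pt_sub, sub_zero, _root_.sub_sub_cancel] using this

theorem Ker_eq {n : ℕ} (h : Rn n → ℝ) (k : Option (Fin n)) (x : Rn n) (δ : ℝ) :
    G h k (pt x δ) = ∫ y, K k (pt y δ) * h (x - y) := by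
  rw [← integral_sub_left_eq_self (fun y => K k (pt y δ) * h (x - y)) volume x]
  simp only [G, pot, pt_sub, sub_zero, _root_.sub_sub_cancel]

theorem Gsym {n : ℕ} {h : Rn n → ℝ} {B N : ℝ} (hh : BC h B N) (j : Fin n) (x : Rn n) (δ : ℝ)
    (hδ : 0 < δ) : G h (some j) (pt x δ) =
      (1/2) * ∫ y, K (some j) (pt y δ) * (h (x - y) - h (x + y)) := by
  have i1 := Ker_int' hh (some j) x δ hδ
  have e : ∀ y, K (some j) (pt (-y) δ) * h (x - -y) = -(K (some j) (pt y δ) * h (x + y)) := fun y => by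
    rw [K_some, K_some, sub_neg_eq_add, norm_neg]; simp
  have i2 := i1.comp_neg
  simp only [e] at i2
  have h2 := integral_neg_eq_self (fun y => K (some j) (pt y δ) * h (x - y)) volume
  simp only [e] at h2
  have h3 : ∫ y, K (some j) (pt y δ) * (h (x - y) - h (x + y)) =
      (∫ y, K (some j) (pt y δ) * h (x - y)) + ∫ y, -(K (some j) (pt y δ) * h (x + y)) := by
    rw [← integral_add i1 i2]
    congr 1; funext y; ring
  rw [h3, h2, Ker_eq]; ring

theorem trunc_sym {n : ℕ} {h : Rn n → ℝ} {B N : ℝ} (hh : BC h B N) (j : Fin n) (x : Rn n) (ε : ℝ)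
    (hε : 0 < ε) : rieszTrunc j ε h x = rieszConst n * ((1/2) *
      ∫ y, {y : Rn n | ε < ‖y‖}.indicator (fun y => y j / ‖y‖ ^ (n + 1) * (h (x - y) - h (x + y))) y) := by
  have hs : MeasurableSet {y : Rn n | ε < ‖y‖} := measurableSet_lt measurable_const measurable_norm
  set F : Rn n → ℝ := {y : Rn n | ε < ‖y‖}.indicator (fun y => h (x - y) * (y j / ‖y‖ ^ (n + 1))) with hF
  have hFi : Integrable F := by
    rw [hF, integrable_indicator_iff hs]
    refine Integrable.mul_bdd (c := (ε ^ n)⁻¹) (shift_int1 hh x).restrict ?_ ?_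
    · refine Measurable.aestronglyMeasurable ?_
      fun_prop
    · refine (ae_restrict_iff' hs).2 (Eventually.of_forall fun y hy => ?_)
      refine (kr_le j y).trans ?_
      have : ε < ‖y‖ := hy
      gcongr
  have e : ∀ y, F (-y) = -({y : Rn n | ε < ‖y‖}.indicator (fun y => h (x + y) * (y j / ‖y‖ ^ (n + 1))) y) := by
    intro y
    by_cases hy : ε < ‖y‖
    · simp [hF, hy, neg_div]
    · simp [hF, hy]
  have i2 := hFi.comp_neg
  have h2 := integral_neg_eq_self F volume
  unfold rieszTrunc
  rw [← integral_indicator hs]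
  change rieszConst n * ∫ y, F y = _
  congr 1
  have h3 : ∫ y, {y : Rn n | ε < ‖y‖}.indicator (fun y => y j / ‖y‖ ^ (n + 1) * (h (x - y) - h (x + y))) y =
      (∫ y, F y) + ∫ y, F (-y) := by
    rw [← integral_add hFi i2]
    congr 1; funext y; rw [e y]
    by_cases hy : ε < ‖y‖
    · simp [hF, hy]; ring
    · simp [hF, hy]
  rw [h3, h2]; ring

theorem ae_ne_zero {n : ℕ} (hn : 1 ≤ n) : ∀ᵐ y : Rn n, y ≠ 0 := by
  haveI := nontriv hn
  rw [ae_iff]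
  simp

theorem G_lim {n : ℕ} (hn : 1 ≤ n) {h : Rn n → ℝ} {B N L : ℝ} (hh : BC h B N)
    (hL : ∀ x y, |h x - h y| ≤ L * ‖x - y‖) (hL0 : 0 ≤ L) (j : Fin n) (x : Rn n) :
    Tendsto (fun δ => G h (some j) (pt x δ)) (𝓝[>] 0) (𝓝 (Rl j h x)) := by
  have hev : ∀ᶠ δ : ℝ in 𝓝[>] 0, 0 < δ := self_mem_nhdsWithin
  refine Tendsto.congr' (hev.mono fun δ hδ => (Gsym hh j x δ hδ).symm) ?_
  refine Tendsto.const_mul _ ?_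
  refine tendsto_integral_filter_of_dominated_convergence (Dom h L x) (Eventually.of_forall fun δ => ?_)
    (Eventually.of_forall fun δ => ?_) (Dom_int hn hh x) ?_
  · simp only [K_some]
    have := hh.meas
    refine Measurable.aestronglyMeasurable ?_
    fun_prop
  · filter_upwards [ae_ne_zero hn] with y hy
    exact Dom_ge hL hL0 x y _ (K_le' _ y hy δ)
  · filter_upwards [ae_ne_zero hn] with y hy
    refine Tendsto.mul_const _ ?_
    simp only [K_some, K_zero j y hy]
    have hy0 : 0 < ‖y‖ := norm_pos_iff.2 hy
    have : ContinuousAt (fun δ : ℝ => y j * (‖y‖ ^ 2 + δ ^ 2) ^ (-mm n)) 0 := by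
      refine ContinuousAt.mul continuousAt_const (ContinuousAt.rpow_const (by fun_prop) (Or.inl ?_))
      positivity
    exact this.tendsto.mono_left nhdsWithin_le_nhds

theorem trunc_lim {n : ℕ} (hn : 1 ≤ n) {h : Rn n → ℝ} {B N L : ℝ} (hh : BC h B N)
    (hL : ∀ x y, |h x - h y| ≤ L * ‖x - y‖) (hL0 : 0 ≤ L) (j : Fin n) (x : Rn n) :
    rieszPV j h x = rieszConst n * Rl j h x := by
  refine Tendsto.limUnder_eq ?_
  have hev : ∀ᶠ δ : ℝ in 𝓝[>] 0, 0 < δ := self_mem_nhdsWithin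
  refine Tendsto.congr' (hev.mono fun δ hδ => (trunc_sym hh j x δ hδ).symm) ?_
  refine Tendsto.const_mul _ (Tendsto.const_mul _ ?_)
  refine tendsto_integral_filter_of_dominated_convergence (Dom h L x) (Eventually.of_forall fun δ => ?_)
    (Eventually.of_forall fun δ => ?_) (Dom_int hn hh x) ?_
  · have hs : MeasurableSet {y : Rn n | δ < ‖y‖} := measurableSet_lt measurable_const measurable_norm
    have := hh.meas
    refine (Measurable.indicator ?_ hs).aestronglyMeasurable
    fun_prop
  · refine Eventually.of_forall fun y => ?_
    have h1 := Dom_ge hL hL0 x y _ (kr_le j y)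
    by_cases hy : δ < ‖y‖
    · rw [Set.indicator_of_mem (by exact hy)]; exact h1
    · simp only [Set.mem_setOf_eq, hy, not_false_eq_true, Set.indicator_of_notMem, norm_zero]
      exact (abs_nonneg _).trans h1
  · filter_upwards [ae_ne_zero hn] with y hy
    have hy0 : 0 < ‖y‖ := norm_pos_iff.2 hy
    refine tendsto_const_nhds.congr' ?_
    have : ∀ᶠ δ : ℝ in 𝓝[>] 0, δ < ‖y‖ := mem_nhdsWithin_of_mem_nhds (gt_mem_nhds hy0)
    filter_upwards [this] with δ hδ
    simp [hδ]

theorem G_bdd {n : ℕ} (hn : 1 ≤ n) {h : Rn n → ℝ} {B N L : ℝ} (hh : BC h B N)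
    (hL : ∀ x y, |h x - h y| ≤ L * ‖x - y‖) (hL0 : 0 ≤ L) (j : Fin n) (x : Rn n) (δ : ℝ) (hδ : 0 < δ) :
    |G h (some j) (pt x δ)| ≤ 2 * L * (∫ y : Rn n, loc y) + 2 * ∫ y, |h y| := by
  rw [Gsym hh j x δ hδ, ← Dom_integral hn hh x (L := L), abs_mul, abs_of_pos (by norm_num : (0:ℝ) < 1/2)]
  have h1 : |∫ y, K (some j) (pt y δ) * (h (x - y) - h (x + y))| ≤ ∫ y, Dom h L x y := by
    rw [← Real.norm_eq_abs]
    refine norm_integral_le_of_norm_le (Dom_int hn hh x) ?_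
    filter_upwards [ae_ne_zero hn] with y hy
    exact Dom_ge hL hL0 x y _ (K_le' _ y hy δ)
  have := abs_nonneg (∫ y, K (some j) (pt y δ) * (h (x - y) - h (x + y)))
  linarith

theorem G0_lim {n : ℕ} {h : Rn n → ℝ} {B N : ℝ} (hh : BC h B N) (hc : Continuous h) (x : Rn n) :
    Tendsto (fun δ => G h none (pt x δ)) (𝓝[>] 0) (𝓝 (cc n * h x)) := by
  have hev : ∀ᶠ δ : ℝ in 𝓝[>] 0, 0 < δ := self_mem_nhdsWithin
  refine Tendsto.congr' (hev.mono fun δ hδ => (G_none_eq h x δ hδ).symm) ?_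
  have := (Vv_cont hc hh.bd).comp (continuous_pt.comp (by fun_prop : Continuous fun δ : ℝ => (x, δ)))
  have h2 := this.tendsto 0
  simp only [Vv, Function.comp_def, px_pt, pt_none, zero_smul, sub_zero, integral_mul_const] at h2
  exact h2.mono_left nhdsWithin_le_nhds

theorem G0_bdd {n : ℕ} {h : Rn n → ℝ} {B N : ℝ} (hh : BC h B N) (x : Rn n) (δ : ℝ) (hδ : 0 < δ) :
    |G h none (pt x δ)| ≤ cc n * B := by
  rw [G_none_eq h x δ hδ, cc, ← integral_mul_const, ← Real.norm_eq_abs]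
  refine norm_integral_le_of_norm_le (Pk_int.mul_const _) (Eventually.of_forall fun u => ?_)
  rw [norm_mul, Real.norm_of_nonneg (Pk_pos u).le]
  exact mul_le_mul_of_nonneg_left (hh.bd _) (Pk_pos u).le

def Hh {n : ℕ} (h : Rn n → ℝ) (x : Rn n) : ℝ := (cc n * h x) ^ 2 + ∑ j, Rl j h x ^ 2

theorem Q_lim {n : ℕ} (hn : 1 ≤ n) {h : Rn n → ℝ} {B N L : ℝ} (hh : BC h B N) (hc : Continuous h)
    (hL : ∀ x y, |h x - h y| ≤ L * ‖x - y‖) (hL0 : 0 ≤ L) (x : Rn n) :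
    Tendsto (fun δ => Q h (pt x δ)) (𝓝[>] 0) (𝓝 (Hh h x)) := by
  unfold Q Hh
  simp only [Fintype.sum_option]
  exact ((G0_lim hh hc x).pow 2).add (tendsto_finset_sum _ fun j _ => (G_lim hn hh hL hL0 j x).pow 2)

theorem Q_bdd {n : ℕ} (hn : 1 ≤ n) {h : Rn n → ℝ} {B N L : ℝ} (hh : BC h B N)
    (hL : ∀ x y, |h x - h y| ≤ L * ‖x - y‖) (hL0 : 0 ≤ L) :
    ∃ D, ∀ x δ, 0 < δ → Q h (pt x δ) ≤ D := by
  refine ⟨(cc n * B) ^ 2 + ∑ j : Fin n, (2 * L * (∫ y : Rn n, loc y) + 2 * ∫ y, |h y|) ^ 2, fun x δ hδ => ?_⟩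
  unfold Q
  rw [Fintype.sum_option]
  refine add_le_add ?_ (Finset.sum_le_sum fun j _ => ?_)
  · rw [← sq_abs]; have := G0_bdd hh x δ hδ; gcongr
  · rw [← sq_abs]; have := G_bdd hn hh hL hL0 j x δ hδ; gcongr

theorem Rl_meas {n : ℕ} (hn : 1 ≤ n) {h : Rn n → ℝ} {B N L : ℝ} (hh : BC h B N)
    (hL : ∀ x y, |h x - h y| ≤ L * ‖x - y‖) (hL0 : 0 ≤ L) (j : Fin n) : Measurable (Rl j h) := by
  have ht : Tendsto (fun k : ℕ => 1 / ((k:ℝ) + 1)) atTop (𝓝[>] 0) :=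
    tendsto_nhdsWithin_iff.2 ⟨tendsto_one_div_add_atTop_nhds_zero_nat,
      Eventually.of_forall fun k => by simp only [Set.mem_Ioi]; positivity⟩
  refine measurable_of_tendsto_metrizable (f := fun (k : ℕ) x => G h (some j) (pt x (1 / ((k:ℝ) + 1))))
    (fun k => ?_) (tendsto_pi_nhds.2 fun x => (G_lim hn hh hL hL0 j x).comp ht)
  refine Continuous.measurable ?_
  rw [continuous_iff_continuousAt]
  intro x
  refine ContinuousAt.comp (f := fun x => pt x (1 / ((k:ℝ) + 1))) (contG hh _ (by simp; positivity) _) ?_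
  exact (continuous_pt.comp (by fun_prop : Continuous fun x : Rn n => (x, (1 / ((k:ℝ) + 1))))).continuousAt

theorem Hh_meas {n : ℕ} (hn : 1 ≤ n) {h : Rn n → ℝ} {B N L : ℝ} (hh : BC h B N)
    (hL : ∀ x y, |h x - h y| ≤ L * ‖x - y‖) (hL0 : 0 ≤ L) : Measurable (Hh h) := by
  have := hh.meas
  have := Rl_meas hn hh hL hL0
  unfold Hh
  fun_prop

theorem Q_le_PH {n : ℕ} (hn : 1 ≤ n) {h : Rn n → ℝ} {B N L : ℝ} (hh : BC h B N) (hc : Continuous h)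
    (hL : ∀ x y, |h x - h y| ≤ L * ‖x - y‖) (hL0 : 0 ≤ L) (x : Rn n) (t : ℝ) (ht : 0 < t) :
    cc n * Q h (pt x t) ^ (1/2:ℝ) ≤ ∫ u, Pk u * Hh h (x - t • u) ^ (1/2:ℝ) := by
  obtain ⟨D, hD⟩ := Q_bdd hn hh hL hL0
  have hb1 : (1 - (1/2:ℝ)) * (2 * n) ≤ n + 1 := by linarith
  have hev : ∀ᶠ δ : ℝ in 𝓝[>] 0, 0 < δ := self_mem_nhdsWithin
  refine le_of_tendsto_of_tendsto (b := 𝓝[>] (0:ℝ))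
    (f := fun ε => cc n * Q h (pt x (t + ε)) ^ (1/2:ℝ))
    (g := fun ε => ∫ u, Pk u * Q h (pt (x - t • u) ε) ^ (1/2:ℝ)) ?_ ?_
    (hev.mono fun ε hε => SW hn hh (1/2) (by norm_num) hb1 ε t hε ht x)
  · refine Tendsto.const_mul _ (Tendsto.rpow_const ?_ (Or.inr (by norm_num)))
    have h1 : ContinuousAt (fun ε : ℝ => Q h (pt x (t + ε))) 0 := by
      refine ContinuousAt.comp (f := fun ε : ℝ => pt x (t + ε)) (contQ hh _ (by simpa using ht)) ?_
      exact (continuous_pt.comp (by fun_prop : Continuous fun ε : ℝ => (x, t + ε))).continuousAt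
    have := h1.tendsto
    rw [add_zero] at this
    exact this.mono_left nhdsWithin_le_nhds
  · refine tendsto_integral_filter_of_dominated_convergence (fun u => Pk u * D ^ (1/2:ℝ)) ?_ ?_
      (Pk_int.mul_const _) ?_
    · refine hev.mono fun ε hε => ?_
      have := (contQb hh ε hε (1/2) (by norm_num)).comp (by fun_prop : Continuous fun u : Rn n => x - t • u)
      exact (Pk_cont.mul this).aestronglyMeasurable
    · refine hev.mono fun ε hε => Eventually.of_forall fun u => ?_
      have h0 := Q_nonneg h (pt (x - t • u) ε)
      rw [norm_mul, Real.norm_of_nonneg (Pk_pos u).le, Real.norm_of_nonneg (by positivity)]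
      have := hD (x - t • u) ε hε
      have := Pk_pos u
      gcongr
    · refine Eventually.of_forall fun u => Tendsto.const_mul _ ?_
      exact Tendsto.rpow_const (Q_lim hn hh hc hL hL0 _) (Or.inr (by norm_num))

theorem Hh_le {n : ℕ} (h : Rn n → ℝ) (x : Rn n) : Hh h x ^ (1/2:ℝ) ≤ cc n * |h x| + ∑ j, |Rl j h x| := by
  have hcc := cc_pos n
  rw [← Real.sqrt_eq_rpow]
  refine Real.sqrt_le_iff.2 ⟨by positivity, ?_⟩
  unfold Hh
  have h1 : ∑ j, Rl j h x ^ 2 ≤ (∑ j, |Rl j h x|) ^ 2 := by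
    have := Finset.sum_sq_le_sq_sum_of_nonneg (s := Finset.univ) (f := fun j => |Rl j h x|) (fun i _ => abs_nonneg _)
    simpa using this
  have h2 : (cc n * h x) ^ 2 = (cc n * |h x|) ^ 2 := by rw [mul_pow, mul_pow, sq_abs]
  have h3 : 0 ≤ ∑ j, |Rl j h x| := by positivity
  have h4 : 0 ≤ cc n * |h x| := by positivity
  nlinarith

end RW

namespace RW

def en {n : ℕ} (h : Rn n → ℝ) (x : Rn n) : ℝ≥0∞ := (‖h x‖₊ : ℝ≥0∞)

theorem en_eq {n : ℕ} (h : Rn n → ℝ) (x : Rn n) : en h x = ENNReal.ofReal |h x| := by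
  unfold en
  rw [← Real.norm_eq_abs]
  exact (ofReal_norm_eq_enorm _).symm

theorem rho_zero {n : ℕ} (X : BFSNorm n) : X.ρ (fun _ => 0) = 0 :=
  (X.eq_zero_iff _ measurable_const).2 (Eventually.of_forall fun _ => rfl)

theorem rho_sum {n : ℕ} (X : BFSNorm n) {ι : Type*} (s : Finset ι) (F : ι → Rn n → ℝ≥0∞) :
    X.ρ (fun x => ∑ i ∈ s, F i x) ≤ ∑ i ∈ s, X.ρ (F i) := by
  classical
  induction s using Finset.induction_on with
  | empty => simp [rho_zero]
  | insert a s ha ih =>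
    simp only [Finset.sum_insert ha]
    exact (X.add_le _ _).trans (add_le_add_right ih _)

theorem rho_BC {n : ℕ} (X : BFSNorm n) {h : Rn n → ℝ} {B N : ℝ} (hh : BC h B N) : X.ρ (en h) < ⊤ := by
  have h1 := X.indicator_lt_top (Metric.closedBall 0 N) Metric.isClosed_closedBall.measurableSet
    Metric.isBounded_closedBall
  have h2 : X.ρ (en h) ≤ X.ρ (fun x => ((B.toNNReal : ℝ≥0) : ℝ≥0∞) * (Metric.closedBall (0:Rn n) N).indicator 1 x) := by
    refine X.mono _ _ (Eventually.of_forall fun x => ?_)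
    by_cases hx : x ∈ Metric.closedBall (0:Rn n) N
    · rw [Set.indicator_of_mem hx, en_eq, Pi.one_apply, mul_one]
      exact ENNReal.ofReal_le_ofReal (hh.bd x)
    · have : h x = 0 := hh.supp x (by simpa using hx)
      simp [en_eq, this]
  rw [X.smul] at h2
  exact h2.trans_lt (ENNReal.mul_lt_top (by simp) h1)

theorem rho_fatou {n : ℕ} (X : BFSNorm n) (F : ℕ → Rn n → ℝ≥0∞) (f : Rn n → ℝ≥0∞) (C : ℝ≥0∞)
    (hF : ∀ x, Tendsto (fun k => F k x) atTop (𝓝 (f x))) (hC : ∀ k, X.ρ (F k) ≤ C) : X.ρ f ≤ C := by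
  rw [X.sup_eq (fun k x => ⨅ j ≥ k, F j x) f]
  · refine iSup_le fun k => le_trans (X.mono _ _ (Eventually.of_forall fun x => ?_)) (hC k)
    exact iInf₂_le k le_rfl
  · refine Eventually.of_forall fun x k k' hk => ?_
    exact le_iInf₂ fun j hj => iInf₂_le j (hk.trans hj)
  · refine Eventually.of_forall fun x => ?_
    rw [← liminf_eq_iSup_iInf_of_nat]
    exact (hF x).liminf_eq

theorem rieszConst_pos (n : ℕ) : 0 < rieszConst n := by
  unfold rieszConst
  have := Real.Gamma_pos_of_pos (s := ((n:ℝ) + 1) / 2) (by positivity)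
  positivity

theorem RB_lip {n : ℕ} (hn : 1 ≤ n) (X : BFSNorm n)
    (hM : ∃ C : ℝ≥0, 0 < C ∧ ∀ f : Rn n → ℝ≥0∞, Measurable f →
      X.ρ (maximal f) ≤ (C : ℝ≥0∞) * X.ρ f)
    (hR : ∀ j : Fin n, ∃ C : ℝ≥0, 0 < C ∧ ∀ f : Rn n → ℝ, Measurable f →
      X.normR f < ⊤ →
      (∀ᵐ x ∂volume,
        Tendsto (fun ε => rieszTrunc j ε f x) (𝓝[>] (0 : ℝ)) (𝓝 (rieszPV j f x))) ∧
      X.normR (rieszPV j f) ≤ (C : ℝ≥0∞) * X.normR f) :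
    ∃ C : ℝ≥0, ∀ (h : Rn n → ℝ) (B N L : ℝ), BC h B N → Continuous h →
      (∀ x y, |h x - h y| ≤ L * ‖x - y‖) → 0 ≤ L → ∀ t, 0 < t →
      X.ρ (fun x => ENNReal.ofReal (Q h (pt x t) ^ (1/2:ℝ))) ≤ C * X.ρ (en h) := by
  obtain ⟨CM, hCM0, hCM⟩ := hM
  choose CR hCR0 hCR using hR
  have hcc := cc_pos n
  have hrc := rieszConst_pos n
  set c1 : ℝ≥0 := ((cc n)⁻¹ * 2 ^ (2 * n + 2)).toNNReal with hc1
  set c2 : ℝ≥0 := (cc n).toNNReal with hc2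
  set c3 : ℝ≥0 := ((rieszConst n)⁻¹).toNNReal with hc3
  refine ⟨c1 * (CM * (c2 + ∑ j, c3 * CR j)), fun h B N L hh hc hL hL0 t ht => ?_⟩
  set Φ : Rn n → ℝ≥0∞ := fun x => ENNReal.ofReal (Hh h x ^ (1/2:ℝ)) with hΦ
  have hΦm : Measurable Φ := by
    have := Hh_meas hn hh hL hL0
    exact (this.pow_const _).ennreal_ofReal
  have hH0 : ∀ x, 0 ≤ Hh h x := fun x => by unfold Hh; positivity
  have s1 : ∀ x, ENNReal.ofReal (Q h (pt x t) ^ (1/2:ℝ)) ≤ (c1:ℝ≥0∞) * maximal Φ x := by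
    intro x
    have a1 := Q_le_PH hn hh hc hL hL0 x t ht
    have a2 : Q h (pt x t) ^ (1/2:ℝ) ≤ (cc n)⁻¹ * ∫ u, Pk u * Hh h (x - t • u) ^ (1/2:ℝ) := by
      rw [le_inv_mul_iff₀ hcc]; exact a1
    have a3 : ENNReal.ofReal (∫ u, Pk u * Hh h (x - t • u) ^ (1/2:ℝ)) ≤
        ENNReal.ofReal (2 ^ (2 * n + 2)) * maximal Φ x := by
      refine le_trans ?_ (poisson_le_max Φ hΦm x t ht)
      by_cases hi : Integrable fun u => Pk u * Hh h (x - t • u) ^ (1/2:ℝ)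
      · rw [ofReal_integral_eq_lintegral_ofReal hi (Eventually.of_forall fun u => by
          have := Pk_pos u
          have := hH0 (x - t • u)
          simp only [Pi.zero_apply]
          positivity)]
        simp only [ENNReal.ofReal_mul (Pk_pos _).le]
        exact le_rfl
      · rw [integral_undef hi]; simp
    refine (ENNReal.ofReal_le_ofReal a2).trans ?_
    rw [ENNReal.ofReal_mul (by positivity)]
    refine (mul_le_mul_right a3 _).trans (le_of_eq ?_)
    rw [← mul_assoc, ← ENNReal.ofReal_mul (by positivity)]
    rfl
  have s2 : ∀ x, Φ x ≤ (c2:ℝ≥0∞) * en h x + ∑ j, (c3:ℝ≥0∞) * en (rieszPV j h) x := by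
    intro x
    refine (ENNReal.ofReal_le_ofReal (Hh_le h x)).trans ?_
    rw [ENNReal.ofReal_add (by positivity) (by positivity), ENNReal.ofReal_mul hcc.le, en_eq,
      ENNReal.ofReal_sum_of_nonneg fun _ _ => abs_nonneg _]
    refine add_le_add le_rfl (Finset.sum_le_sum fun j _ => ?_)
    rw [en_eq, trunc_lim hn hh hL hL0, abs_mul, abs_of_pos hrc, hc3]
    change _ ≤ ENNReal.ofReal _ * _
    rw [← ENNReal.ofReal_mul (by positivity), inv_mul_cancel_left₀ hrc.ne']
  have hfin : X.normR h < ⊤ := rho_BC X hh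
  calc X.ρ (fun x => ENNReal.ofReal (Q h (pt x t) ^ (1/2:ℝ)))
      ≤ X.ρ (fun x => (c1:ℝ≥0∞) * maximal Φ x) := X.mono _ _ (Eventually.of_forall s1)
    _ = c1 * X.ρ (maximal Φ) := X.smul _ _
    _ ≤ c1 * (CM * X.ρ Φ) := by gcongr; exact hCM Φ hΦm
    _ ≤ c1 * (CM * ((c2 + ∑ j, c3 * CR j) * X.ρ (en h))) := by
        gcongr
        refine (X.mono _ _ (Eventually.of_forall s2)).trans ?_
        refine (X.add_le _ _).trans ?_
        rw [add_mul, X.smul, ENNReal.coe_finset_sum, Finset.sum_mul]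
        refine add_le_add le_rfl ((rho_sum X _ _).trans (Finset.sum_le_sum fun j _ => ?_))
        rw [X.smul, ENNReal.coe_mul, mul_assoc]
        gcongr
        exact (hCR j h hh.meas hfin).2
    _ = _ := by push_cast; ring

/- mollification -/
def tent {n : ℕ} (u : Rn n) : ℝ := max 0 (1 - ‖u‖)
def ta (n : ℕ) : ℝ := ∫ u : Rn n, tent u
theorem tent_nonneg {n : ℕ} (u : Rn n) : 0 ≤ tent u := le_max_left _ _
theorem tent_le_one {n : ℕ} (u : Rn n) : tent u ≤ 1 := max_le (by norm_num) (by linarith [norm_nonneg u])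
theorem tent_zero {n : ℕ} (u : Rn n) (hu : 1 < ‖u‖) : tent u = 0 := max_eq_left (by linarith)
theorem tent_cont {n : ℕ} : Continuous (tent : Rn n → ℝ) := by unfold tent; fun_prop
theorem tent_BC {n : ℕ} : BC (tent : Rn n → ℝ) 1 1 :=
  ⟨tent_cont.measurable, fun y => by rw [abs_of_nonneg (tent_nonneg y)]; exact tent_le_one y, tent_zero, by norm_num⟩
theorem tent_lip {n : ℕ} (u v : Rn n) : |tent u - tent v| ≤ ‖u - v‖ := by
  unfold tent
  refine (abs_max_sub_max_le_max _ _ _ _).trans ?_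
  simp only [sub_self, abs_zero]
  refine max_le (norm_nonneg _) ?_
  rw [show 1 - ‖u‖ - (1 - ‖v‖) = -(‖u‖ - ‖v‖) by ring, abs_neg]
  exact abs_norm_sub_norm_le u v
theorem ta_pos (n : ℕ) : 0 < ta n := by
  unfold ta
  refine (Continuous.integral_pos_of_hasCompactSupport_nonneg_nonzero tent_cont ?_ tent_nonneg (x := 0) ?_)
  · refine HasCompactSupport.of_support_subset_isCompact (isCompact_closedBall (0:Rn n) 1) fun u hu => ?_
    by_contra h
    exact hu (tent_zero u (by simpa using h))
  · simp [tent]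

theorem tent_le_Pk {n : ℕ} (u : Rn n) : tent u ≤ 2 ^ mm n * Pk u := by
  by_cases hu : 1 < ‖u‖
  · rw [tent_zero u hu]; have := Pk_pos u; positivity
  · push Not at hu
    refine (tent_le_one u).trans ?_
    unfold Pk
    have h1 : (1 + ‖u‖ ^ 2) ≤ 2 := by nlinarith [norm_nonneg u]
    have h2 := Real.rpow_le_rpow_of_nonpos (by positivity) h1 (show -mm n ≤ 0 by linarith [mm_pos n])
    have : (2:ℝ) ^ mm n * 2 ^ (-mm n) = 1 := by
      rw [← Real.rpow_add (by norm_num)]; simp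
    calc (1:ℝ) = 2 ^ mm n * 2 ^ (-mm n) := this.symm
      _ ≤ _ := mul_le_mul_of_nonneg_left h2 (by positivity)

def mol {n : ℕ} (s : ℝ) (h : Rn n → ℝ) (x : Rn n) : ℝ := (ta n)⁻¹ * ∫ u, tent u * h (x - s • u)

theorem mol_int {n : ℕ} (s : ℝ) {h : Rn n → ℝ} {B N : ℝ} (hh : BC h B N) (x : Rn n) :
    Integrable fun u => tent u * h (x - s • u) :=
  tent_BC.integrable.mul_bdd (c := B)
    (hh.meas.comp (by fun_prop : Measurable fun u : Rn n => x - s • u)).aestronglyMeasurable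
    (Eventually.of_forall fun y => hh.bd _)

theorem mol_eq {n : ℕ} (s : ℝ) (hs : 0 < s) (h : Rn n → ℝ) (x : Rn n) :
    ∫ u, tent u * h (x - s • u) = (s ^ n)⁻¹ * ∫ y, tent (s⁻¹ • (x - y)) * h y := by
  have h1 : ∫ y, tent (s⁻¹ • (x - y)) * h y = ∫ y, tent (s⁻¹ • y) * h (x - y) := by
    rw [← integral_sub_left_eq_self (fun y => tent (s⁻¹ • y) * h (x - y)) volume x]
    simp only [_root_.sub_sub_cancel]
  rw [h1]
  have h2 := Measure.integral_comp_smul (volume : Measure (Rn n))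
    (fun y => tent (s⁻¹ • y) * h (x - y)) s
  simp only [smul_smul, inv_mul_cancel₀ hs.ne', one_smul, finrank_euclideanSpace, Fintype.card_fin,
    smul_eq_mul] at h2
  rw [abs_of_pos (by positivity)] at h2
  exact h2

theorem mol_lip {n : ℕ} (s : ℝ) (hs : 0 < s) {h : Rn n → ℝ} {B N : ℝ} (hh : BC h B N) (x x' : Rn n) :
    |mol s h x - mol s h x'| ≤ ((ta n)⁻¹ * ((s ^ n)⁻¹ * (s⁻¹ * ∫ y, |h y|))) * ‖x - x'‖ := by
  have ht := ta_pos n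
  have hi : ∀ x, Integrable fun y => tent (s⁻¹ • (x - y)) * h y := fun x => by
    refine hh.integrable.bdd_mul (c := 1) ?_ (Eventually.of_forall fun y => tent_BC.bd _)
    exact (tent_cont.comp (by fun_prop)).aestronglyMeasurable
  unfold mol
  rw [mol_eq s hs, mol_eq s hs, ← mul_sub, ← mul_sub, ← integral_sub (hi x) (hi x'), abs_mul, abs_mul,
    abs_of_pos (by positivity), abs_of_pos (by positivity), mul_assoc, mul_assoc]
  gcongr
  rw [mul_comm _ ‖x - x'‖, ← mul_assoc, ← integral_const_mul, ← Real.norm_eq_abs]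
  refine norm_integral_le_of_norm_le (hh.integrable.abs.const_mul _) (Eventually.of_forall fun y => ?_)
  rw [← sub_mul, norm_mul]
  refine mul_le_mul_of_nonneg_right ?_ (norm_nonneg _)
  refine (tent_lip _ _).trans (le_of_eq ?_)
  rw [← smul_sub, norm_smul, sub_sub_sub_cancel_right, Real.norm_of_nonneg (by positivity), mul_comm]

theorem mol_BC {n : ℕ} (s : ℝ) (hs : 0 < s) {h : Rn n → ℝ} {B N : ℝ} (hh : BC h B N) :
    BC (mol s h) B (N + s) ∧ Continuous (mol s h) := by
  have ht := ta_pos n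
  have hI : 0 ≤ ∫ y, |h y| := integral_nonneg fun _ => abs_nonneg _
  have hc : Continuous (mol s h) := by
    refine (LipschitzWith.of_dist_le_mul (K := ((ta n)⁻¹ * ((s ^ n)⁻¹ * (s⁻¹ * ∫ y, |h y|))).toNNReal) fun x y => ?_).continuous
    rw [Real.coe_toNNReal _ (by positivity), dist_eq_norm, dist_eq_norm]
    exact mol_lip s hs hh x y
  refine ⟨⟨hc.measurable, fun x => ?_, fun x hx => ?_, by have := hh.hN; positivity⟩, hc⟩
  · unfold mol
    rw [abs_mul, abs_of_pos (by positivity), inv_mul_le_iff₀ ht, ta, ← integral_mul_const, ← Real.norm_eq_abs]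
    refine norm_integral_le_of_norm_le (tent_BC.integrable.mul_const _) (Eventually.of_forall fun u => ?_)
    rw [norm_mul, Real.norm_of_nonneg (tent_nonneg u)]
    exact mul_le_mul_of_nonneg_left (hh.bd _) (tent_nonneg u)
  · unfold mol
    have : ∀ u, tent u * h (x - s • u) = 0 := fun u => by
      by_cases hu : 1 < ‖u‖
      · rw [tent_zero u hu, zero_mul]
      · push Not at hu
        rw [hh.supp, mul_zero]
        have h1 : ‖x‖ ≤ ‖x - s • u‖ + ‖s • u‖ := by
          calc ‖x‖ = ‖(x - s • u) + s • u‖ := by simp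
            _ ≤ _ := norm_add_le _ _
        rw [norm_smul, Real.norm_of_nonneg hs.le] at h1
        nlinarith
    simp [this]

theorem mol_max {n : ℕ} (s : ℝ) (hs : 0 < s) {h : Rn n → ℝ} {B N : ℝ} (hh : BC h B N) (x : Rn n) :
    en (mol s h) x ≤ ENNReal.ofReal ((ta n)⁻¹ * (2 ^ mm n * 2 ^ (2 * n + 2))) * maximal (en h) x := by
  have ht := ta_pos n
  have hm : Measurable (en h) := by
    have := hh.meas; unfold en; fun_prop
  rw [en_eq, mol, abs_mul, abs_of_pos (by positivity), ENNReal.ofReal_mul (by positivity),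
    ENNReal.ofReal_mul (by positivity), mul_assoc]
  refine mul_le_mul_right ?_ _
  rw [ENNReal.ofReal_mul (by positivity), mul_assoc]
  refine le_trans ?_ (mul_le_mul_right (poisson_le_max (en h) hm x s hs) _)
  rw [← lintegral_const_mul' _ _ (by simp), ← Real.norm_eq_abs, ofReal_norm_eq_enorm]
  refine (enorm_integral_le_lintegral_enorm _).trans (lintegral_mono fun u => ?_)
  rw [enorm_mul, ← mul_assoc, ← ENNReal.ofReal_mul (by positivity)]
  refine mul_le_mul' ?_ le_rfl
  rw [← ofReal_norm_eq_enorm, Real.norm_of_nonneg (tent_nonneg u)]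
  exact ENNReal.ofReal_le_ofReal (tent_le_Pk u)

theorem G_trans {n : ℕ} (h : Rn n → ℝ) (k : Option (Fin n)) (x v : Rn n) (t : ℝ) :
    ∫ y, K k (pt x t - pt y 0) * h (y - v) = G h k (pt (x - v) t) := by
  rw [← integral_add_right_eq_self (fun y => K k (pt x t - pt y 0) * h (y - v)) v]
  unfold G pot
  congr 1; funext y
  simp only [pt_sub, sub_zero, add_sub_cancel_right]
  rw [show x - (y + v) = x - v - y by abel]

theorem G_mol {n : ℕ} (s : ℝ) (hs : 0 < s) {h : Rn n → ℝ} {B N : ℝ} (hh : BC h B N) (k : Option (Fin n))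
    (x : Rn n) (t : ℝ) (ht : 0 < t) :
    G (mol s h) k (pt x t) = (ta n)⁻¹ * ∫ u, tent u * G h k (pt (x - s • u) t) := by
  have e1 : ∀ y, K k (pt x t - pt y 0) * mol s h y =
      (ta n)⁻¹ * ∫ u, K k (pt x t - pt y 0) * (tent u * h (y - s • u)) := fun y => by
    unfold mol; rw [integral_const_mul]; ring
  have e2 : ∀ u, tent u * G h k (pt (x - s • u) t) = ∫ y, K k (pt x t - pt y 0) * (tent u * h (y - s • u)) :=
    fun u => by
    rw [← G_trans, ← integral_const_mul]
    congr 1; funext y; ring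
  unfold G pot
  simp only [e1, integral_const_mul]
  congr 1
  have e3 : ∀ u, tent u * ∫ y, K k (pt (x - s • u) t - pt y 0) * h y =
    ∫ y, K k (pt x t - pt y 0) * (tent u * h (y - s • u)) := e2
  have e4 : ∀ y, (K k (pt x t - pt y 0) * ∫ u, (tent u * h (y - s • u))) =
    ∫ u, K k (pt x t - pt y 0) * (tent u * h (y - s • u)) := fun y => by rw [integral_const_mul]
  simp only [e3, e4]
  refine integral_integral_swap ?_
  have hKc := (kerK k).cont_shift (pt x t) ht
  have hm : Measurable (fun p : Rn n × Rn n => K k (pt x t - pt p.1 0) * (tent p.2 * h (p.1 - s • p.2))) := by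
    exact (hKc.measurable.comp measurable_fst).mul ((tent_cont.measurable.comp measurable_snd).mul
      (hh.meas.comp (by fun_prop : Measurable fun p : Rn n × Rn n => p.1 - s • p.2)))
  have hb : IntegrableOn (fun p : Rn n × Rn n => K k (pt x t - pt p.1 0) * (tent p.2 * h (p.1 - s • p.2)))
      (Metric.closedBall 0 (N + s) ×ˢ Metric.closedBall 0 1) (volume.prod volume) := by
    refine Measure.integrableOn_of_bounded (M := 1 * (t ^ 2) ^ (-((n:ℝ)/2)) * (1 * B)) ?_
      hm.aestronglyMeasurable ?_
    · rw [Measure.prod_prod]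
      exact (ENNReal.mul_lt_top measure_closedBall_lt_top measure_closedBall_lt_top).ne
    · refine Eventually.of_forall fun p => ?_
      rw [norm_mul, norm_mul]
      have h1 := (kerK k).bd' (pt x t - pt p.1 0) (t ^ 2) (by positivity) (S_ge (pt x t) p.1)
      have h2 := tent_BC.bd p.2
      have h3 := hh.bd (p.1 - s • p.2)
      simp only [Real.norm_eq_abs]
      gcongr
  refine (integrableOn_iff_integrable_of_support_subset ?_).1 hb
  intro p hp
  by_contra hcon
  refine hp ?_
  simp only [Set.mem_prod, Metric.mem_closedBall, dist_zero_right, not_and_or, not_le] at hcon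
  by_cases h2 : 1 < ‖p.2‖
  · show K k (pt x t - pt p.1 0) * (tent p.2 * h (p.1 - s • p.2)) = 0
    rw [tent_zero p.2 h2]; ring
  · have h1 := hcon.resolve_right h2
    push Not at h2
    have : h (p.1 - s • p.2) = 0 := by
      refine hh.supp _ ?_
      have h4 : ‖p.1‖ ≤ ‖p.1 - s • p.2‖ + ‖s • p.2‖ := by
        calc ‖p.1‖ = ‖(p.1 - s • p.2) + s • p.2‖ := by simp
          _ ≤ _ := norm_add_le _ _
      rw [norm_smul, Real.norm_of_nonneg hs.le] at h4
      nlinarith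
    show K k (pt x t - pt p.1 0) * (tent p.2 * h (p.1 - s • p.2)) = 0
    rw [this]; ring

theorem contGx {n : ℕ} {f : Rn n → ℝ} {B N : ℝ} (hf : BC f B N) (ε : ℝ) (hε : 0 < ε) (k) :
    Continuous fun x => G f k (pt x ε) := by
  rw [continuous_iff_continuousAt]
  intro x
  refine ContinuousAt.comp (f := fun x => pt x ε) (contG hf _ hε k) ?_
  exact (continuous_pt.comp (by fun_prop : Continuous fun x : Rn n => (x, ε))).continuousAt

theorem bddGx {n : ℕ} {f : Rn n → ℝ} {B N : ℝ} (hf : BC f B N) (ε : ℝ) (hε : 0 < ε) (k) :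
    ∃ D : ℝ, ∀ x, |G f k (pt x ε)| ≤ D := by
  obtain ⟨D, hD0, hD⟩ := pot_bdx (kerK k) hf ε hε
  refine ⟨D, fun x => (hD x ε le_rfl).trans ?_⟩
  refine mul_le_of_le_one_right hD0 (Real.rpow_le_one_of_one_le_of_nonpos (by simp) ?_)
  have : (0:ℝ) ≤ n := by positivity
  linarith

theorem G_mol_lim {n : ℕ} {h : Rn n → ℝ} {B N : ℝ} (hh : BC h B N) (k : Option (Fin n))
    (x : Rn n) (t : ℝ) (ht : 0 < t) :
    Tendsto (fun s => G (mol s h) k (pt x t)) (𝓝[>] 0) (𝓝 (G h k (pt x t))) := by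
  have hev : ∀ᶠ δ : ℝ in 𝓝[>] 0, 0 < δ := self_mem_nhdsWithin
  refine Tendsto.congr' (hev.mono fun s hs => (G_mol s hs hh k x t ht).symm) ?_
  obtain ⟨D, hD⟩ := bddGx hh t ht k
  have hc := contGx hh t ht k
  have e : G h k (pt x t) = (ta n)⁻¹ * ∫ u : Rn n, tent u * G h k (pt x t) := by
    rw [integral_mul_const]
    change _ = (ta n)⁻¹ * (ta n * _)
    rw [inv_mul_cancel_left₀ (ta_pos n).ne']
  rw [e]
  refine Tendsto.const_mul _ ?_
  refine tendsto_integral_filter_of_dominated_convergence (fun u => tent u * D) (Eventually.of_forall fun s => ?_)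
    (Eventually.of_forall fun s => Eventually.of_forall fun u => ?_) (tent_BC.integrable.mul_const _)
    (Eventually.of_forall fun u => ?_)
  · exact (tent_cont.mul (hc.comp (by fun_prop : Continuous fun u : Rn n => x - s • u))).aestronglyMeasurable
  · rw [norm_mul, Real.norm_of_nonneg (tent_nonneg u)]
    exact mul_le_mul_of_nonneg_left (hD _) (tent_nonneg u)
  · refine Tendsto.const_mul _ ?_
    have := (hc.comp (by fun_prop : Continuous fun s : ℝ => x - s • u)).tendsto 0
    simp only [Function.comp_def, zero_smul, sub_zero] at this
    exact this.mono_left nhdsWithin_le_nhds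

theorem RB {n : ℕ} (hn : 1 ≤ n) (X : BFSNorm n)
    (hM : ∃ C : ℝ≥0, 0 < C ∧ ∀ f : Rn n → ℝ≥0∞, Measurable f →
      X.ρ (maximal f) ≤ (C : ℝ≥0∞) * X.ρ f)
    (hR : ∀ j : Fin n, ∃ C : ℝ≥0, 0 < C ∧ ∀ f : Rn n → ℝ, Measurable f →
      X.normR f < ⊤ →
      (∀ᵐ x ∂volume,
        Tendsto (fun ε => rieszTrunc j ε f x) (𝓝[>] (0 : ℝ)) (𝓝 (rieszPV j f x))) ∧
      X.normR (rieszPV j f) ≤ (C : ℝ≥0∞) * X.normR f) :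
    ∃ C : ℝ≥0, ∀ (h : Rn n → ℝ) (B N : ℝ), BC h B N → ∀ t, 0 < t →
      X.ρ (fun x => ENNReal.ofReal (Q h (pt x t) ^ (1/2:ℝ))) ≤ C * X.ρ (en h) := by
  obtain ⟨C, hC⟩ := RB_lip hn X hM hR
  obtain ⟨CM, hCM0, hCM⟩ := hM
  have hta := ta_pos n
  set c1 : ℝ≥0 := ((ta n)⁻¹ * (2 ^ mm n * 2 ^ (2 * n + 2))).toNNReal with hc1
  refine ⟨C * (c1 * CM), fun h B N hh t ht => ?_⟩
  set s : ℕ → ℝ := fun k => 1 / ((k:ℝ) + 1) with hs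
  have hs0 : ∀ k, 0 < s k := fun k => by simp only [hs]; positivity
  have hst : Tendsto s atTop (𝓝[>] 0) :=
    tendsto_nhdsWithin_iff.2 ⟨tendsto_one_div_add_atTop_nhds_zero_nat, Eventually.of_forall hs0⟩
  refine rho_fatou X (fun k x => ENNReal.ofReal (Q (mol (s k) h) (pt x t) ^ (1/2:ℝ))) _ _ (fun x => ?_) fun k => ?_
  · refine ENNReal.tendsto_ofReal (Tendsto.rpow_const ?_ (Or.inr (by norm_num)))
    unfold Q
    exact tendsto_finset_sum _ fun i _ => ((G_mol_lim hh i x t ht).comp hst).pow 2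
  · have hI : 0 ≤ ∫ y, |h y| := integral_nonneg fun _ => abs_nonneg _
    obtain ⟨b1, b2⟩ := mol_BC (s k) (hs0 k) hh
    have hsk := hs0 k
    refine (hC _ _ _ _ b1 b2 (fun x y => mol_lip (s k) (hs0 k) hh x y) (by positivity) t ht).trans ?_
    push_cast
    rw [mul_assoc, mul_assoc]
    gcongr
    refine (X.mono _ _ (Eventually.of_forall (mol_max (s k) (hs0 k) hh))).trans ?_
    have hm : Measurable (en h) := by
      have := hh.meas; unfold en; fun_prop
    calc _ = X.ρ (fun x => (c1 : ℝ≥0∞) * maximal (en h) x) := rfl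
      _ ≤ _ := by rw [X.smul]; gcongr; exact hCM _ hm

end RW

namespace RW

theorem assoc_scale {n : ℕ} (X : BFSNorm n) (f φ : Rn n → ℝ≥0∞) (hφ : Measurable φ) (c : ℝ≥0) (hc : 0 < c)
    (h : X.ρ φ ≤ c) : ∫⁻ x, f x * φ x ≤ c * assocNorm X.ρ f := by
  have hc' : (c : ℝ≥0∞) ≠ 0 := by exact_mod_cast hc.ne'
  have h1 : ∫⁻ x, f x * (((c⁻¹ : ℝ≥0) : ℝ≥0∞) * φ x) ≤ assocNorm X.ρ f := by
    refine le_iSup_of_le (fun x => ((c⁻¹ : ℝ≥0) : ℝ≥0∞) * φ x) (le_iSup_of_le (by fun_prop) (le_iSup_of_le ?_ le_rfl))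
    rw [X.smul, ENNReal.coe_inv hc.ne']
    calc _ ≤ (c:ℝ≥0∞)⁻¹ * c := by gcongr
      _ = 1 := ENNReal.inv_mul_cancel hc' (by simp)
  have h2 : ∀ x, f x * (((c⁻¹ : ℝ≥0) : ℝ≥0∞) * φ x) = ((c⁻¹ : ℝ≥0) : ℝ≥0∞) * (f x * φ x) := fun x => by ring
  simp only [h2] at h1
  rw [lintegral_const_mul' _ _ (by simp), ENNReal.coe_inv hc.ne'] at h1
  calc _ = (c:ℝ≥0∞) * ((c:ℝ≥0∞)⁻¹ * ∫⁻ x, f x * φ x) := by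
        rw [← mul_assoc, ENNReal.mul_inv_cancel hc' (by simp), one_mul]
    _ ≤ _ := by gcongr

theorem K_par {n : ℕ} (i : Option (Fin n)) : ∃ σ : ℝ, |σ| = 1 ∧ ∀ (x y : Rn n) (ε : ℝ),
    K i (pt x ε - pt y 0) = σ * K i (pt y ε - pt x 0) := by
  have hS : ∀ (x y : Rn n) (ε : ℝ), S (pt x ε - pt y 0) = S (pt y ε - pt x 0) := fun x y ε => by
    rw [pt_sub, pt_sub, S_pt, S_pt, norm_sub_rev]
  cases i with
  | none => exact ⟨1, by simp, fun x y ε => by unfold K; rw [hS]; simp⟩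
  | some j => exact ⟨-1, by simp, fun x y ε => by unfold K; rw [hS]; simp; ring⟩

theorem K_int2 {n : ℕ} (i : Option (Fin n)) {f h : Rn n → ℝ} {B N B' N' : ℝ} (hf : BC f B N) (hh : BC h B' N')
    (ε : ℝ) (hε : 0 < ε) :
    Integrable (fun p : Rn n × Rn n => K i (pt p.1 ε - pt p.2 0) * (h p.1 * f p.2)) (volume.prod volume) := by
  refine (hh.integrable.mul_prod hf.integrable).bdd_mul (c := 1 * (ε ^ 2) ^ (-((n:ℝ)/2))) ?_
    (Eventually.of_forall fun p => ?_)
  · refine Continuous.aestronglyMeasurable ?_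
    rw [continuous_iff_continuousAt]
    intro p
    refine ContinuousAt.comp (f := fun p : Rn n × Rn n => pt p.1 ε - pt p.2 0)
      ((kerK i).cont _ (S_pos (pt p.1 ε) hε p.2)) ?_
    refine Continuous.continuousAt (Continuous.sub ?_ ?_)
    · exact continuous_pt.comp (by fun_prop : Continuous fun p : Rn n × Rn n => (p.1, ε))
    · exact continuous_pt0.comp continuous_snd
  · exact (kerK i).bd' _ (ε ^ 2) (by positivity) (S_ge (pt p.1 ε) p.2)

theorem G_dual {n : ℕ} (i : Option (Fin n)) {f h : Rn n → ℝ} {B N B' N' : ℝ} (hf : BC f B N) (hh : BC h B' N')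
    (hf0 : ∀ y, 0 ≤ f y) (ε : ℝ) (hε : 0 < ε) :
    ∫ x, G f i (pt x ε) * h x ≤ ∫ y, f y * |G h i (pt y ε)| := by
  obtain ⟨σ, hσ, hK⟩ := K_par (n := n) i
  have e1 : ∀ x, G f i (pt x ε) * h x = ∫ y, K i (pt x ε - pt y 0) * (h x * f y) := fun x => by
    unfold G pot
    rw [← integral_mul_const]; congr 1; funext y; ring
  have e2 : ∀ y, ∫ x, K i (pt x ε - pt y 0) * (h x * f y) = f y * (σ * G h i (pt y ε)) := fun y => by
    unfold G pot
    rw [← integral_const_mul, ← integral_const_mul]; congr 1; funext x; rw [hK x y]; ring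
  simp only [e1]
  rw [integral_integral_swap (K_int2 i hf hh ε hε)]
  simp only [e2]
  obtain ⟨D, hD⟩ := bddGx hh ε hε i
  refine integral_mono ?_ ?_ fun y => ?_
  · refine hf.integrable.mul_bdd (c := D) ?_ (Eventually.of_forall fun y => ?_)
    · exact (continuous_const.mul (contGx hh ε hε i)).aestronglyMeasurable
    · rw [norm_mul, Real.norm_eq_abs, hσ, one_mul]; exact hD y
  · refine hf.integrable.mul_bdd (c := D) ?_ (Eventually.of_forall fun y => ?_)
    · exact (contGx hh ε hε i).abs.aestronglyMeasurable
    · rw [Real.norm_eq_abs, abs_abs]; exact hD y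
  · refine mul_le_mul_of_nonneg_left ?_ (hf0 y)
    calc _ ≤ |σ * G h i (pt y ε)| := le_abs_self _
      _ = _ := by rw [abs_mul, hσ, one_mul]

theorem abs_G_le {n : ℕ} (h : Rn n → ℝ) (i : Option (Fin n)) (z : Z n) : |G h i z| ≤ Q h z ^ (1/2:ℝ) := by
  rw [← Real.sqrt_eq_rpow]
  refine Real.abs_le_sqrt ?_
  exact Finset.single_le_sum (f := fun k => G h k z ^ 2) (fun _ _ => sq_nonneg _) (Finset.mem_univ i)

theorem Q_half_le {n : ℕ} (h : Rn n → ℝ) (z : Z n) : Q h z ^ (1/2:ℝ) ≤ ∑ i, |G h i z| := by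
  rw [← Real.sqrt_eq_rpow]
  have h0 : 0 ≤ ∑ i, |G h i z| := Finset.sum_nonneg fun _ _ => abs_nonneg _
  refine Real.sqrt_le_iff.2 ⟨h0, ?_⟩
  unfold Q
  rw [sq (∑ i, |G h i z|), Finset.sum_mul]
  refine Finset.sum_le_sum fun i _ => ?_
  rw [← sq_abs, sq]
  exact mul_le_mul_of_nonneg_left (Finset.single_le_sum (f := fun k => |G h k z|) (fun _ _ => abs_nonneg _)
    (Finset.mem_univ i)) (abs_nonneg _)

theorem dual_BC {n : ℕ} (X : BFSNorm n) (C : ℝ≥0) (hC : ∀ (h : Rn n → ℝ) (B N : ℝ), BC h B N → ∀ t, 0 < t →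
      X.ρ (fun x => ENNReal.ofReal (Q h (pt x t) ^ (1/2:ℝ))) ≤ C * X.ρ (en h))
    {f v : Rn n → ℝ} {B N B' N' : ℝ} (hf : BC f B N) (hv : BC v B' N')
    (hf0 : ∀ y, 0 ≤ f y) (hv0 : ∀ y, 0 ≤ v y) (c : ℝ≥0) (hc : X.ρ (en v) ≤ c) (ε : ℝ) (hε : 0 < ε) (i) :
    ∫⁻ x, ENNReal.ofReal |G f i (pt x ε)| * ENNReal.ofReal (v x) ≤
      ((C + 1) * (c + 1) : ℝ≥0) * assocNorm X.ρ (fun x => ENNReal.ofReal (f x)) := by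
  have hGc := contGx hf ε hε i
  set h : Rn n → ℝ := fun x => if 0 ≤ G f i (pt x ε) then v x else - v x with hh
  have hha : ∀ x, |h x| = |v x| := fun x => by simp only [hh]; split_ifs <;> simp
  have hhB : BC h B' N' := by
    refine ⟨?_, fun y => by rw [hha]; exact hv.bd y, fun y hy => ?_, hv.hN⟩
    · exact Measurable.ite (measurableSet_le measurable_const hGc.measurable) hv.meas hv.meas.neg
    · simp only [hh, hv.supp y hy]; simp
  have hen : en h = en v := by funext x; rw [en_eq, en_eq, hha]
  have e1 : ∀ x, G f i (pt x ε) * h x = |G f i (pt x ε)| * v x := fun x => by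
    simp only [hh]; split_ifs with h1
    · rw [abs_of_nonneg h1]
    · rw [abs_of_neg (not_le.1 h1)]; ring
  have hd := G_dual i hf hhB hf0 ε hε
  simp only [e1] at hd
  obtain ⟨D, hD⟩ := bddGx hf ε hε i
  obtain ⟨D', hD'⟩ := bddGx hhB ε hε i
  have hGc' := contGx hhB ε hε i
  have i1 : Integrable fun x => |G f i (pt x ε)| * v x :=
    hv.integrable.bdd_mul (c := D) hGc.abs.aestronglyMeasurable
      (Eventually.of_forall fun y => by rw [Real.norm_eq_abs, abs_abs]; exact hD y)
  have i2 : Integrable fun y => f y * |G h i (pt y ε)| :=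
    hf.integrable.mul_bdd (c := D') hGc'.abs.aestronglyMeasurable
      (Eventually.of_forall fun y => by rw [Real.norm_eq_abs, abs_abs]; exact hD' y)
  have hd2 := ENNReal.ofReal_le_ofReal hd
  rw [ofReal_integral_eq_lintegral_ofReal i1 (Eventually.of_forall fun x => mul_nonneg (abs_nonneg _) (hv0 x)),
    ofReal_integral_eq_lintegral_ofReal i2 (Eventually.of_forall fun x => mul_nonneg (hf0 x) (abs_nonneg _))] at hd2
  simp only [ENNReal.ofReal_mul (abs_nonneg _), ENNReal.ofReal_mul (hf0 _)] at hd2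
  refine hd2.trans ?_
  refine (lintegral_mono (g := fun x => ENNReal.ofReal (f x) * ENNReal.ofReal (Q h (pt x ε) ^ (1/2:ℝ)))
    fun x => mul_le_mul_right (ENNReal.ofReal_le_ofReal (abs_G_le h i _)) _).trans ?_
  refine assoc_scale X _ _ ?_ _ (by positivity) ?_
  · exact ENNReal.measurable_ofReal.comp (contQb hhB ε hε (1/2) (by norm_num)).measurable
  · refine (hC h B' N' hhB ε hε).trans ?_
    rw [hen]
    push_cast
    gcongr
    · exact le_self_add
    · exact hc.trans le_self_add

theorem trunc_ex {n : ℕ} (w : Rn n → ℝ≥0∞) (hw : Measurable w) : ∃ v : ℕ → Rn n → ℝ≥0∞,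
    (∀ k, Measurable (v k)) ∧ (∀ k x, v k x ≤ w x) ∧ (∀ k x, v k x ≠ ⊤) ∧ Monotone v ∧
    (∀ x, ⨆ k, v k x = w x) ∧ ∀ k : ℕ, BC (fun x => (v k x).toReal) k k := by
  set v : ℕ → Rn n → ℝ≥0∞ := fun k => (Metric.closedBall (0:Rn n) k).indicator (fun x => min (w x) k) with hv
  have hvm : ∀ k, Measurable (v k) := fun k =>
    (hw.min measurable_const).indicator Metric.isClosed_closedBall.measurableSet
  have hvk : ∀ k x, v k x ≤ k := fun k x => Set.indicator_le' (fun _ _ => min_le_right _ _) (fun _ _ => by simp) x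
  have hvw : ∀ k x, v k x ≤ w x := fun k x => Set.indicator_le' (fun _ _ => min_le_left _ _) (fun _ _ => by simp) x
  have hvt : ∀ k x, v k x ≠ ⊤ := fun k x => ((hvk k x).trans_lt (by simp)).ne
  have hmono : Monotone v := by
    intro k l hkl x
    simp only [hv]
    have hkl' : (k:ℝ) ≤ l := by exact_mod_cast hkl
    refine (Set.indicator_le_indicator_of_subset (Metric.closedBall_subset_closedBall hkl') (fun _ => zero_le) x).trans ?_
    refine Set.indicator_le_indicator ?_
    refine min_le_min le_rfl (by exact_mod_cast hkl)
  have hsup : ∀ x, ⨆ k, v k x = w x := by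
    intro x
    refine le_antisymm (iSup_le fun k => hvw k x) ?_
    refine le_of_forall_lt fun a ha => ?_
    have hat : a ≠ ⊤ := (ha.trans_le le_top).ne
    obtain ⟨k, hk⟩ := exists_nat_gt (max a.toReal ‖x‖)
    have h1 : a < k := by
      rw [← ENNReal.ofReal_toReal hat, ← ENNReal.ofReal_natCast]
      exact (ENNReal.ofReal_lt_ofReal_iff_of_nonneg (by simp)).2 ((le_max_left _ _).trans_lt hk)
    refine lt_of_lt_of_le ?_ (le_iSup (fun k => v k x) k)
    simp only [hv]
    rw [Set.indicator_of_mem (by simpa using (le_max_right _ _).trans hk.le)]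
    exact lt_min ha h1
  have hBC : ∀ k, BC (fun x => (v k x).toReal) k k := fun k => by
    refine ⟨(hvm k).ennreal_toReal, fun y => ?_, fun y hy => ?_, by positivity⟩
    · rw [abs_of_nonneg ENNReal.toReal_nonneg]
      exact (ENNReal.toReal_mono (by simp) (hvk k y)).trans (by simp)
    · simp only [hv]
      rw [Set.indicator_of_notMem (by simpa using hy)]; simp
  exact ⟨v, hvm, hvw, hvt, hmono, hsup, hBC⟩

theorem dual_main {n : ℕ} (X : BFSNorm n) (C : ℝ≥0) (hC : ∀ (h : Rn n → ℝ) (B N : ℝ), BC h B N → ∀ t, 0 < t →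
      X.ρ (fun x => ENNReal.ofReal (Q h (pt x t) ^ (1/2:ℝ))) ≤ C * X.ρ (en h))
    {f : Rn n → ℝ} {B N : ℝ} (hf : BC f B N)
    (hf0 : ∀ y, 0 ≤ f y) (w : Rn n → ℝ≥0∞) (hw : Measurable w) (c : ℝ≥0) (hc : X.ρ w ≤ c) (ε : ℝ) (hε : 0 < ε) :
    ∫⁻ x, ENNReal.ofReal (Q f (pt x ε) ^ (1/2:ℝ)) * w x ≤
      ((n + 1) * ((C + 1) * (c + 1)) : ℝ≥0) * assocNorm X.ρ (fun x => ENNReal.ofReal (f x)) := by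
  obtain ⟨v, hvm, hvw, hvt, hmono, hsup, hBC⟩ := trunc_ex w hw
  have hQm : Measurable fun x => ENNReal.ofReal (Q f (pt x ε) ^ (1/2:ℝ)) :=
    ENNReal.measurable_ofReal.comp (contQb hf ε hε (1/2) (by norm_num)).measurable
  have hk : ∀ k, ∫⁻ x, ENNReal.ofReal (Q f (pt x ε) ^ (1/2:ℝ)) * v k x ≤
      ((n + 1) * ((C + 1) * (c + 1)) : ℝ≥0) * assocNorm X.ρ (fun x => ENNReal.ofReal (f x)) := by
    intro k
    have hen : en (fun x => (v k x).toReal) = v k := by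
      funext x; rw [en_eq, abs_of_nonneg ENNReal.toReal_nonneg, ENNReal.ofReal_toReal (hvt k x)]
    have hρ : X.ρ (en (fun x => (v k x).toReal)) ≤ c := by
      rw [hen]; exact (X.mono _ _ (Eventually.of_forall (hvw k))).trans hc
    have hi := fun i => dual_BC X C hC hf (hBC k) hf0 (fun _ => ENNReal.toReal_nonneg) c hρ ε hε i
    simp only [ENNReal.ofReal_toReal (hvt k _)] at hi
    calc _ ≤ ∫⁻ x, ∑ i, ENNReal.ofReal |G f i (pt x ε)| * v k x := by
          refine lintegral_mono fun x => ?_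
          rw [← Finset.sum_mul]
          refine mul_le_mul_left ?_ _
          rw [← ENNReal.ofReal_sum_of_nonneg fun _ _ => abs_nonneg _]
          exact ENNReal.ofReal_le_ofReal (Q_half_le f _)
      _ = ∑ i, ∫⁻ x, ENNReal.ofReal |G f i (pt x ε)| * v k x := by
          refine lintegral_finset_sum _ fun i _ => ?_
          exact (ENNReal.measurable_ofReal.comp (contGx hf ε hε i).abs.measurable).mul (hvm k)
      _ ≤ ∑ i : Option (Fin n), ((C + 1) * (c + 1) : ℝ≥0) * assocNorm X.ρ (fun x => ENNReal.ofReal (f x)) :=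
          Finset.sum_le_sum fun i _ => hi i
      _ = _ := by
          rw [Finset.sum_const, Finset.card_univ, Fintype.card_option, Fintype.card_fin, nsmul_eq_mul]
          push_cast; ring
  have : ∀ x, ENNReal.ofReal (Q f (pt x ε) ^ (1/2:ℝ)) * w x = ⨆ k, ENNReal.ofReal (Q f (pt x ε) ^ (1/2:ℝ)) * v k x :=
    fun x => by rw [← ENNReal.mul_iSup, hsup]
  simp only [this]
  rw [lintegral_iSup (f := fun k x => ENNReal.ofReal (Q f (pt x ε) ^ (1/2:ℝ)) * v k x) (fun k => hQm.mul (hvm k)) fun k l hkl x => mul_le_mul_right (hmono hkl x) _]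
  exact iSup_le hk

end RW

namespace RW

theorem max_meas {n : ℕ} (φ : Rn n → ℝ≥0∞) : Measurable (maximal φ) := by
  refine LowerSemicontinuous.measurable ?_
  intro x lam hlam
  unfold maximal at hlam
  simp only [lt_iSup_iff] at hlam
  obtain ⟨c, r, hr, hx, h⟩ := hlam
  have hv : Tendsto (fun s : ℝ => (volume (Cube c s))⁻¹ * ∫⁻ y in Cube c r, φ y) (𝓝[>] r)
      (𝓝 ((volume (Cube c r))⁻¹ * ∫⁻ y in Cube c r, φ y)) := by
    refine ENNReal.Tendsto.mul_const ?_ (Or.inl (ENNReal.inv_ne_zero.2 (cube_vol_ne_top c r)))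
    simp only [cube_vol]
    refine Tendsto.mono_left ?_ nhdsWithin_le_nhds
    have : Continuous fun s : ℝ => (ENNReal.ofReal (2 * s) ^ n)⁻¹ := by
      have h2 : Continuous fun s : ℝ => ENNReal.ofReal (2 * s) :=
        ENNReal.continuous_ofReal.comp (by fun_prop)
      exact ((ENNReal.continuous_pow n).comp h2).inv
    exact this.tendsto r
  have h1 := (hv.eventually (lt_mem_nhds h)).and self_mem_nhdsWithin
  obtain ⟨s, hs1, hs2⟩ := h1.exists
  have hs2' : r < s := hs2
  filter_upwards [Metric.ball_mem_nhds x (sub_pos.2 hs2')] with y hy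
  refine lt_of_lt_of_le hs1 (le_trans ?_ (max_ge φ y c s (hr.trans hs2') fun i => ?_))
  · refine mul_le_mul_right (lintegral_mono_set fun z hz i => (hz i).trans hs2'.le) _
  · have a1 := hx i
    have a2 := abs_coord_le (y - x) i
    rw [Metric.mem_ball, dist_eq_norm] at hy
    calc |y i - c i| = |(y - x) i + (x i - c i)| := by simp
      _ ≤ |(y - x) i| + |x i - c i| := abs_add_le _ _
      _ ≤ s := by linarith

theorem weak_cube {n : ℕ} (φ w : Rn n → ℝ≥0∞) (hφ : Measurable φ) (hw : Measurable w) (A : ℝ≥0)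
    (hA : ∀ x, maximal w x ≤ A * w x) (lam : ℝ≥0∞) (c : Rn n) (r : ℝ) (hr : 0 < r)
    (h : lam * volume (Cube c r) ≤ ∫⁻ y in Cube c r, φ y) :
    lam * ∫⁻ y in Cube c (5 * r), w y ≤ 5 ^ n * A * ∫⁻ y in Cube c r, φ y * w y := by
  set I := ∫⁻ y in Cube c (5 * r), w y with hI
  have hv5 : volume (Cube c (5 * r)) = 5 ^ n * volume (Cube c r) := by
    rw [cube_vol, cube_vol, show 2 * (5 * r) = 5 * (2 * r) by ring, ENNReal.ofReal_mul (by norm_num), mul_pow]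
    simp
  have h1 : ∀ y ∈ Cube c r, I ≤ 5 ^ n * volume (Cube c r) * (A * w y) := fun y hy => by
    rw [← hv5]
    refine (max_ge' w y c (5 * r) (by positivity) fun i => (hy i).trans (by linarith)).trans ?_
    exact mul_le_mul_right (hA y) _
  have h2 : volume (Cube c r) * (lam * I) ≤ volume (Cube c r) * (5 ^ n * A * ∫⁻ y in Cube c r, φ y * w y) := by
    calc volume (Cube c r) * (lam * I) = (lam * volume (Cube c r)) * I := by ring
      _ ≤ (∫⁻ y in Cube c r, φ y) * I := by gcongr
      _ = ∫⁻ y in Cube c r, φ y * I := (lintegral_mul_const _ hφ).symm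
      _ ≤ ∫⁻ y in Cube c r, (volume (Cube c r) * (5 ^ n * A)) * (φ y * w y) := by
          refine setLIntegral_mono (by fun_prop) fun y hy => ?_
          calc _ ≤ φ y * (5 ^ n * volume (Cube c r) * (A * w y)) := by gcongr; exact h1 y hy
            _ = _ := by ring
      _ = _ := by rw [lintegral_const_mul _ (by fun_prop)]; ring
  exact (ENNReal.mul_le_mul_iff_right (cube_vol_ne_zero c r hr) (cube_vol_ne_top c r)).1 h2

theorem weak_R {n : ℕ} (φ w : Rn n → ℝ≥0∞) (hφ : Measurable φ) (hw : Measurable w) (A : ℝ≥0)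
    (hA : ∀ x, maximal w x ≤ A * w x) (lam : ℝ≥0∞) (R : ℝ) :
    lam * (volume.withDensity w) (⋃ a ∈ {a : Rn n × ℝ | 0 < a.2 ∧ a.2 ≤ R ∧
      lam * volume (Cube a.1 a.2) ≤ ∫⁻ y in Cube a.1 a.2, φ y}, Cube a.1 a.2) ≤ 5 ^ n * A * ∫⁻ y, φ y * w y := by
  set t := {a : Rn n × ℝ | 0 < a.2 ∧ a.2 ≤ R ∧
      lam * volume (Cube a.1 a.2) ≤ ∫⁻ y in Cube a.1 a.2, φ y} with ht
  obtain ⟨u, hut, hd, hu⟩ := Vitali.exists_disjoint_subfamily_covering_enlargement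
    (fun a : Rn n × ℝ => Cube a.1 a.2) t (fun a => a.2) 2 (by norm_num) (fun a ha => ha.1.le) R (fun a ha => ha.2.1)
    (fun a ha => ⟨a.1, mem_cube_self _ _ ha.1.le⟩)
  have huc : u.Countable := by
    refine hd.countable_of_nonempty_interior fun a ha => ?_
    refine ⟨a.1, mem_interior.2 ⟨Metric.ball a.1 a.2, fun y hy => ?_, Metric.isOpen_ball, Metric.mem_ball_self (hut ha).1⟩⟩
    exact ball_sub_cube _ _ _ (by rw [Metric.mem_ball, dist_eq_norm] at hy; exact hy.le)
  have hsub : (⋃ a ∈ t, Cube a.1 a.2) ⊆ ⋃ b ∈ u, Cube b.1 (5 * b.2) := by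
    refine Set.iUnion₂_subset fun a ha x hx => ?_
    obtain ⟨b, hb, ⟨z, hza, hzb⟩, hab⟩ := hu a ha
    refine Set.mem_iUnion₂.2 ⟨b, hb, fun i => ?_⟩
    have a1 := hx i
    have a2 := hza i
    have a3 := hzb i
    rw [abs_le] at *
    constructor <;> linarith [a1.1, a1.2, a2.1, a2.2, a3.1, a3.2]
  calc _ ≤ lam * (volume.withDensity w) (⋃ b ∈ u, Cube b.1 (5 * b.2)) := by gcongr
    _ ≤ lam * ∑' b : u, (volume.withDensity w) (Cube b.1.1 (5 * b.1.2)) := by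
        gcongr; exact measure_biUnion_le _ huc _
    _ = ∑' b : u, lam * ∫⁻ y in Cube b.1.1 (5 * b.1.2), w y := by
        rw [ENNReal.tsum_mul_left]
        congr 2; funext b
        exact withDensity_apply _ (cube_meas _ _)
    _ ≤ ∑' b : u, 5 ^ n * A * ∫⁻ y in Cube b.1.1 b.1.2, φ y * w y :=
        ENNReal.tsum_le_tsum fun b => weak_cube φ w hφ hw A hA lam _ _ (hut b.2).1 (hut b.2).2.2
    _ = 5 ^ n * A * ∫⁻ y in ⋃ b ∈ u, Cube b.1 b.2, φ y * w y := by
        rw [ENNReal.tsum_mul_left, lintegral_biUnion huc (fun b _ => cube_meas _ _) hd]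
    _ ≤ _ := by gcongr; exact Measure.restrict_le_self

theorem weak {n : ℕ} (φ w : Rn n → ℝ≥0∞) (hφ : Measurable φ) (hw : Measurable w) (A : ℝ≥0)
    (hA : ∀ x, maximal w x ≤ A * w x) (lam : ℝ≥0∞) :
    lam * (volume.withDensity w) {x | lam < maximal φ x} ≤ 5 ^ n * A * ∫⁻ y, φ y * w y := by
  set U : ℕ → Set (Rn n) := fun R => ⋃ a ∈ {a : Rn n × ℝ | 0 < a.2 ∧ a.2 ≤ R ∧
      lam * volume (Cube a.1 a.2) ≤ ∫⁻ y in Cube a.1 a.2, φ y}, Cube a.1 a.2 with hU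
  have hsub : {x | lam < maximal φ x} ⊆ ⋃ R, U R := by
    intro x hx
    simp only [Set.mem_setOf_eq, maximal, lt_iSup_iff] at hx
    obtain ⟨c, r, hr, hx, h⟩ := hx
    obtain ⟨R, hR⟩ := exists_nat_ge r
    refine Set.mem_iUnion.2 ⟨R, Set.mem_iUnion₂.2 ⟨(c, r), ⟨hr, hR, ?_⟩, hx⟩⟩
    calc lam * volume (Cube c r) ≤ ((volume (Cube c r))⁻¹ * ∫⁻ y in Cube c r, φ y) * volume (Cube c r) := by gcongr
      _ = (volume (Cube c r) * (volume (Cube c r))⁻¹) * ∫⁻ y in Cube c r, φ y := by ring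
      _ = _ := by rw [ENNReal.mul_inv_cancel (cube_vol_ne_zero c r hr) (cube_vol_ne_top c r), one_mul]
  have hmono : Monotone U := by
    intro R R' h
    refine Set.biUnion_subset_biUnion_left fun a ha => ⟨ha.1, ha.2.1.trans (by exact_mod_cast h), ha.2.2⟩
  refine (mul_le_mul_right (measure_mono hsub) _).trans ?_
  rw [hmono.measure_iUnion, ENNReal.mul_iSup]
  exact iSup_le fun R => weak_R φ w hφ hw A hA lam R

theorem max_add_const {n : ℕ} (φ ψ : Rn n → ℝ≥0∞) (a : ℝ≥0∞) (h : ∀ y, φ y ≤ ψ y + a) (x : Rn n) :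
    maximal φ x ≤ maximal ψ x + a := by
  unfold maximal
  refine iSup_le fun c => iSup_le fun r => iSup_le fun hr => iSup_le fun hx => ?_
  calc (volume (Cube c r))⁻¹ * ∫⁻ y in Cube c r, φ y
      ≤ (volume (Cube c r))⁻¹ * ∫⁻ y in Cube c r, (ψ y + a) := by gcongr; exact h _
    _ = (volume (Cube c r))⁻¹ * (∫⁻ y in Cube c r, ψ y) + (volume (Cube c r) * (volume (Cube c r))⁻¹) * a := by
        rw [lintegral_add_right _ measurable_const, setLIntegral_const]; ring
    _ = (volume (Cube c r))⁻¹ * (∫⁻ y in Cube c r, ψ y) + a := by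
        rw [ENNReal.mul_inv_cancel (cube_vol_ne_zero c r hr) (cube_vol_ne_top c r), one_mul]
    _ ≤ _ := by gcongr; exact max_ge ψ x c r hr hx

theorem strong {n : ℕ} (φ : Rn n → ℝ) (w : Rn n → ℝ≥0∞) (hφ : Measurable φ) (hφ0 : ∀ x, 0 ≤ φ x) (D : ℝ)
    (hD : ∀ x, φ x ≤ D) (hw : Measurable w) (A : ℝ≥0)
    (hA : ∀ x, maximal w x ≤ A * w x) (p : ℝ) (hp : 1 < p) :
    ∫⁻ x, maximal (fun y => ENNReal.ofReal (φ y)) x ^ p * w x ≤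
      ENNReal.ofReal p * (2 * 5 ^ n * A) * (ENNReal.ofReal (p - 1))⁻¹ * ENNReal.ofReal (2 ^ (p - 1)) *
        ∫⁻ x, ENNReal.ofReal (φ x ^ p) * w x := by
  set F := fun y => ENNReal.ofReal (φ y) with hF
  have hFm : Measurable F := hφ.ennreal_ofReal
  have hMt : ∀ x, maximal F x ≠ ⊤ := fun x => by
    have h1 := max_add_const F (fun _ => 0) (ENNReal.ofReal D) (fun y => by
      simp only [hF, zero_add]; exact ENNReal.ofReal_le_ofReal (hD y)) x
    refine (h1.trans_lt (ENNReal.add_lt_top.2 ⟨?_, by simp⟩)).ne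
    simp [maximal]
  set ν := (volume : Measure (Rn n)).withDensity w with hν
  set μ := ν.withDensity F with hμ
  have hMm := max_meas F
  have e1 : ∫⁻ x, maximal F x ^ p * w x = ∫⁻ x, ENNReal.ofReal ((maximal F x).toReal ^ p) ∂ν := by
    rw [hν, lintegral_withDensity_eq_lintegral_mul _ hw (by fun_prop)]
    refine lintegral_congr fun x => ?_
    rw [Pi.mul_apply, mul_comm, ← ENNReal.ofReal_rpow_of_nonneg ENNReal.toReal_nonneg (by linarith),
      ENNReal.ofReal_toReal (hMt x)]
  rw [e1, lintegral_rpow_eq_lintegral_meas_lt_mul ν (Eventually.of_forall fun _ => ENNReal.toReal_nonneg)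
    hMm.ennreal_toReal.aemeasurable (by linarith)]
  have key : ∀ t : ℝ, 0 < t → ν {a | t < (maximal F a).toReal} * ENNReal.ofReal (t ^ (p - 1)) ≤
      (2 * 5 ^ n * A) * (μ {a | t < 2 * φ a} * ENNReal.ofReal (t ^ (p - 1 - 1))) := by
    intro t ht
    have hE : MeasurableSet {a | t < 2 * φ a} := measurableSet_lt measurable_const (by fun_prop)
    set ψ := Set.indicator {a | t < 2 * φ a} F with hψ
    have hψm : Measurable ψ := hFm.indicator hE
    have s1 : {a | t < (maximal F a).toReal} ⊆ {x | ENNReal.ofReal (t / 2) < maximal ψ x} := by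
      intro x hx
      have hx' : t < (maximal F x).toReal := hx
      have h2 := max_add_const F ψ (ENNReal.ofReal (t / 2)) (fun y => by
        by_cases hy : t < 2 * φ y
        · rw [hψ, Set.indicator_of_mem (by exact hy)]; exact le_self_add
        · rw [hψ, Set.indicator_of_notMem (by exact hy), zero_add]
          exact ENNReal.ofReal_le_ofReal (by linarith)) x
      have h3 : ENNReal.ofReal t < maximal F x := (ENNReal.ofReal_lt_iff_lt_toReal ht.le (hMt x)).2 hx'
      rw [show t = t / 2 + t / 2 by ring, ENNReal.ofReal_add (by positivity) (by positivity)] at h3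
      have h4 := h3.trans_le h2
      exact lt_of_add_lt_add_right h4
    have s2 := weak ψ w hψm hw A hA (ENNReal.ofReal (t / 2))
    have s3 : ∫⁻ y, ψ y * w y = μ {a | t < 2 * φ a} := by
      rw [hμ, withDensity_apply _ hE, ← lintegral_indicator hE, hν,
        lintegral_withDensity_eq_lintegral_mul _ hw hψm]
      refine lintegral_congr fun y => ?_
      rw [Pi.mul_apply, mul_comm]
    rw [s3] at s2
    have ht2 : ENNReal.ofReal (t ^ (p - 1)) = 2 * (ENNReal.ofReal (t / 2) * ENNReal.ofReal (t ^ (p - 1 - 1))) := by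
      rw [← ENNReal.ofReal_mul (by positivity), show (2:ℝ≥0∞) = ENNReal.ofReal 2 by simp, ← ENNReal.ofReal_mul (by norm_num)]
      congr 1
      rw [Real.rpow_sub_one ht.ne' (p - 1)]; field_simp
    calc _ ≤ ν {x | ENNReal.ofReal (t / 2) < maximal ψ x} * ENNReal.ofReal (t ^ (p - 1)) := by gcongr
      _ = 2 * ENNReal.ofReal (t ^ (p - 1 - 1)) * (ENNReal.ofReal (t / 2) * ν {x | ENNReal.ofReal (t / 2) < maximal ψ x}) := by
          rw [ht2]; ring
      _ ≤ 2 * ENNReal.ofReal (t ^ (p - 1 - 1)) * (5 ^ n * A * μ {a | t < 2 * φ a}) := by gcongr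
      _ = _ := by ring
  have hpp : ENNReal.ofReal (p - 1) ≠ 0 := by simpa using hp
  have lc := lintegral_rpow_eq_lintegral_meas_lt_mul μ (f := fun x => 2 * φ x) (Eventually.of_forall fun x => by
    simp only [Pi.zero_apply]; linarith [hφ0 x]) (by fun_prop) (p := p - 1) (by linarith)
  have lc2 : ∫⁻ ω, ENNReal.ofReal ((2 * φ ω) ^ (p - 1)) ∂μ =
      ENNReal.ofReal (2 ^ (p - 1)) * ∫⁻ x, ENNReal.ofReal (φ x ^ p) * w x := by
    rw [hμ, lintegral_withDensity_eq_lintegral_mul _ hFm (by fun_prop), hν,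
      lintegral_withDensity_eq_lintegral_mul _ hw (by fun_prop), ← lintegral_const_mul' _ _ (by simp)]
    refine lintegral_congr fun x => ?_
    simp only [Pi.mul_apply, hF]
    rw [Real.mul_rpow (by norm_num) (hφ0 x), ENNReal.ofReal_mul (by positivity)]
    have : φ x ^ p = φ x * φ x ^ (p - 1) := by
      rcases (hφ0 x).eq_or_lt with h | h
      · rw [← h, Real.zero_rpow (by linarith)]; simp
      · rw [Real.rpow_sub_one h.ne']; field_simp
    rw [this, ENNReal.ofReal_mul (hφ0 x)]; ring
  have hc0 : (2 * 5 ^ n * A : ℝ≥0∞) ≠ ⊤ := by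
    exact ENNReal.mul_ne_top (ENNReal.mul_ne_top (by simp) (by simp)) (by simp)
  calc _ ≤ ENNReal.ofReal p * ∫⁻ t in Set.Ioi (0:ℝ), (2 * 5 ^ n * A) * (μ {a | t < 2 * φ a} * ENNReal.ofReal (t ^ (p - 1 - 1))) := by
        gcongr ENNReal.ofReal p * ?_
        exact setLIntegral_mono' measurableSet_Ioi key
    _ = ENNReal.ofReal p * (2 * 5 ^ n * A) * (((ENNReal.ofReal (p - 1))⁻¹ * ENNReal.ofReal (p - 1)) *
          ∫⁻ t in Set.Ioi (0:ℝ), (μ {a | t < 2 * φ a} * ENNReal.ofReal (t ^ (p - 1 - 1)))) := by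
        rw [lintegral_const_mul' _ _ hc0, ENNReal.inv_mul_cancel hpp (by simp), one_mul]; ring
    _ = _ := by rw [mul_assoc (ENNReal.ofReal (p - 1))⁻¹, ← lc, lc2]; ring

end RW

namespace RW

theorem max_mono {n : ℕ} (φ ψ : Rn n → ℝ≥0∞) (h : ∀ y, φ y ≤ ψ y) (x : Rn n) : maximal φ x ≤ maximal ψ x := by
  simpa using max_add_const φ ψ 0 (by simpa using h) x

theorem max_tsum {n : ℕ} (F : ℕ → Rn n → ℝ≥0∞) (hF : ∀ k, Measurable (F k)) (x : Rn n) :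
    maximal (fun y => ∑' k, F k y) x ≤ ∑' k, maximal (F k) x := by
  refine iSup_le fun c => iSup_le fun r => iSup_le fun hr => iSup_le fun hx => ?_
  rw [lintegral_tsum fun k => (hF k).aemeasurable, ← ENNReal.tsum_mul_left]
  exact ENNReal.tsum_le_tsum fun k => max_ge (F k) x c r hr hx

theorem max_smul {n : ℕ} (F : Rn n → ℝ≥0∞) (hF : Measurable F) (a : ℝ≥0∞) (x : Rn n) :
    maximal (fun y => a * F y) x ≤ a * maximal F x := by
  refine iSup_le fun c => iSup_le fun r => iSup_le fun hr => iSup_le fun hx => ?_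
  rw [lintegral_const_mul _ hF, mul_left_comm]
  exact mul_le_mul_right (max_ge F x c r hr hx) _

theorem rho_tsum {n : ℕ} (X : BFSNorm n) (F : ℕ → Rn n → ℝ≥0∞) :
    X.ρ (fun x => ∑' k, F k x) ≤ ∑' k, X.ρ (F k) := by
  rw [X.sup_eq (fun N x => ∑ k ∈ Finset.range N, F k x) (fun x => ∑' k, F k x)]
  · refine iSup_le fun N => (rho_sum X _ _).trans (ENNReal.sum_le_tsum _)
  · refine Eventually.of_forall fun x N N' h => ?_
    exact Finset.sum_le_sum_of_subset (Finset.range_mono h)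
  · exact Eventually.of_forall fun x => ENNReal.tsum_eq_iSup_nat.symm

theorem A1 {n : ℕ} (X : BFSNorm n) (C : ℝ≥0) (hC0 : 0 < C)
    (hC : ∀ f : Rn n → ℝ≥0∞, Measurable f → X.ρ (maximal f) ≤ (C : ℝ≥0∞) * X.ρ f)
    (g : Rn n → ℝ≥0∞) (hg : Measurable g) (hg1 : X.ρ g ≤ 1) :
    ∃ w : Rn n → ℝ≥0∞, Measurable w ∧ (∀ x, g x ≤ w x) ∧ X.ρ w ≤ (2 : ℝ≥0) ∧
      ∀ x, maximal w x ≤ (2 * C : ℝ≥0) * w x := by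
  set H : ℕ → Rn n → ℝ≥0∞ := fun k => maximal^[k] g with hH
  have hH1 : ∀ k, H (k + 1) = maximal (H k) := fun k => Function.iterate_succ_apply' _ _ _
  have hHm : ∀ k, Measurable (H k) := fun k => by
    cases k with
    | zero => exact hg
    | succ k => rw [hH1]; exact max_meas _
  have hHr : ∀ k, X.ρ (H k) ≤ ((C ^ k : ℝ≥0) : ℝ≥0∞) := fun k => by
    induction k with
    | zero => simp only [pow_zero, ENNReal.coe_one]; exact hg1
    | succ k ih =>
      rw [hH1, pow_succ', ENNReal.coe_mul]
      exact (hC _ (hHm k)).trans (by gcongr)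
  set a : ℝ≥0 := (2 * C)⁻¹ with ha
  have hsm : ∀ k, Measurable fun x => ((a ^ k : ℝ≥0) : ℝ≥0∞) * H k x := fun k => (hHm k).const_mul _
  refine ⟨fun x => ∑' k, ((a ^ k : ℝ≥0) : ℝ≥0∞) * H k x, Measurable.ennreal_tsum hsm, fun x => ?_, ?_, fun x => ?_⟩
  · refine le_trans ?_ (ENNReal.le_tsum 0)
    simp [hH]
  · refine (rho_tsum X _).trans ?_
    calc ∑' k, X.ρ (fun x => ((a ^ k : ℝ≥0) : ℝ≥0∞) * H k x) ≤ ∑' k : ℕ, (2⁻¹ : ℝ≥0∞) ^ k := by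
          refine ENNReal.tsum_le_tsum fun k => ?_
          rw [X.smul]
          refine (mul_le_mul_right (hHr k) _).trans (le_of_eq ?_)
          rw [← ENNReal.coe_mul, ← mul_pow]
          have : a * C = 2⁻¹ := by rw [ha]; field_simp
          rw [this, ENNReal.coe_pow, ENNReal.coe_inv (by norm_num)]; simp
      _ = ((2:ℝ≥0) : ℝ≥0∞) := by rw [ENNReal.tsum_geometric, ENNReal.one_sub_inv_two, inv_inv]; simp
  · refine (max_tsum _ hsm x).trans ?_
    calc ∑' k, maximal (fun x => ((a ^ k : ℝ≥0) : ℝ≥0∞) * H k x) x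
        ≤ ∑' k, ((2 * C : ℝ≥0) : ℝ≥0∞) * (((a ^ (k + 1) : ℝ≥0) : ℝ≥0∞) * H (k + 1) x) := by
          refine ENNReal.tsum_le_tsum fun k => (max_smul _ (hHm k) _ x).trans (le_of_eq ?_)
          rw [← hH1, ← mul_assoc, ← ENNReal.coe_mul]
          congr 2
          rw [pow_succ', ← mul_assoc, ha, mul_inv_cancel₀ (by positivity), one_mul]
      _ = ((2 * C : ℝ≥0) : ℝ≥0∞) * ∑' k, (((a ^ (k + 1) : ℝ≥0) : ℝ≥0∞) * H (k + 1) x) := ENNReal.tsum_mul_left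
      _ ≤ _ := by
          gcongr
          exact ENNReal.tsum_comp_le_tsum_of_injective (add_left_injective 1)
            (fun k => ((a ^ k : ℝ≥0) : ℝ≥0∞) * H k x)

theorem cube_bd {n : ℕ} (hn : 1 ≤ n) {f : Rn n → ℝ} {B N : ℝ} (hf : BC f B N) (hf0 : ∀ y, 0 ≤ f y)
    (x c : Rn n) (r ε : ℝ) (hε : 0 < ε) (hr : ε < r) (hx : x ∈ Cube c r) :
    (volume (Cube c r))⁻¹ * ∫⁻ y in Cube c r, ENNReal.ofReal (f y) ≤
      ENNReal.ofReal ((4 * n + 1) ^ mm n) * ((ENNReal.ofReal (cc n))⁻¹ * ENNReal.ofReal (2 ^ (2 * n + 2))) ^ (((n:ℝ) + 1) / n) *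
        maximal (fun y => ENNReal.ofReal (Q f (pt y ε) ^ ((n:ℝ) / (2 * (n + 1))))) x ^ (((n:ℝ) + 1) / n) := by
  have hn' : (0:ℝ) < n := by exact_mod_cast hn
  refine (avg_le hf hf0 x c r (hε.trans hr) hx).trans ?_
  rw [mul_assoc]
  refine mul_le_mul_right ?_ _
  set b : ℝ := (n:ℝ) / (2 * (n + 1)) with hb
  have hb0 : 0 ≤ b := by positivity
  have h1 := SW' hn hf b (by positivity) (by rw [hb]; field_simp; nlinarith) ε (r - ε) hε (by linarith) x
  have hm : Measurable fun y => ENNReal.ofReal (Q f (pt y ε) ^ b) :=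
    (contQb hf ε hε b hb0).measurable.ennreal_ofReal
  have h2 := h1.trans (poisson_le_max (fun y => ENNReal.ofReal (Q f (pt y ε) ^ b)) hm x (r - ε) (by linarith))
  rw [sub_add_cancel] at h2
  have hcc : ENNReal.ofReal (cc n) ≠ 0 := by simpa using cc_pos n
  have h3 : ENNReal.ofReal (Q f (pt x r) ^ b) ≤ ((ENNReal.ofReal (cc n))⁻¹ * ENNReal.ofReal (2 ^ (2 * n + 2))) *
      maximal (fun y => ENNReal.ofReal (Q f (pt y ε) ^ b)) x := by
    calc _ = (ENNReal.ofReal (cc n))⁻¹ * (ENNReal.ofReal (cc n) * ENNReal.ofReal (Q f (pt x r) ^ b)) := by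
          rw [← mul_assoc, ENNReal.inv_mul_cancel hcc (by simp), one_mul]
      _ ≤ _ := by rw [mul_assoc]; gcongr
  rw [← ENNReal.mul_rpow_of_nonneg _ _ (by positivity)]
  refine le_trans (le_of_eq ?_) (ENNReal.rpow_le_rpow h3 (by positivity))
  have hq := Q_nonneg f (pt x r)
  rw [ENNReal.ofReal_rpow_of_nonneg (by positivity) (by positivity), ← Real.rpow_mul hq]
  congr 2
  rw [hb]; field_simp

theorem main_BC {n : ℕ} (hn : 1 ≤ n) (X : BFSNorm n) (C A : ℝ≥0) (hC : ∀ (h : Rn n → ℝ) (B N : ℝ), BC h B N → ∀ t, 0 < t →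
      X.ρ (fun x => ENNReal.ofReal (Q h (pt x t) ^ (1/2:ℝ))) ≤ C * X.ρ (en h)) :
    ∃ C' : ℝ≥0, ∀ w : Rn n → ℝ≥0∞, Measurable w → X.ρ w ≤ (2 : ℝ≥0) → (∀ x, maximal w x ≤ A * w x) →
      ∀ (f : Rn n → ℝ) (B N : ℝ), BC f B N → (∀ y, 0 ≤ f y) →
      ∫⁻ x, maximal (fun y => ENNReal.ofReal (f y)) x * w x ≤ C' * assocNorm X.ρ (fun y => ENNReal.ofReal (f y)) := by
  have hn' : (0:ℝ) < n := by exact_mod_cast hn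
  set p : ℝ := ((n:ℝ) + 1) / n with hp
  have hp1 : 1 < p := by rw [hp, lt_div_iff₀ hn']; linarith
  set b : ℝ := (n:ℝ) / (2 * (n + 1)) with hb
  have hb0 : 0 ≤ b := by positivity
  set c1 : ℝ≥0∞ := ENNReal.ofReal ((4 * n + 1) ^ mm n) * ((ENNReal.ofReal (cc n))⁻¹ * ENNReal.ofReal (2 ^ (2 * n + 2))) ^ p with hc1
  have hcc : ENNReal.ofReal (cc n) ≠ 0 := by simpa using cc_pos n
  have hc1t : c1 ≠ ⊤ := by
    refine ENNReal.mul_ne_top (by simp) (ENNReal.rpow_ne_top_of_nonneg (by linarith) ?_)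
    exact ENNReal.mul_ne_top (ENNReal.inv_ne_top.2 hcc) (by simp)
  set c2 : ℝ≥0∞ := ENNReal.ofReal p * (2 * 5 ^ n * A) * (ENNReal.ofReal (p - 1))⁻¹ * ENNReal.ofReal (2 ^ (p - 1)) with hc2
  have hc2t : c2 ≠ ⊤ := by
    have hpp : ENNReal.ofReal (p - 1) ≠ 0 := by simpa using hp1
    have : (2 * 5 ^ n * A : ℝ≥0∞) ≠ ⊤ :=
      ENNReal.mul_ne_top (ENNReal.mul_ne_top (by simp) (by simp)) (by simp)
    exact ENNReal.mul_ne_top (ENNReal.mul_ne_top (ENNReal.mul_ne_top (by simp) this) (ENNReal.inv_ne_top.2 hpp)) (by simp)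
  set c3 : ℝ≥0 := (n + 1) * ((C + 1) * (2 + 1)) with hc3
  refine ⟨c1.toNNReal * c2.toNNReal * c3, fun w hw hw2 hwA f B N hf hf0 => ?_⟩
  push_cast
  rw [ENNReal.coe_toNNReal hc1t, ENNReal.coe_toNNReal hc2t]
  set ε : ℕ → ℝ := fun k => 1 / ((k:ℝ) + 1) with hε
  have hε0 : ∀ k, 0 < ε k := fun k => by simp only [hε]; positivity
  set φ : ℕ → Rn n → ℝ := fun k x => Q f (pt x (ε k)) ^ b with hφ
  set W : ℕ → Rn n → ℝ≥0∞ := fun k x => c1 * maximal (fun y => ENNReal.ofReal (φ k y)) x ^ p * w x with hW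
  have hWm : ∀ k, Measurable (W k) := fun k => (((max_meas _).pow_const p).const_mul _).mul hw
  have s1 : ∀ x, maximal (fun y => ENNReal.ofReal (f y)) x * w x ≤ liminf (fun k => W k x) atTop := by
    intro x
    simp only [maximal, ENNReal.iSup_mul]
    refine iSup_le fun c => iSup_le fun r => iSup_le fun hr => iSup_le fun hx => ?_
    have hev : ∀ᶠ k in atTop, ε k < r :=
      (tendsto_one_div_add_atTop_nhds_zero_nat (𝕜 := ℝ)).eventually (gt_mem_nhds hr)
    refine le_liminf_of_le (by isBoundedDefault) (hev.mono fun k hk => ?_)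
    exact mul_le_mul_left (cube_bd hn hf hf0 x c r (ε k) (hε0 k) hk hx) _
  have s2 : ∀ k, ∫⁻ x, W k x ≤ c1 * c2 * c3 * assocNorm X.ρ (fun y => ENNReal.ofReal (f y)) := by
    intro k
    have hφ0 : ∀ x, 0 ≤ φ k x := fun x => Real.rpow_nonneg (Q_nonneg _ _) _
    obtain ⟨D, hD⟩ := bddQb hf (ε k) (hε0 k) b hb0
    have h1 := strong (φ k) w (contQb hf (ε k) (hε0 k) b hb0).measurable hφ0 D
      (fun x => (le_abs_self _).trans (hD x)) hw A hwA p hp1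
    have h2 := dual_main X C hC hf hf0 w hw 2 hw2 (ε k) (hε0 k)
    have h3 : ∀ x, φ k x ^ p = Q f (pt x (ε k)) ^ (1/2:ℝ) := fun x => by
      simp only [hφ]
      rw [← Real.rpow_mul (Q_nonneg _ _)]
      congr 1
      rw [hb, hp]; field_simp
    simp only [h3] at h1
    simp only [hW, mul_assoc c1]
    rw [lintegral_const_mul' _ _ hc1t, mul_assoc c2]
    refine mul_le_mul_right (h1.trans ?_) _
    exact mul_le_mul_right h2 _
  calc _ ≤ ∫⁻ x, liminf (fun k => W k x) atTop := lintegral_mono s1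
    _ ≤ liminf (fun k => ∫⁻ x, W k x) atTop := lintegral_liminf_le hWm
    _ ≤ liminf (fun k : ℕ => c1 * c2 * c3 * assocNorm X.ρ (fun y => ENNReal.ofReal (f y))) atTop :=
        liminf_le_liminf (Eventually.of_forall s2)
    _ = _ := by simp

theorem main_gen {n : ℕ} (X : BFSNorm n) (C' : ℝ≥0∞) (w : Rn n → ℝ≥0∞) (hw : Measurable w)
    (h : ∀ (f : Rn n → ℝ) (B N : ℝ), BC f B N → (∀ y, 0 ≤ f y) →
      ∫⁻ x, maximal (fun y => ENNReal.ofReal (f y)) x * w x ≤ C' * assocNorm X.ρ (fun y => ENNReal.ofReal (f y)))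
    (f : Rn n → ℝ≥0∞) (hf : Measurable f) :
    ∫⁻ x, maximal f x * w x ≤ C' * assocNorm X.ρ f := by
  obtain ⟨v, hvm, hvw, hvt, hmono, hsup, hBC⟩ := trunc_ex f hf
  have s1 : ∀ x, maximal f x * w x ≤ ⨆ k, maximal (v k) x * w x := by
    intro x
    rw [← ENNReal.iSup_mul]
    refine mul_le_mul_left ?_ _
    refine iSup_le fun c => iSup_le fun r => iSup_le fun hr => iSup_le fun hx => ?_
    simp only [← hsup]
    rw [lintegral_iSup hvm hmono, ENNReal.mul_iSup]
    exact iSup_mono fun k => max_ge (v k) x c r hr hx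
  refine (lintegral_mono s1).trans ?_
  rw [lintegral_iSup (f := fun k x => maximal (v k) x * w x) (fun k => (max_meas _).mul hw)
    fun k l hkl x => mul_le_mul_left (max_mono _ _ (hmono hkl) x) _]
  refine iSup_le fun k => ?_
  have h1 := h _ _ _ (hBC k) fun _ => ENNReal.toReal_nonneg
  simp only [ENNReal.ofReal_toReal (hvt k _)] at h1
  refine h1.trans (mul_le_mul_right ?_ _)
  unfold assocNorm
  gcongr
  exact hvw k _

theorem main0 (f : Rn 0 → ℝ≥0∞) (x : Rn 0) : maximal f x ≤ f x := by
  refine iSup_le fun c => iSup_le fun r => iSup_le fun hr => iSup_le fun hx => ?_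
  have : ∀ y, f y = f x := fun y => by rw [Subsingleton.elim y x]
  simp only [this]
  rw [setLIntegral_const, mul_left_comm, ENNReal.inv_mul_cancel (cube_vol_ne_zero c r hr) (cube_vol_ne_top c r), mul_one]

theorem main {n : ℕ} (X : BFSNorm n)
    (hM : ∃ C : ℝ≥0, 0 < C ∧ ∀ f : Rn n → ℝ≥0∞, Measurable f →
      X.ρ (maximal f) ≤ (C : ℝ≥0∞) * X.ρ f)
    (hR : ∀ j : Fin n, ∃ C : ℝ≥0, 0 < C ∧ ∀ f : Rn n → ℝ, Measurable f →
      X.normR f < ⊤ →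
      (∀ᵐ x ∂volume,
        Tendsto (fun ε => rieszTrunc j ε f x) (𝓝[>] (0 : ℝ)) (𝓝 (rieszPV j f x))) ∧
      X.normR (rieszPV j f) ≤ (C : ℝ≥0∞) * X.normR f) :
    ∃ C' : ℝ≥0, 0 < C' ∧ ∀ f : Rn n → ℝ≥0∞, Measurable f →
      assocNorm X.ρ (maximal f) ≤ (C' : ℝ≥0∞) * assocNorm X.ρ f := by
  rcases Nat.eq_zero_or_pos n with rfl | hn
  · refine ⟨1, one_pos, fun f hf => ?_⟩
    rw [ENNReal.coe_one, one_mul]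
    unfold assocNorm
    gcongr
    exact main0 f _
  · obtain ⟨C, hC⟩ := RB hn X hM hR
    obtain ⟨CM, hCM0, hCM⟩ := hM
    obtain ⟨C', hC'⟩ := main_BC hn X C (2 * CM) hC
    refine ⟨C' + 1, by positivity, fun f hf => ?_⟩
    refine iSup_le fun g => iSup_le fun hg => iSup_le fun hg1 => ?_
    obtain ⟨w, hw, hgw, hw2, hwA⟩ := A1 X CM hCM0 hCM g hg hg1
    calc _ ≤ ∫⁻ x, maximal f x * w x := by gcongr; exact hgw _
      _ ≤ C' * assocNorm X.ρ f := main_gen X C' w hw (hC' w hw hw2 hwA) f hf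
      _ ≤ _ := by gcongr; simp

end RW

/-- Lemma 5.3, after Rutsky. If the maximal operator `M`
and all Riesz transforms `R_j` are bounded on a BFS `X`, then `M` is bounded
on the associate space `X'`. -/
theorem maximal_bounded_on_assoc_of_riesz_bounded (n : ℕ) (X : BFSNorm n)
    (hM : ∃ C : ℝ≥0, 0 < C ∧ ∀ f : Rn n → ℝ≥0∞, Measurable f →
      X.ρ (maximal f) ≤ (C : ℝ≥0∞) * X.ρ f)
    (hR : ∀ j : Fin n, ∃ C : ℝ≥0, 0 < C ∧ ∀ f : Rn n → ℝ, Measurable f →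
      X.normR f < ⊤ →
      (∀ᵐ x ∂volume,
        Tendsto (fun ε => rieszTrunc j ε f x) (𝓝[>] (0 : ℝ)) (𝓝 (rieszPV j f x))) ∧
      X.normR (rieszPV j f) ≤ (C : ℝ≥0∞) * X.normR f) :
    ∃ C' : ℝ≥0, 0 < C' ∧ ∀ f : Rn n → ℝ≥0∞, Measurable f →
      assocNorm X.ρ (maximal f) ≤ (C' : ℝ≥0∞) * assocNorm X.ρ f := by
  exact RW.main X hM hR
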